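/- arXiv:2504.14711 — 4 statements merged into one kernel-verified Lean document; each statement's English description precedes it below -/
import Mathlib

section
/- Let G be a graph with |V(G)| ≥ Δ(G)³. Then G is equitably k-choosable for every k ≥ Δ(G) + 2. -/
/-- `G` is equitably `L`-colorable for a `k`-list assignment `L`: there is a proper
coloring `f` with `f v ∈ L v` for every vertex in which every color class has at most
`⌈|V(G)|/k⌉` vertices. -/
def EquitablyLColorable {V : Type*} [Fintype V] (G : SimpleGraph V) (k : ℕ)
    (L : V → Finset ℕ) : Prop :=
  ∃ f : V → ℕ, (∀ v : V, f v ∈ L v) ∧ (∀ ⦃u v : V⦄, G.Adj u v → f u ≠ f v) ∧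
    ∀ c : ℕ, (Finset.univ.filter fun v => f v = c).card ≤ (Fintype.card V + k - 1) / k

/-- `G` is equitably `k`-choosable: it is equitably `L`-colorable for every `k`-list
assignment `L`. -/
def EquitablyChoosable {V : Type*} [Fintype V] (G : SimpleGraph V) (k : ℕ) : Prop :=
  ∀ L : V → Finset ℕ, (∀ v : V, (L v).card = k) → EquitablyLColorable G k L

namespace EquitableList

open Finset

open scoped Classical

section Defs

variable {V : Type*} [Fintype V] (G : SimpleGraph V) (L : V → Finset ℕ) (s : ℕ)

/-- The vertices coloured `c` by the partial colouring `f`. -/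
noncomputable def colorClass (f : V → Option ℕ) (c : ℕ) : Finset V :=
  univ.filter fun u => f u = some c

/-- `f` is a proper `L`-colouring of `G - v` whose colour classes have at most `s` vertices. -/
structure NearColoring (f : V → Option ℕ) (v : V) : Prop where
  none_iff : ∀ u, f u = none ↔ u = v
  mem : ∀ u c, f u = some c → c ∈ L u
  proper : ∀ u x c, G.Adj u x → f u = some c → f x ≠ some c
  card_le : ∀ c, (colorClass f c).card ≤ s

/-- `G` has a proper `L`-colouring whose colour classes have at most `s` vertices. -/
def BoundedColorable : Prop :=
  ∃ f : V → ℕ, (∀ v, f v ∈ L v) ∧ (∀ ⦃u v⦄, G.Adj u v → f u ≠ f v) ∧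
    ∀ c, (univ.filter fun v => f v = c).card ≤ s

/-- The colour `c` is in the list of `u` and does not occur on the neighbours of `u`. -/
def Free (f : V → Option ℕ) (u : V) (c : ℕ) : Prop :=
  c ∈ L u ∧ ∀ x, G.Adj u x → f x ≠ some c

/-- Colours that can be reached from the uncoloured vertex `v` by at most `n` moves. -/
def ReachIn (f : V → Option ℕ) (v : V) : ℕ → ℕ → Prop
  | 0, _ => False
  | n + 1, a => ReachIn f v n a ∨ Free G L f v a ∨
      ∃ u c, f u = some c ∧ ReachIn f v n c ∧ Free G L f u a

/-- Colours that can be reached from the uncoloured vertex `v`. -/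
def Reach (f : V → Option ℕ) (v : V) (a : ℕ) : Prop := ∃ n, ReachIn G L f v n a

/-- Colours from which a class with fewer than `s` vertices can be reached by at most `n` moves. -/
def AccIn (f : V → Option ℕ) : ℕ → ℕ → Prop
  | 0, c => (colorClass f c).card < s
  | n + 1, c => AccIn f n c ∨ ∃ u d, f u = some c ∧ Free G L f u d ∧ AccIn f n d

/-- Colours from which a class with fewer than `s` vertices can be reached. -/
def Acc (f : V → Option ℕ) (c : ℕ) : Prop := ∃ n, AccIn G L s f n c

/-- The colours occurring in the lists from which no small class can be reached. -/
noncomputable def blocked (f : V → Option ℕ) : Finset ℕ :=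
  (univ.biUnion L).filter fun c => ¬ Acc G L s f c

/-- Colour `u` with `c` and uncolour `y`. -/
noncomputable def displace (f : V → Option ℕ) (u : V) (c : ℕ) (y : V) : V → Option ℕ :=
  fun x => if x = y then none else if x = u then some c else f x

/-- A near colouring of a graph without bounded colouring, with as few blocked colours as
possible. -/
structure Critical (f : V → Option ℕ) (v : V) : Prop where
  near : NearColoring G L s f v
  not_colorable : ¬ BoundedColorable G L s
  minimal : ∀ g w, NearColoring G L s g w → (blocked G L s f).card ≤ (blocked G L s g).card

end Defs

section Moves

variable {V : Type*} {G : SimpleGraph V} {L : V → Finset ℕ} {s : ℕ}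
  {f : V → Option ℕ} {u v w x y : V} {c d : ℕ}

lemma displace_eq_some_of_ne (hu : f u = none) (hy : f y = some c) (hd : d ≠ c) :
    displace f u c y x = some d ↔ f x = some d := by
  unfold displace
  split_ifs with h1 h2
  · subst h1; simp [hy, hd.symm]
  · subst h2; simp [hu, hd.symm]
  · rfl

lemma Reach.step {a : ℕ} (h : Reach G L f v c) (hu : f u = some c) (ha : Free G L f u a) :
    Reach G L f v a := by
  obtain ⟨n, hn⟩ := h
  exact ⟨n + 1, Or.inr (Or.inr ⟨u, c, hu, hn, ha⟩)⟩

lemma Reach.of_free {a : ℕ} (ha : Free G L f v a) : Reach G L f v a :=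
  ⟨1, Or.inr (Or.inl ha)⟩

variable [Fintype V]

lemma mem_colorClass : u ∈ colorClass f c ↔ f u = some c := by simp [colorClass]

lemma colorClass_displace_of_ne (hu : f u = none) (hy : f y = some c) (hd : d ≠ c) :
    colorClass (displace f u c y) d = colorClass f d := by
  ext x
  simp only [mem_colorClass, displace_eq_some_of_ne hu hy hd]

lemma colorClass_displace_self (hu : f u = none) (hy : f y = some c) :
    colorClass (displace f u c y) c = insert u ((colorClass f c).erase y) := by
  have huy : u ≠ y := by rintro rfl; simp [hu] at hy
  ext x
  simp only [mem_colorClass, displace, mem_insert, mem_erase]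
  split_ifs with h1 h2
  · subst h1; simp [huy.symm]
  · subst h2; simp
  · simp [h1, h2]

lemma card_colorClass_displace (hu : f u = none) (hy : f y = some c) (d : ℕ) :
    (colorClass (displace f u c y) d).card = (colorClass f d).card := by
  by_cases hd : d = c
  · subst hd
    rw [colorClass_displace_self hu hy, card_insert_of_notMem, card_erase_of_mem]
    · have : 0 < (colorClass f d).card := card_pos.2 ⟨y, mem_colorClass.2 hy⟩
      omega
    · exact mem_colorClass.2 hy
    · simp [mem_colorClass, hu]
  · rw [colorClass_displace_of_ne hu hy hd]

lemma NearColoring.near_displace (h : NearColoring G L s f u) (hc : c ∈ L u) (hy : f y = some c)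
    (hsolo : ∀ x, G.Adj u x → f x = some c → x = y) :
    NearColoring G L s (displace f u c y) y := by
  have hu : f u = none := (h.none_iff u).2 rfl
  refine ⟨fun x => ?_, fun x d hx => ?_, fun x x' d hadj hx hx' => ?_, fun d => ?_⟩
  · unfold displace
    split_ifs with h1 h2
    · simp [h1]
    · simp [h1]
    · simp [h1, h.none_iff, h2]
  · unfold displace at hx
    split_ifs at hx with h1 h2
    · subst h2; simp at hx; exact hx ▸ hc
    · exact h.mem _ _ hx
  · unfold displace at hx hx'
    split_ifs at hx hx' with h1 h2 h3 h4 h5 h6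
    · subst h2 h4; exact hadj.ne rfl
    · subst h2; simp at hx; subst hx; exact h3 (hsolo _ hadj hx')
    · subst h6; simp at hx'; subst hx'; exact h1 (hsolo _ hadj.symm hx)
    · exact h.proper _ _ _ hadj hx hx'
  · rw [card_colorClass_displace hu hy]; exact h.card_le d

lemma NearColoring.exists_reach (h : NearColoring G L s f v) (n : ℕ) (a : ℕ)
    (ha : ReachIn G L f v n a) :
    ∃ u g, NearColoring G L s g u ∧ Free G L g u a ∧
      ∀ c, (c = a ∨ ¬ ReachIn G L f v n c) → ∀ x, g x = some c ↔ f x = some c := by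
  induction n generalizing a with
  | zero => exact ha.elim
  | succ n ih =>
    by_cases hn : ReachIn G L f v n a
    · obtain ⟨u, g, hg, hfree, hag⟩ := ih a hn
      refine ⟨u, g, hg, hfree, fun c hc => hag c (hc.imp id fun h h' => h (Or.inl h'))⟩
    rcases ha with ha | ha | ⟨u, c, huc, hc, hfree⟩
    · exact absurd ha hn
    · exact ⟨v, f, h, ha, fun _ _ _ => Iff.rfl⟩
    · obtain ⟨u₀, g, hg, hfree₀, hag⟩ := ih c hc
      have hgu : g u = some c := (hag c (Or.inl rfl) u).2 huc
      have hgu₀ : g u₀ = none := (hg.none_iff _).2 rfl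
      have hne : ∀ d, (d = a ∨ ¬ ReachIn G L f v (n + 1) d) → d ≠ c ∧ ¬ ReachIn G L f v n d := by
        rintro d (rfl | hd)
        · exact ⟨fun h => hn (h ▸ hc), hn⟩
        · exact ⟨fun h => hd (Or.inl (h ▸ hc)), fun h => hd (Or.inl h)⟩
      have key : ∀ d, (d = a ∨ ¬ ReachIn G L f v (n + 1) d) →
          ∀ x, displace g u₀ c u x = some d ↔ f x = some d := fun d hd x => by
        rw [displace_eq_some_of_ne hgu₀ hgu (hne d hd).1]
        exact hag d (Or.inr (hne d hd).2) x
      refine ⟨u, _, hg.near_displace hfree₀.1 hgu fun x hx hx' => absurd hx' (hfree₀.2 x hx), ?_, key⟩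
      exact ⟨hfree.1, fun x hx hx' => hfree.2 x hx ((key a (Or.inl rfl) x).1 hx')⟩

lemma Acc.of_card_lt (h : (colorClass f c).card < s) : Acc G L s f c := ⟨0, h⟩

lemma Acc.step (h : Acc G L s f d) (hu : f u = some c) (hd : Free G L f u d) :
    Acc G L s f c := by
  obtain ⟨n, hn⟩ := h
  exact ⟨n + 1, Or.inr ⟨u, d, hu, hd, hn⟩⟩

/-- Every vertex of a reachable class can be made the uncoloured one without changing the
classes that are not reachable. -/
lemma NearColoring.exists_uncolor (h : NearColoring G L s f v)
    (hw : ∀ c, f w = some c → Reach G L f v c) :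
    ∃ g, NearColoring G L s g w ∧
      ∀ c, ¬ Reach G L f v c → ∀ x, g x = some c ↔ f x = some c := by
  rcases hfw : f w with _ | c
  · obtain rfl := (h.none_iff w).1 hfw
    exact ⟨f, h, fun _ _ _ => Iff.rfl⟩
  · obtain ⟨n, hn⟩ := hw c hfw
    obtain ⟨u, g, hg, hfree, hag⟩ := h.exists_reach n c hn
    have hgw : g w = some c := (hag c (Or.inl rfl) w).2 hfw
    have hgu : g u = none := (hg.none_iff _).2 rfl
    refine ⟨_, hg.near_displace hfree.1 hgw fun x hx hx' => absurd hx' (hfree.2 x hx), fun d hd x => ?_⟩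
    rw [displace_eq_some_of_ne hgu hgw (by rintro rfl; exact hd ⟨n, hn⟩)]
    exact hag d (Or.inr fun h => hd ⟨n, h⟩) x

lemma NearColoring.colorable_of_free (h : NearColoring G L s f v) (hc : Free G L f v c)
    (hlt : (colorClass f c).card < s) : BoundedColorable G L s := by
  have hv : f v = none := (h.none_iff v).2 rfl
  have hsome : ∀ u, u ≠ v → f u = some ((f u).getD 0) := fun u hu => by
    rcases hfu : f u with _ | d
    · exact absurd ((h.none_iff u).1 hfu) hu
    · simp
  refine ⟨fun u => if u = v then c else (f u).getD 0, fun u => ?_, fun u x hux => ?_, fun d => ?_⟩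
  · dsimp only
    split_ifs with hu
    · subst hu; exact hc.1
    · exact h.mem _ _ (hsome u hu)
  · dsimp only
    split_ifs with h1 h2 h3
    · subst h1 h2; exact absurd rfl hux.ne
    · subst h1; intro heq; exact hc.2 x hux (by rw [hsome x h2, ← heq])
    · subst h3; intro heq; exact hc.2 u hux.symm (by rw [hsome u h1, heq])
    · intro heq
      exact h.proper u x _ hux (hsome u h1) (by rw [hsome x h3, heq])
  · by_cases hd : d = c
    · subst hd
      refine le_trans (card_le_card (t := insert v (colorClass f d)) fun u hu => ?_)
        ((card_insert_le _ _).trans hlt)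
      simp only [mem_filter, mem_univ, true_and] at hu
      split_ifs at hu with h1
      · simp [h1]
      · simp [mem_colorClass, ← hu, ← hsome u h1]
    · refine le_trans (card_le_card (t := colorClass f d) fun u hu => ?_) (h.card_le d)
      simp only [mem_filter, mem_univ, true_and] at hu
      split_ifs at hu with h1
      · exact absurd hu.symm hd
      · simp [mem_colorClass, ← hu, ← hsome u h1]

lemma NearColoring.not_acc_of_reach (h : NearColoring G L s f v)
    (hG : ¬ BoundedColorable G L s) (hc : Reach G L f v c) : ¬ Acc G L s f c := by
  rintro ⟨n, hn⟩
  induction n generalizing c with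
  | zero =>
    obtain ⟨m, hm⟩ := hc
    obtain ⟨u, g, hg, hfree, hag⟩ := h.exists_reach m c hm
    refine hG (hg.colorable_of_free hfree ?_)
    have : colorClass g c = colorClass f c := by
      ext x; simp only [mem_colorClass, hag c (Or.inl rfl)]
    rw [this]; exact hn
  | succ n ih =>
    rcases hn with hn | ⟨u, d, hu, hd, hn⟩
    · exact ih hc hn
    · exact ih (hc.step hu hd) hn

variable (G L s f) in
/-- The number of moves needed to reach a small class from `c`. -/
noncomputable def accRank (c : ℕ) : ℕ := sInf {n | AccIn G L s f n c}

lemma exists_witness (h : Acc G L s f c) (hfull : ¬ (colorClass f c).card < s) :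
    ∃ u d, f u = some c ∧ Free G L f u d ∧ Acc G L s f d ∧
      accRank G L s f d < accRank G L s f c := by
  have hspec : AccIn G L s f (accRank G L s f c) c := Nat.sInf_mem (s := {n | AccIn G L s f n c}) h
  rcases hr : accRank G L s f c with _ | n
  · rw [hr] at hspec; exact absurd hspec hfull
  · rw [hr] at hspec
    rcases hspec with hspec | ⟨u, d, hu, hd, hn⟩
    · exact absurd hspec (Nat.notMem_of_lt_sInf (s := {n | AccIn G L s f n c})
        (by rw [accRank] at hr; omega))
    · exact ⟨u, d, hu, hd, ⟨n, hn⟩, Nat.lt_succ_of_le (Nat.sInf_le hn)⟩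

end Moves

section Structure

variable {V : Type*} [Fintype V] {G : SimpleGraph V} {L : V → Finset ℕ} {s : ℕ}
  {f : V → Option ℕ} {v w y z : V} {c d : ℕ} {t : ℕ → V} {p : ℕ → ℕ}

variable (G L s) in
/-- `t c` is a vertex of the full accessible class `c` that can be moved to the class `p c`,
which is closer to a small class. -/
def IsCertificate (f : V → Option ℕ) (t : ℕ → V) (p : ℕ → ℕ) : Prop :=
  ∀ c, Acc G L s f c → ¬ (colorClass f c).card < s →
    f (t c) = some c ∧ Free G L f (t c) (p c) ∧ Acc G L s f (p c) ∧
      accRank G L s f (p c) < accRank G L s f c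

variable (G L s) in
/-- `y` is the only neighbour of `w` in its class, this class is accessible, and its colour can
be given to `w` without disturbing the certificate. -/
def GoodSolo (f : V → Option ℕ) (t : ℕ → V) (p : ℕ → ℕ) (w y : V) (c : ℕ) : Prop :=
  c ∈ L w ∧ Acc G L s f c ∧ f y = some c ∧ G.Adj w y ∧
    (∀ x, G.Adj w x → f x = some c → x = y) ∧
    ∀ d, Acc G L s f d → ¬ (colorClass f d).card < s → p d = c → ¬ G.Adj w (t d)

lemma exists_certificate [Nonempty V] (f : V → Option ℕ) :
    ∃ t p, IsCertificate G L s f t p := by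
  have h : ∀ c, ∃ q : V × ℕ, Acc G L s f c → ¬ (colorClass f c).card < s →
      f q.1 = some c ∧ Free G L f q.1 q.2 ∧ Acc G L s f q.2 ∧
        accRank G L s f q.2 < accRank G L s f c := fun c => by
    by_cases hc : Acc G L s f c ∧ ¬ (colorClass f c).card < s
    · obtain ⟨u, d, h⟩ := exists_witness hc.1 hc.2
      exact ⟨(u, d), fun _ _ => h⟩
    · exact ⟨(Classical.arbitrary V, 0), fun h1 h2 => absurd ⟨h1, h2⟩ hc⟩
  choose q hq using h
  exact ⟨fun c => (q c).1, fun c => (q c).2, hq⟩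

lemma exists_critical (h : NearColoring G L s f v) (hG : ¬ BoundedColorable G L s) :
    ∃ f v, Critical G L s f v := by
  obtain ⟨⟨f', v'⟩, hmem, hmin⟩ :=
    (measure fun q : (V → Option ℕ) × V => (blocked G L s q.1).card).wf.has_min
      {q | NearColoring G L s q.1 q.2} ⟨(f, v), h⟩
  exact ⟨f', v', hmem, hG, fun g w hg => not_lt.1 (hmin (g, w) hg)⟩

lemma Critical.exists_adj_of_acc (h : Critical G L s f v)
    (hw : ∀ c, f w = some c → ¬ Acc G L s f c) (hc : c ∈ L w) (hacc : Acc G L s f c) :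
    ∃ x, G.Adj w x ∧ f x = some c := by
  by_contra! hno
  have hfree : Free G L f w c := ⟨hc, hno⟩
  rcases hfw : f w with _ | d
  · obtain rfl := (h.near.none_iff w).1 hfw
    exact h.near.not_acc_of_reach h.not_colorable (.of_free hfree) hacc
  · exact hw d hfw (hacc.step hfw hfree)

lemma NearColoring.exists_adj_of_not_reach (h : NearColoring G L s f v)
    (hw : ∀ c, f w = some c → Reach G L f v c) (hc : c ∈ L w) (hr : ¬ Reach G L f v c) :
    ∃ x, G.Adj w x ∧ f x = some c := by
  by_contra! hno
  have hfree : Free G L f w c := ⟨hc, hno⟩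
  rcases hfw : f w with _ | d
  · obtain rfl := (h.none_iff w).1 hfw
    exact hr (.of_free hfree)
  · exact hr ((hw d hfw).step hfw hfree)

/-- Moving the hole (the uncoloured vertex) to `w` and then to `y` keeps all accessible
classes accessible. -/
lemma Critical.exists_shift (h : Critical G L s f v) (hcert : IsCertificate G L s f t p)
    (hw : ∀ c, f w = some c → Reach G L f v c) (hsolo : GoodSolo G L s f t p w y c) :
    ∃ g, NearColoring G L s g y ∧ (∀ x, g x = some c ↔ x = w ∨ (x ≠ y ∧ f x = some c)) ∧
      (∀ d, d ≠ c → ¬ Reach G L f v d → ∀ x, g x = some d ↔ f x = some d) ∧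
      ∀ d, Acc G L s f d → Acc G L s g d := by
  obtain ⟨hcw, hacc, hy, hadj, huniq, hgood⟩ := hsolo
  have hnr : ∀ d, Acc G L s f d → ¬ Reach G L f v d := fun d hd hr =>
    h.near.not_acc_of_reach h.not_colorable hr hd
  obtain ⟨e, he, hagree⟩ := h.near.exists_uncolor hw
  have hew : e w = none := (he.none_iff w).2 rfl
  have hey : e y = some c := (hagree c (hnr c hacc) y).2 hy
  have hg : NearColoring G L s (displace e w c y) y :=
    he.near_displace hcw hey fun x hx hx' => huniq x hx ((hagree c (hnr c hacc) x).1 hx')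
  have hgc : ∀ x, displace e w c y x = some c ↔ x = w ∨ (x ≠ y ∧ f x = some c) := fun x => by
    rw [← mem_colorClass, colorClass_displace_self hew hey, mem_insert, mem_erase, mem_colorClass,
      hagree c (hnr c hacc)]
  have hgd : ∀ d, d ≠ c → ¬ Reach G L f v d →
      ∀ x, displace e w c y x = some d ↔ f x = some d := fun d hd hr x => by
    rw [displace_eq_some_of_ne hew hey hd, hagree d hr]
  have hcard : ∀ d, Acc G L s f d →
      (colorClass (displace e w c y) d).card = (colorClass f d).card := fun d hd => by
    rw [card_colorClass_displace hew hey]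
    congr 1
    ext x; simp only [mem_colorClass, hagree d (hnr d hd)]
  refine ⟨displace e w c y, hg, hgc, hgd, ?_⟩
  generalize displace e w c y = g at *
  intro d hd
  induction hn : accRank G L s f d using Nat.strong_induction_on generalizing d with
  | _ n ih =>
  by_cases hfull : (colorClass f d).card < s
  · exact .of_card_lt (by rwa [hcard d hd])
  obtain ⟨ht, hfree, hp, hlt⟩ := hcert d hd hfull
  have hpg : Acc G L s g (p d) := ih _ (hn ▸ hlt) (p d) hp rfl
  have hgt : g (t d) = some d := by
    by_cases hdc : d = c
    · subst hdc
      refine (hgc _).2 (Or.inr ⟨fun hty => ?_, ht⟩)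
      have hpc : p d ≠ d := fun hpc => by rw [hpc] at hlt; exact lt_irrefl _ hlt
      refine hg.not_acc_of_reach h.not_colorable (.of_free ⟨hty ▸ hfree.1, fun x hx hx' => ?_⟩) hpg
      exact hfree.2 x (hty ▸ hx) ((hgd _ hpc (hnr _ hp) x).1 hx')
    · exact (hgd d hdc (hnr d hd) _).2 ht
  refine hpg.step hgt ⟨hfree.1, fun x hx hx' => ?_⟩
  by_cases hpc : p d = c
  · rw [hpc, hgc] at hx'
    rcases hx' with rfl | ⟨-, hx'⟩
    · exact hgood d hd hfull hpc hx.symm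
    · exact hfree.2 x hx (hpc ▸ hx')
  · exact hfree.2 x hx ((hgd _ hpc (hnr _ hp) x).1 hx')

lemma Critical.adj_of_goodSolo (h : Critical G L s f v) (hcert : IsCertificate G L s f t p)
    (hw : ∀ c, f w = some c → Reach G L f v c) (hz : ∀ c, f z = some c → Reach G L f v c)
    (hsw : GoodSolo G L s f t p w y c) (hsz : GoodSolo G L s f t p z y d) (hne : w ≠ z) :
    G.Adj w z := by
  obtain rfl : d = c := by
    have h1 := hsw.2.2.1; have h2 := hsz.2.2.1
    rw [h1] at h2; exact (Option.some.inj h2).symm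
  by_contra hadj
  obtain ⟨g, hg, hgc, hgd, hacc⟩ := h.exists_shift hcert hw hsw
  have hdr : ¬ Reach G L f v d := fun hr =>
    h.near.not_acc_of_reach h.not_colorable hr hsw.2.1
  rcases hgz : g z with _ | e
  · exact hsz.2.2.2.1.ne ((hg.none_iff z).1 hgz)
  have hfree : Free G L g z d := by
    refine ⟨hsz.1, fun x hx hx' => ?_⟩
    rcases (hgc x).1 hx' with rfl | ⟨hxy, hxd⟩
    · exact hadj hx.symm
    · exact hxy (hsz.2.2.2.2.1 x hx hxd)
  have heg : Acc G L s g e := (hacc d hsw.2.1).step hgz hfree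
  have hef : ¬ Acc G L s f e := fun hef => by
    have her : ¬ Reach G L f v e := fun hr => h.near.not_acc_of_reach h.not_colorable hr hef
    by_cases hed : e = d
    · subst hed
      rcases (hgc z).1 hgz with rfl | ⟨-, hfz⟩
      · exact hne rfl
      · exact her (hz _ hfz)
    · exact her (hz e ((hgd e hed her z).1 hgz))
  refine absurd (h.minimal g y hg) (not_le.2 (card_lt_card ?_))
  refine (ssubset_iff_of_subset fun a ha => ?_).2 ⟨e, ?_, fun he => (mem_filter.1 he).2 heg⟩
  · rw [blocked, mem_filter] at ha ⊢
    exact ⟨ha.1, fun h' => ha.2 (hacc a h')⟩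
  · exact mem_filter.2 ⟨mem_biUnion.2 ⟨z, mem_univ _, hg.mem z e hgz⟩, hef⟩

lemma Critical.exists_adj_of_goodSolo (h : Critical G L s f v)
    (hcert : IsCertificate G L s f t p) (hw : ∀ c, f w = some c → Reach G L f v c)
    (hsw : GoodSolo G L s f t p w y c) (hd : d ∈ L y) (hdc : d ≠ c) (hacc : Acc G L s f d) :
    ∃ x, G.Adj y x ∧ f x = some d := by
  by_contra! hno
  obtain ⟨g, hg, hgc, hgd, hacc'⟩ := h.exists_shift hcert hw hsw
  have hdr : ¬ Reach G L f v d := fun hr => h.near.not_acc_of_reach h.not_colorable hr hacc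
  exact hg.not_acc_of_reach h.not_colorable
    (.of_free ⟨hd, fun x hx hx' => hno x hx ((hgd d hdc hdr x).1 hx')⟩) (hacc' d hacc)

end Structure

section Degree

variable {V : Type*}

/-- The number of neighbours of `w` in `S`. -/
noncomputable def degIn (G : SimpleGraph V) (S : Finset V) (w : V) : ℕ := (S.filter (G.Adj w)).card

lemma sum_degIn_comm {G : SimpleGraph V} (S T : Finset V) :
    ∑ w ∈ S, degIn G T w = ∑ w ∈ T, degIn G S w := by
  unfold degIn
  have h := sum_card_bipartiteAbove_eq_sum_card_bipartiteBelow (s := S) (t := T) G.Adj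
  unfold bipartiteAbove bipartiteBelow at h
  rw [h]
  simp only [G.adj_comm]

end Degree

section Counting

variable {V : Type*} [Fintype V] {G : SimpleGraph V} {L : V → Finset ℕ} {s k r : ℕ}
  {f : V → Option ℕ} {v w : V} {c : ℕ}

lemma card_biUnion_colorClass {C : Finset ℕ} (h : ∀ c ∈ C, (colorClass f c).card = s) :
    (C.biUnion (colorClass f)).card = s * C.card := by
  rw [card_biUnion, sum_congr rfl h, sum_const, smul_eq_mul, mul_comm]
  intro c _ d _ hcd
  refine disjoint_left.2 fun x hx hx' => hcd ?_
  rw [mem_colorClass] at hx hx'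
  exact Option.some.inj (hx.symm.trans hx')

lemma two_mul_card_le_card_adj_add_solo {C : Finset ℕ}
    (h : ∀ c ∈ C, ∃ x, G.Adj w x ∧ f x = some c) :
    2 * C.card ≤ (univ.filter fun x => G.Adj w x ∧ ∃ c ∈ C, f x = some c).card +
      (C.filter fun c => ∃ y, ∀ x, (G.Adj w x ∧ f x = some c) ↔ x = y).card := by
  have hsum : (univ.filter fun x => G.Adj w x ∧ ∃ c ∈ C, f x = some c).card =
      ∑ c ∈ C, (univ.filter fun x => G.Adj w x ∧ f x = some c).card := by
    rw [← card_biUnion]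
    · congr 1; ext x; simp; tauto
    · intro c _ d _ hcd
      refine disjoint_left.2 fun x hx hx' => hcd ?_
      simp only [mem_filter, mem_univ, true_and] at hx hx'
      exact Option.some.inj (hx.2.symm.trans hx'.2)
  rw [hsum, card_filter, ← sum_add_distrib, mul_comm, ← smul_eq_mul, ← sum_const]
  refine sum_le_sum fun c hc => ?_
  obtain ⟨y, hy⟩ := h c hc
  have hpos : 0 < (univ.filter fun x => G.Adj w x ∧ f x = some c).card :=
    card_pos.2 ⟨y, by simpa using hy⟩
  by_cases hone : (univ.filter fun x => G.Adj w x ∧ f x = some c).card = 1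
  · obtain ⟨a, ha⟩ := card_eq_one.1 hone
    rw [if_pos ⟨a, fun x => by simpa using Finset.ext_iff.1 ha x⟩]
    omega
  · omega

lemma card_le_card_adj {C : Finset ℕ} (h : ∀ c ∈ C, ∃ x, G.Adj w x ∧ f x = some c) :
    C.card ≤ (univ.filter fun x => G.Adj w x ∧ ∃ c ∈ C, f x = some c).card := by
  have h1 := two_mul_card_le_card_adj_add_solo h
  have h2 := card_filter_le C fun c => ∃ y, ∀ x, (G.Adj w x ∧ f x = some c) ↔ x = y
  omega

variable (G L s) in
/-- The vertices of accessible classes. -/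
noncomputable def accSet (f : V → Option ℕ) : Finset V :=
  univ.filter fun u => ∃ c, f u = some c ∧ Acc G L s f c

variable (G L s) in
/-- The vertices outside the accessible classes. -/
noncomputable def blockedSet (f : V → Option ℕ) : Finset V :=
  univ.filter fun u => ∀ c, f u = some c → ¬ Acc G L s f c

variable (G L) in
/-- The uncoloured vertex and the vertices of reachable classes. -/
noncomputable def reachSet (f : V → Option ℕ) (v : V) : Finset V :=
  univ.filter fun u => ∀ c, f u = some c → Reach G L f v c

variable (G L s) in
/-- The reachable colours. -/
noncomputable def reachColors (f : V → Option ℕ) (v : V) : Finset ℕ :=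
  (blocked G L s f).filter fun c => Reach G L f v c

variable (G L s) in
/-- The colours of the accessible classes with `s` vertices. -/
noncomputable def fullColors (f : V → Option ℕ) : Finset ℕ :=
  (univ.biUnion L).filter fun c => Acc G L s f c ∧ ¬ (colorClass f c).card < s

lemma card_blockedSet_add_card_accSet :
    (blockedSet G L s f).card + (accSet G L s f).card = Fintype.card V := by
  rw [blockedSet, accSet, ← card_univ, ← card_filter_add_card_filter_not (s := univ)
    (fun u => ∀ c, f u = some c → ¬ Acc G L s f c)]
  simp

lemma NearColoring.mem_blocked (h : NearColoring G L s f v) (hs : 0 < s) :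
    c ∈ blocked G L s f ↔ ¬ Acc G L s f c := by
  refine ⟨fun hc => (mem_filter.1 hc).2, fun hc => mem_filter.2 ⟨?_, hc⟩⟩
  have : 0 < (colorClass f c).card := hs.trans_le (not_lt.1 fun hlt => hc (.of_card_lt hlt))
  obtain ⟨u, hu⟩ := card_pos.1 this
  exact mem_biUnion.2 ⟨u, mem_univ _, h.mem u c (mem_colorClass.1 hu)⟩

lemma NearColoring.card_eq_of_not_lt (h : NearColoring G L s f v)
    (hc : ¬ (colorClass f c).card < s) : (colorClass f c).card = s :=
  le_antisymm (h.card_le c) (not_lt.1 hc)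

lemma NearColoring.card_insert_biUnion (h : NearColoring G L s f v) {C : Finset ℕ}
    (hC : ∀ c ∈ C, ¬ (colorClass f c).card < s) :
    (insert v (C.biUnion (colorClass f))).card = s * C.card + 1 := by
  rw [card_insert_of_notMem,
    card_biUnion_colorClass fun c hc => h.card_eq_of_not_lt (hC c hc)]
  simp [mem_colorClass, (h.none_iff v).2 rfl]

lemma NearColoring.card_blockedSet (h : NearColoring G L s f v) (hs : 0 < s) :
    (blockedSet G L s f).card = s * (blocked G L s f).card + 1 := by
  rw [← h.card_insert_biUnion (C := blocked G L s f)
    fun c hc hlt => (h.mem_blocked hs).1 hc (.of_card_lt hlt)]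
  congr 1
  ext u
  simp only [blockedSet, mem_filter, mem_univ, true_and, mem_insert, mem_biUnion, mem_colorClass,
    h.mem_blocked hs, ← h.none_iff u]
  rcases f u with _ | c <;> simp

lemma Critical.reach_not_acc (h : Critical G L s f v) (hc : Reach G L f v c) :
    ¬ Acc G L s f c := h.near.not_acc_of_reach h.not_colorable hc

lemma Critical.mem_reachColors (h : Critical G L s f v) (hs : 0 < s) :
    c ∈ reachColors G L s f v ↔ Reach G L f v c := by
  rw [reachColors, mem_filter, h.near.mem_blocked hs, and_iff_right_iff_imp]
  exact h.reach_not_acc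

lemma Critical.card_reachSet (h : Critical G L s f v) (hs : 0 < s) :
    (reachSet G L f v).card = s * (reachColors G L s f v).card + 1 := by
  rw [← h.near.card_insert_biUnion (C := reachColors G L s f v)
    fun c hc hlt => h.reach_not_acc ((h.mem_reachColors hs).1 hc) (.of_card_lt hlt)]
  congr 1
  ext u
  simp only [reachSet, mem_filter, mem_univ, true_and, mem_insert, mem_biUnion, mem_colorClass,
    h.mem_reachColors hs, ← h.near.none_iff u]
  rcases f u with _ | c <;> simp

lemma Critical.reachSet_subset (h : Critical G L s f v) :
    reachSet G L f v ⊆ blockedSet G L s f := fun _ hu =>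
  mem_filter.2 ⟨mem_univ _, fun c hc => h.reach_not_acc ((mem_filter.1 hu).2 c hc)⟩

lemma NearColoring.card_blocked_add_card_fullColors (h : NearColoring G L s f v) (hs : 0 < s)
    (hcard : Fintype.card V ≤ s * k) :
    (blocked G L s f).card + (fullColors G L s f).card < k := by
  have h1 := h.card_insert_biUnion (C := blocked G L s f ∪ fullColors G L s f) fun c hc hlt => by
    rcases mem_union.1 hc with hc | hc
    · exact (h.mem_blocked hs).1 hc (.of_card_lt hlt)
    · exact (mem_filter.1 hc).2.2 hlt
  have hdisj : Disjoint (blocked G L s f) (fullColors G L s f) :=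
    disjoint_left.2 fun c hc hc' => (mem_filter.1 hc).2 (mem_filter.1 hc').2.1
  rw [card_union_of_disjoint hdisj] at h1
  refine Nat.lt_of_mul_lt_mul_left (a := s) ?_
  have := card_le_univ (insert v ((blocked G L s f ∪ fullColors G L s f).biUnion (colorClass f)))
  omega

lemma card_le_card_blocked_add (h : NearColoring G L s f v) (hs : 0 < s) (w : V) :
    (L w).card ≤ (blocked G L s f).card + ((L w).filter (Acc G L s f)).card := by
  rw [← card_filter_add_card_filter_not (s := L w) (Acc G L s f), add_comm]
  gcongr
  exact fun c hc => (h.mem_blocked hs).2 (mem_filter.1 hc).2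

lemma filter_adj_color_subset {C : Finset ℕ} (hC : ∀ c ∈ C, Acc G L s f c) :
    (univ.filter fun x => G.Adj w x ∧ ∃ c ∈ C, f x = some c) ⊆
      (accSet G L s f).filter (G.Adj w) := fun x hx => by
  obtain ⟨-, hadj, c, hc, hxc⟩ := mem_filter.1 hx
  exact mem_filter.2 ⟨mem_filter.2 ⟨mem_univ _, c, hxc, hC c hc⟩, hadj⟩

lemma Critical.card_filter_acc_le (h : Critical G L s f v) (hw : w ∈ blockedSet G L s f) :
    ((L w).filter (Acc G L s f)).card ≤ degIn G (accSet G L s f) w := by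
  refine (card_le_card_adj (G := G) (f := f) (w := w) fun c hc => ?_).trans
    (card_le_card (filter_adj_color_subset fun c hc => (mem_filter.1 hc).2))
  exact h.exists_adj_of_acc (mem_filter.1 hw).2 (mem_filter.1 hc).1 (mem_filter.1 hc).2

/-- Basic degree inequality for vertices of reachable classes. -/
lemma Critical.degIn_add_le (h : Critical G L s f v)
    (hdeg : ∀ u, (univ.filter (G.Adj u)).card ≤ r) (hw : w ∈ reachSet G L f v) :
    degIn G (accSet G L s f) w +
      ((L w).filter fun c => ¬ Acc G L s f c ∧ ¬ Reach G L f v c).card +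
        degIn G (reachSet G L f v) w ≤ r := by
  set C := (L w).filter fun c => ¬ Acc G L s f c ∧ ¬ Reach G L f v c
  have h1 : C.card ≤ _ := card_le_card_adj (G := G) (f := f) (w := w) fun c hc =>
    h.near.exists_adj_of_not_reach (mem_filter.1 hw).2 (mem_filter.1 hc).1 (mem_filter.1 hc).2.2
  refine le_trans ?_ (hdeg w)
  refine le_trans (Nat.add_le_add_right (Nat.add_le_add_left h1 _) _) ?_
  unfold degIn
  rw [← card_union_of_disjoint, ← card_union_of_disjoint]
  · refine card_le_card fun x hx => ?_
    simp only [mem_union, mem_filter, mem_univ, true_and] at hx ⊢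
    tauto
  · refine disjoint_left.2 fun x hx hx' => ?_
    have hr := (mem_filter.1 (mem_filter.1 hx').1).2
    rcases mem_union.1 hx with hx | hx
    · obtain ⟨-, c, hxc, hc⟩ := mem_filter.1 (mem_filter.1 hx).1
      exact h.reach_not_acc (hr c hxc) hc
    · obtain ⟨-, -, c, hc, hxc⟩ := mem_filter.1 hx
      exact (mem_filter.1 hc).2.2 (hr c hxc)
  · refine disjoint_left.2 fun x hx hx' => ?_
    obtain ⟨-, -, c, hc, hxc⟩ := mem_filter.1 hx'
    obtain ⟨-, d, hxd, hd⟩ := mem_filter.1 (mem_filter.1 hx).1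
    obtain rfl := Option.some.inj (hxc.symm.trans hxd)
    exact (mem_filter.1 hc).2.1 hd

lemma Critical.card_list_eq (h : Critical G L s f v) (w : V) :
    ((L w).filter (Acc G L s f)).card +
      ((L w).filter fun c => ¬ Acc G L s f c ∧ ¬ Reach G L f v c).card +
        ((L w).filter (Reach G L f v)).card = (L w).card := by
  rw [← card_filter_add_card_filter_not (s := L w) (Acc G L s f), add_assoc]
  congr 1
  rw [← card_filter_add_card_filter_not (s := (L w).filter fun c => ¬ Acc G L s f c)
    (Reach G L f v), filter_filter, filter_filter, add_comm]
  congr 2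
  ext c
  simp only [mem_filter]
  exact and_congr_right fun _ => ⟨fun hr => ⟨h.reach_not_acc hr, hr⟩, fun hr => hr.2⟩

lemma Critical.card_filter_reach_le (h : Critical G L s f v) (hs : 0 < s) (w : V) :
    ((L w).filter (Reach G L f v)).card ≤ (reachColors G L s f v).card :=
  card_le_card fun _ hc => (h.mem_reachColors hs).2 (mem_filter.1 hc).2

lemma Critical.mem_reachSet (h : Critical G L s f v) : v ∈ reachSet G L f v :=
  mem_filter.2 ⟨mem_univ _, by simp [(h.near.none_iff v).2 rfl]⟩

lemma Critical.add_degIn_reachSet_le (h : Critical G L s f v) (hs : 0 < s)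
    (hL : ∀ u, (L u).card = k) (hdeg : ∀ u, (univ.filter (G.Adj u)).card ≤ r)
    (hw : w ∈ reachSet G L f v) :
    k + degIn G (reachSet G L f v) w ≤ r + (reachColors G L s f v).card := by
  have h1 := h.degIn_add_le hdeg hw
  have h2 := h.card_filter_acc_le (h.reachSet_subset hw)
  have h3 := h.card_list_eq w
  have h4 := h.card_filter_reach_le hs w
  rw [hL] at h3
  omega

lemma Critical.card_blocked_lt (h : Critical G L s f v) (hs : 0 < s)
    (hL : ∀ u, (L u).card = k) (hdeg : ∀ u, (univ.filter (G.Adj u)).card ≤ r)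
    (hcard : Fintype.card V ≤ s * k) : (blocked G L s f).card < r := by
  have h1 := h.near.card_blocked_add_card_fullColors hs hcard
  have h2 := h.near.card_blockedSet hs
  have h3 := card_blockedSet_add_card_accSet (G := G) (L := L) (s := s) (f := f)
  obtain ⟨x, hx, rfl⟩ : ∃ x, 0 < x ∧ k = (blocked G L s f).card + x :=
    ⟨k - (blocked G L s f).card, by omega, by omega⟩
  have h4 : (blockedSet G L s f).card * x ≤
      ∑ w ∈ blockedSet G L s f, degIn G (accSet G L s f) w := by
    rw [← smul_eq_mul]
    refine card_nsmul_le_sum _ _ _ fun w hw => ?_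
    have h5 := h.card_filter_acc_le hw
    have h6 := card_le_card_blocked_add h.near hs w
    rw [hL] at h6
    omega
  rw [sum_degIn_comm] at h4
  have h5 : ∑ w ∈ accSet G L s f, degIn G (blockedSet G L s f) w ≤
      (accSet G L s f).card * r := by
    rw [← smul_eq_mul]
    refine sum_le_card_nsmul _ _ _ fun w _ => (card_le_card ?_).trans (hdeg w)
    exact filter_subset_filter _ (subset_univ _)
  have h6 : (accSet G L s f).card + 1 ≤ s * x := by
    rw [mul_add] at hcard; omega
  have h7 := h4.trans h5
  rw [h2] at h7
  generalize (blocked G L s f).card = m at *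
  generalize (accSet G L s f).card = a at *
  by_contra! hmr
  have h8 : (a + 1) * r ≤ s * x * m := Nat.mul_le_mul h6 hmr
  nlinarith

end Counting

section Discharging

variable {V : Type*} [Fintype V] {G : SimpleGraph V} {L : V → Finset ℕ} {s k r : ℕ}
  {f : V → Option ℕ} {v w y : V} {t : ℕ → V} {p : ℕ → ℕ}

variable (G L s) in
/-- The vertices to which the hole can be moved from `w` along a good solo edge. -/
noncomputable def goodSet (f : V → Option ℕ) (t : ℕ → V) (p : ℕ → ℕ) (w : V) : Finset V :=
  (accSet G L s f).filter fun y => ∃ c, GoodSolo G L s f t p w y c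

variable (G L s) in
/-- The vertices of reachable classes from which the hole can be moved to `y` along a good solo
edge. -/
noncomputable def sourceSet (f : V → Option ℕ) (v : V) (t : ℕ → V) (p : ℕ → ℕ) (y : V) :
    Finset V :=
  (reachSet G L f v).filter fun w => ∃ c, GoodSolo G L s f t p w y c

variable (G L s) in
/-- The number of certificate vertices adjacent to `w`. -/
noncomputable def badCount (f : V → Option ℕ) (t : ℕ → V) (w : V) : ℕ :=
  ((fullColors G L s f).filter fun d => G.Adj w (t d)).card

lemma Critical.two_mul_card_filter_acc_le (h : Critical G L s f v)
    (hs : 0 < s) (t : ℕ → V) (p : ℕ → ℕ) (hw : w ∈ blockedSet G L s f) :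
    2 * ((L w).filter (Acc G L s f)).card ≤ degIn G (accSet G L s f) w +
      (goodSet G L s f t p w).card + badCount G L s f t w := by
  set C := (L w).filter (Acc G L s f)
  have h1 := two_mul_card_le_card_adj_add_solo (G := G) (f := f) (w := w) (C := C) fun c hc =>
    h.exists_adj_of_acc (mem_filter.1 hw).2 (mem_filter.1 hc).1 (mem_filter.1 hc).2
  have h2 := card_le_card (filter_adj_color_subset (w := w) (C := C) (G := G) (L := L) (s := s)
    (f := f) fun c hc => (mem_filter.1 hc).2)
  set S := C.filter fun c => ∃ y, ∀ x, (G.Adj w x ∧ f x = some c) ↔ x = y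
  have h3 : S.card ≤ (goodSet G L s f t p w).card + badCount G L s f t w := by
    have hsub : S.image some ⊆ (goodSet G L s f t p w).image f ∪
        ((fullColors G L s f).filter fun d => G.Adj w (t d)).image (fun d => some (p d)) := by
      intro a ha
      obtain ⟨c, hc, rfl⟩ := mem_image.1 ha
      obtain ⟨hcC, y, hy⟩ := mem_filter.1 hc
      obtain ⟨hcL, hacc⟩ := mem_filter.1 hcC
      obtain ⟨hadj, hyc⟩ := (hy y).2 rfl
      rw [mem_union]
      by_cases hbad : ∃ d, Acc G L s f d ∧ ¬ (colorClass f d).card < s ∧ p d = c ∧ G.Adj w (t d)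
      · obtain ⟨d, hd, hfull, hpd, hadj'⟩ := hbad
        refine Or.inr (mem_image.2 ⟨d, mem_filter.2 ⟨mem_filter.2 ⟨?_, hd, hfull⟩, hadj'⟩, by
          rw [hpd]⟩)
        obtain ⟨u, hu⟩ := card_pos.1 (hs.trans_le (not_lt.1 hfull))
        exact mem_biUnion.2 ⟨u, mem_univ _, h.near.mem u d (mem_colorClass.1 hu)⟩
      · refine Or.inl (mem_image.2 ⟨y, mem_filter.2 ⟨mem_filter.2 ⟨mem_univ _, c, hyc, hacc⟩,
          c, hcL, hacc, hyc, hadj, fun x hx hx' => (hy x).1 ⟨hx, hx'⟩, ?_⟩, hyc⟩)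
        intro d hd hfull hpd hadj'
        exact hbad ⟨d, hd, hfull, hpd, hadj'⟩
    rw [← card_image_of_injective S (Option.some_injective ℕ)]
    exact (card_le_card hsub).trans ((card_union_le _ _).trans
      (Nat.add_le_add card_image_le card_image_le))
  unfold degIn
  omega

lemma sum_badCount_le (hdeg : ∀ u, (univ.filter (G.Adj u)).card ≤ r) (S : Finset V) :
    ∑ w ∈ S, badCount G L s f t w ≤ r * (fullColors G L s f).card := by
  have h := sum_card_bipartiteAbove_eq_sum_card_bipartiteBelow (s := S)
    (t := fullColors G L s f) (fun w d => G.Adj w (t d))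
  unfold bipartiteAbove bipartiteBelow at h
  unfold badCount
  rw [h, mul_comm, ← smul_eq_mul]
  refine sum_le_card_nsmul _ _ _ fun d _ => (card_le_card fun w hw => ?_).trans (hdeg (t d))
  exact mem_filter.2 ⟨mem_univ _, (mem_filter.1 hw).2.symm⟩

lemma Critical.card_sourceSet_le (h : Critical G L s f v) (hcert : IsCertificate G L s f t p)
    (hw : w ∈ sourceSet G L s f v t p y) :
    (sourceSet G L s f v t p y).card ≤ 1 + degIn G (reachSet G L f v) w := by
  obtain ⟨hwr, c, hc⟩ := mem_filter.1 hw
  rw [← card_erase_add_one hw, add_comm]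
  refine Nat.add_le_add_left (card_le_card fun z hz => ?_) 1
  obtain ⟨hzw, hz⟩ := mem_erase.1 hz
  obtain ⟨hzr, d, hd⟩ := mem_filter.1 hz
  exact mem_filter.2 ⟨hzr, h.adj_of_goodSolo hcert (mem_filter.1 hwr).2 (mem_filter.1 hzr).2
    hc hd hzw.symm⟩

lemma degIn_accSet_add_degIn_blockedSet_le (hdeg : ∀ u, (univ.filter (G.Adj u)).card ≤ r)
    (y : V) : degIn G (accSet G L s f) y + degIn G (blockedSet G L s f) y ≤ r := by
  unfold degIn
  rw [← card_union_of_disjoint]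
  · refine (card_le_card ?_).trans (hdeg y)
    rw [← filter_union]
    exact filter_subset_filter _ (subset_univ _)
  · refine disjoint_filter_filter (disjoint_left.2 fun x hx hx' => ?_)
    obtain ⟨-, c, hc, hacc⟩ := mem_filter.1 hx
    exact (mem_filter.1 hx').2 c hc hacc

lemma Critical.degIn_blockedSet_le (h : Critical G L s f v) (hs : 0 < s)
    (hcert : IsCertificate G L s f t p) (hL : ∀ u, (L u).card = k)
    (hdeg : ∀ u, (univ.filter (G.Adj u)).card ≤ r) (hw : w ∈ sourceSet G L s f v t p y) :
    degIn G (blockedSet G L s f) y + k ≤ r + 1 + (blocked G L s f).card := by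
  obtain ⟨hwr, c, hc⟩ := mem_filter.1 hw
  have h1 := card_le_card_adj (G := G) (f := f) (w := y)
    (C := ((L y).filter (Acc G L s f)).erase c) fun d hd => by
      obtain ⟨hdc, hd⟩ := mem_erase.1 hd
      obtain ⟨hdL, hacc⟩ := mem_filter.1 hd
      exact h.exists_adj_of_goodSolo hcert (mem_filter.1 hwr).2 hc hdL hdc hacc
  have h2 := card_le_card (filter_adj_color_subset (w := y)
    (C := ((L y).filter (Acc G L s f)).erase c) (G := G) (L := L) (s := s)
    (f := f) fun c hc => (mem_filter.1 (mem_erase.1 hc).2).2)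
  have h3 := card_le_card_blocked_add h.near hs y
  have h4 := degIn_accSet_add_degIn_blockedSet_le (L := L) (s := s) (f := f) hdeg y
  have h5 := pred_card_le_card_erase (s := (L y).filter (Acc G L s f)) (a := c)
  rw [hL] at h3
  unfold degIn at h4 ⊢
  omega

lemma sum_card_goodSet : ∑ w ∈ reachSet G L f v, (goodSet G L s f t p w).card =
    ∑ y ∈ accSet G L s f, (sourceSet G L s f v t p y).card :=
  sum_card_bipartiteAbove_eq_sum_card_bipartiteBelow fun w y => ∃ c, GoodSolo G L s f t p w y c

lemma sum_sum_inv_card_sourceSet_le :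
    ∑ w ∈ reachSet G L f v, ∑ y ∈ goodSet G L s f t p w,
      ((sourceSet G L s f v t p y).card : ℚ)⁻¹ ≤ (accSet G L s f).card := by
  have hcomm : ∑ w ∈ reachSet G L f v, ∑ y ∈ goodSet G L s f t p w,
      ((sourceSet G L s f v t p y).card : ℚ)⁻¹ = ∑ y ∈ accSet G L s f,
      ∑ w ∈ sourceSet G L s f v t p y, ((sourceSet G L s f v t p y).card : ℚ)⁻¹ := by
    refine sum_comm' fun w y => ?_
    simp only [goodSet, sourceSet, mem_filter]
    tauto
  rw [hcomm, ← nsmul_one, ← sum_const]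
  refine sum_le_sum fun y _ => ?_
  rw [sum_const, nsmul_eq_mul]
  exact mul_inv_le_one

/-- There is no critical near colouring with many blocked and reachable colours. -/
lemma Critical.card_blocked_add_card_reachColors_le (h : Critical G L s f v) (hs : 0 < s)
    (hL : ∀ u, (L u).card = k) (hdeg : ∀ u, (univ.filter (G.Adj u)).card ≤ r)
    (hrk : r + 2 ≤ k) (hcard : Fintype.card V ≤ s * k) (hrs : r ≤ s) :
    (blocked G L s f).card + (reachColors G L s f v).card ≤ r := by
  by_contra! hlarge
  have : Nonempty V := ⟨v⟩
  obtain ⟨t, p, hcert⟩ := exists_certificate (G := G) (L := L) (s := s) f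
  have hfull := h.near.card_blocked_add_card_fullColors hs hcard
  have hB := h.near.card_blockedSet hs
  have hR := h.card_reachSet hs
  have hBA := card_blockedSet_add_card_accSet (G := G) (L := L) (s := s) (f := f)
  have hBR := card_sdiff_add_card_eq_card h.reachSet_subset
  have hbad := sum_badCount_le (G := G) (L := L) (s := s) (f := f) (t := t) hdeg
    (reachSet G L f v)
  have hupper : ∑ y ∈ accSet G L s f, (degIn G (blockedSet G L s f) y +
      (sourceSet G L s f v t p y).card) ≤ (accSet G L s f).card *
        ((blocked G L s f).card + (reachColors G L s f v).card - 1) := by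
    rw [← smul_eq_mul]
    refine sum_le_card_nsmul _ _ _ fun y _ => ?_
    rcases (sourceSet G L s f v t p y).eq_empty_or_nonempty with hy | ⟨w, hw⟩
    · rw [hy, card_empty]
      have := degIn_accSet_add_degIn_blockedSet_le (L := L) (s := s) (f := f) hdeg y
      omega
    · have h1 := h.degIn_blockedSet_le hs hcert hL hdeg hw
      have h2 := h.card_sourceSet_le hcert hw
      have h3 := h.add_degIn_reachSet_le hs hL hdeg (mem_filter.1 hw).1
      omega
  obtain ⟨x, hx, hkx⟩ : ∃ x, 0 < x ∧ k = (blocked G L s f).card + x :=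
    ⟨k - (blocked G L s f).card, by omega, by omega⟩
  have hacc : ∀ w, x ≤ ((L w).filter (Acc G L s f)).card := fun w => by
    have := card_le_card_blocked_add h.near hs w
    rw [hL] at this
    omega
  have hlow₁ : (blockedSet G L s f \ reachSet G L f v).card * x ≤
      ∑ w ∈ blockedSet G L s f \ reachSet G L f v, degIn G (accSet G L s f) w := by
    rw [← smul_eq_mul]
    exact card_nsmul_le_sum _ _ _ fun w hw =>
      (hacc w).trans (h.card_filter_acc_le (mem_sdiff.1 hw).1)
  have hlow₂ : (reachSet G L f v).card * (2 * x) ≤ ∑ w ∈ reachSet G L f v,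
      (degIn G (accSet G L s f) w + (goodSet G L s f t p w).card + badCount G L s f t w) := by
    rw [← smul_eq_mul]
    exact card_nsmul_le_sum _ _ _ fun w hw => (Nat.mul_le_mul_left 2 (hacc w)).trans
      (h.two_mul_card_filter_acc_le hs t p (h.reachSet_subset hw))
  rw [sum_add_distrib, sum_add_distrib, sum_card_goodSet] at hlow₂
  rw [sum_add_distrib, ← sum_degIn_comm, ← sum_sdiff h.reachSet_subset] at hupper
  have hA : (accSet G L s f).card + 1 ≤ s * x := by
    rw [hkx, mul_add] at hcard; omega
  have hD : (fullColors G L s f).card + 1 ≤ x := by omega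
  have htotal : (blockedSet G L s f \ reachSet G L f v).card * x +
      (reachSet G L f v).card * (2 * x) ≤ (accSet G L s f).card *
        ((blocked G L s f).card + (reachColors G L s f v).card - 1) +
        r * (fullColors G L s f).card := by omega
  obtain ⟨n, hn⟩ : ∃ n, (blocked G L s f).card + (reachColors G L s f v).card = n + 1 :=
    ⟨_, (Nat.succ_pred_eq_of_pos (by omega)).symm⟩
  rw [hn, Nat.add_sub_cancel] at htotal
  rw [hB, hR] at hBR
  rw [hR] at htotal
  clear hupper hlow₁ hlow₂ hbad hacc
  generalize (blocked G L s f).card = m at *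
  generalize (reachColors G L s f v).card = ρ at *
  generalize (accSet G L s f).card = a at *
  generalize (fullColors G L s f).card = D at *
  generalize (blockedSet G L s f \ reachSet G L f v).card = M at *
  have h1 : (M + (s * ρ + 1)) * x = (s * m + 1) * x := by rw [hBR]
  have h2 : (a + 1) * n ≤ s * x * n := Nat.mul_le_mul_right _ hA
  have h3 : r * (D + 1) ≤ s * x := Nat.mul_le_mul hrs hD
  have h4 : s * x * (m + ρ) = s * x * (n + 1) := by rw [hn]
  nlinarith

lemma mul_le_mul_of_solo_bound {x i n b q g : ℕ} (hg : 1 ≤ g) (hx : x + 1 = g + q)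
    (hn : g + i ≤ n + b) (hq : i + 1 ≤ q) : x * (1 + i) ≤ (n + b * (1 + i)) * q := by
  obtain ⟨e, rfl⟩ := Nat.exists_eq_add_of_le hq
  obtain ⟨g, rfl⟩ := Nat.exists_eq_add_of_le hg
  obtain rfl : x = 1 + g + i + e := by omega
  calc (1 + g + i + e) * (1 + i) ≤ (1 + g + i + e) * (1 + i) + e * g := Nat.le_add_right _ _
    _ = (1 + g + i) * (i + 1 + e) := by ring
    _ ≤ (n + b * (1 + i)) * (i + 1 + e) :=
      Nat.mul_le_mul_right _ (hn.trans (Nat.add_le_add_left (Nat.le_mul_of_pos_right _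
        (by omega)) _))

lemma solo_count_contradiction {s x q a D r ρ κ k : ℕ} (hA : a + 1 ≤ s * x) (hD : D + 1 ≤ x)
    (hmain : (s * ρ + 1) * x ≤ (a + r * D) * q) (hr : r ^ 3 ≤ s * k) (hk : k = r + 1 + κ)
    (hκ : 1 ≤ κ) (hρ : ρ = q + κ) (hρr : 2 * ρ ≤ r) : False := by
  have h1 : s * κ < r * q := by
    have h2 : (a + 1) * q ≤ s * x * q := Nat.mul_le_mul_right _ hA
    have h3 : r * (D + 1) * q ≤ r * x * q :=
      Nat.mul_le_mul_right _ (Nat.mul_le_mul_left _ hD)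
    rw [hρ] at hmain
    refine Nat.lt_of_mul_lt_mul_right (a := x) ?_
    nlinarith
  have h4 : k ≤ κ * (r + 2) := by
    obtain ⟨e, rfl⟩ := Nat.exists_eq_add_of_le hκ
    nlinarith
  have h5 : s * k ≤ s * κ * (r + 2) := by
    rw [mul_assoc]; exact Nat.mul_le_mul_left _ h4
  have h6 : 2 * (q + 1) ≤ r := by omega
  have h7 : s * κ * (r + 2) ≤ r * q * (r + 2) := Nat.mul_le_mul_right _ h1.le
  have h8 : 0 < r := by omega
  have h9 : r * r * (2 * (q + 1)) ≤ r * r * r := Nat.mul_le_mul_left _ h6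
  have h10 : r * (2 * (q + 1)) ≤ r * r := Nat.mul_le_mul_left _ h6
  nlinarith

/-- There is no critical near colouring with few blocked and reachable colours. -/
lemma Critical.lt_card_blocked_add_card_reachColors (h : Critical G L s f v) (hs : 0 < s)
    (hL : ∀ u, (L u).card = k) (hdeg : ∀ u, (univ.filter (G.Adj u)).card ≤ r)
    (hrk : r + 2 ≤ k) (hcard : Fintype.card V ≤ s * k) (hr : r ^ 3 ≤ s * k) :
    r < (blocked G L s f).card + (reachColors G L s f v).card := by
  by_contra! hsmall
  have : Nonempty V := ⟨v⟩
  obtain ⟨t, p, hcert⟩ := exists_certificate (G := G) (L := L) (s := s) f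
  have hfull := h.near.card_blocked_add_card_fullColors hs hcard
  have hB := h.near.card_blockedSet hs
  have hR := h.card_reachSet hs
  have hBA := card_blockedSet_add_card_accSet (G := G) (L := L) (s := s) (f := f)
  have hbad := sum_badCount_le (G := G) (L := L) (s := s) (f := f) (t := t) hdeg
    (reachSet G L f v)
  have hRB : (reachColors G L s f v).card ≤ (blocked G L s f).card := card_filter_le _ _
  obtain ⟨x, hx, hkx⟩ : ∃ x, 0 < x ∧ k = (blocked G L s f).card + x :=
    ⟨k - (blocked G L s f).card, by omega, by omega⟩
  have hA : (accSet G L s f).card + 1 ≤ s * x := by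
    rw [hkx, mul_add] at hcard; omega
  have hD : (fullColors G L s f).card + 1 ≤ x := by omega
  have hv := h.add_degIn_reachSet_le hs hL hdeg h.mem_reachSet
  obtain ⟨q, hq⟩ : ∃ q, (reachColors G L s f v).card + r + 1 = k + q :=
    ⟨(reachColors G L s f v).card + r + 1 - k, by omega⟩
  have hq0 : 0 < q := by omega
  have hlow : ∀ w ∈ reachSet G L f v, (x : ℚ) / q - badCount G L s f t w ≤
      ∑ y ∈ goodSet G L s f t p w, ((sourceSet G L s f v t p y).card : ℚ)⁻¹ := fun w hw => by
    have h1 := h.degIn_add_le hdeg hw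
    have h2 := h.two_mul_card_filter_acc_le hs t p (h.reachSet_subset hw)
    have h3 := h.card_list_eq w
    have h4 := h.card_filter_reach_le hs w
    have h5 := card_le_card_blocked_add h.near hs w
    have h6 := h.add_degIn_reachSet_le hs hL hdeg hw
    rw [hL] at h3 h5
    have h7 : ((goodSet G L s f t p w).card : ℚ) / (1 + degIn G (reachSet G L f v) w) ≤
        ∑ y ∈ goodSet G L s f t p w, ((sourceSet G L s f v t p y).card : ℚ)⁻¹ := by
      rw [div_eq_mul_inv, ← nsmul_eq_mul]
      refine card_nsmul_le_sum _ _ _ fun y hy => ?_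
      have hwy : w ∈ sourceSet G L s f v t p y := mem_filter.2 ⟨hw, (mem_filter.1 hy).2⟩
      have hpos : 0 < (sourceSet G L s f v t p y).card := card_pos.2 ⟨w, hwy⟩
      refine inv_anti₀ (by exact_mod_cast hpos) ?_
      exact_mod_cast h.card_sourceSet_le hcert hwy
    refine le_trans ?_ h7
    have h8 : 2 * k + degIn G (reachSet G L f v) w ≤ (goodSet G L s f t p w).card +
        badCount G L s f t w + (reachColors G L s f v).card + (blocked G L s f).card + r := by
      omega
    generalize degIn G (reachSet G L f v) w = i at *
    generalize (goodSet G L s f t p w).card = n at *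
    generalize badCount G L s f t w = b at *
    have hqQ : (0 : ℚ) < q := by exact_mod_cast hq0
    rw [sub_le_iff_le_add, div_add' _ _ _ (by positivity), div_le_div_iff₀ hqQ (by positivity)]
    have h9 : x * (1 + i) ≤ (n + b * (1 + i)) * q :=
      mul_le_mul_of_solo_bound (g := x + 1 - q) (by omega) (by omega) (by omega) (by omega)
    exact_mod_cast h9
  have hsum := (sum_le_sum hlow).trans sum_sum_inv_card_sourceSet_le
  rw [sum_sub_distrib, sum_const, nsmul_eq_mul, hR] at hsum
  have hmain : (s * (reachColors G L s f v).card + 1) * x ≤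
      ((accSet G L s f).card + r * (fullColors G L s f).card) * q := by
    have hbadQ : ∑ w ∈ reachSet G L f v, (badCount G L s f t w : ℚ) ≤
        r * (fullColors G L s f).card := by exact_mod_cast hbad
    have hqQ : (0 : ℚ) < q := by exact_mod_cast hq0
    have := hsum.trans' (sub_le_sub_left hbadQ _)
    rw [sub_le_iff_le_add, ← mul_div_assoc, div_le_iff₀ hqQ] at this
    exact_mod_cast this
  clear hsum hlow hbad
  generalize (blocked G L s f).card = m at *
  generalize (reachColors G L s f v).card = ρ at *
  generalize (accSet G L s f).card = a at *
  generalize (fullColors G L s f).card = D at *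
  exact solo_count_contradiction (ρ := ρ) (κ := k - r - 1) hA hD hmain hr (by omega) (by omega)
    (by omega) (by omega)

end Discharging

section Extension

variable {V : Type*} [Fintype V] {G : SimpleGraph V} {L : V → Finset ℕ} {s k r : ℕ}
  {f : V → Option ℕ} {v : V}

/-- A near colouring of a graph with small maximum degree can be completed. -/
theorem NearColoring.boundedColorable (h : NearColoring G L s f v) (hL : ∀ u, (L u).card = k)
    (hdeg : ∀ u, (univ.filter (G.Adj u)).card ≤ r) (hrk : r + 2 ≤ k)
    (hcard : Fintype.card V ≤ s * k) (hr : r ^ 3 ≤ s * k) : BoundedColorable G L s := by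
  by_contra hG
  have : Nonempty V := ⟨v⟩
  have hs : 0 < s := Nat.pos_of_mul_pos_right (Fintype.card_pos.trans_le hcard)
  obtain ⟨f, v, h⟩ := exists_critical h hG
  have h1 := h.card_blocked_lt hs hL hdeg hcard
  have h2 : (reachColors G L s f v).card ≤ (blocked G L s f).card := card_filter_le _ _
  have h3 := h.add_degIn_reachSet_le hs hL hdeg h.mem_reachSet
  have hrs : r ≤ s := by
    by_contra! hsr
    have h4 : s * k ≤ r * (2 * r) := Nat.mul_le_mul hsr.le (by omega)
    have h5 : 3 * (r * r) ≤ r * (r * r) := Nat.mul_le_mul_right _ (by omega)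
    have h6 : 0 < r * r := Nat.mul_pos (by omega) (by omega)
    nlinarith
  exact absurd (h.card_blocked_add_card_reachColors_le hs hL hdeg hrk hcard hrs)
    (not_le.2 (h.lt_card_blocked_add_card_reachColors hs hL hdeg hrk hcard hr))

theorem boundedColorable_of_cube_le (hL : ∀ u, (L u).card = k)
    (hdeg : ∀ u, (univ.filter (G.Adj u)).card ≤ r) (hrk : r + 2 ≤ k)
    (hcard : Fintype.card V ≤ s * k) (hr : r ^ 3 ≤ s * k) : BoundedColorable G L s := by
  suffices h : ∀ S : Finset V, ∃ f : V → ℕ, (∀ v ∈ S, f v ∈ L v) ∧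
      (∀ u ∈ S, ∀ v ∈ S, G.Adj u v → f u ≠ f v) ∧ ∀ c, (S.filter fun v => f v = c).card ≤ s by
    obtain ⟨f, h1, h2, h3⟩ := h univ
    exact ⟨f, fun v => h1 v (mem_univ _), fun u v => h2 u (mem_univ _) v (mem_univ _), h3⟩
  intro S
  induction S using Finset.induction_on with
  | empty => exact ⟨fun _ => 0, by simp, by simp, by simp⟩
  | insert a S ha ih =>
  obtain ⟨f, hmem, hproper, hclass⟩ := ih
  have hS : ∀ x : {x // x ∈ insert a S}, x.1 ≠ a → x.1 ∈ S := fun x hx =>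
    (mem_insert.1 x.2).resolve_left hx
  have hnear : NearColoring (G.comap (Subtype.val : {x // x ∈ insert a S} → V)) (fun x => L x.1) s
      (fun x => if x.1 = a then none else some (f x.1)) ⟨a, mem_insert_self a S⟩ := by
    refine ⟨fun x => ?_, fun x c hx => ?_, fun x y c hxy hx hy => ?_, fun c => ?_⟩
    · simp [Subtype.ext_iff]
    · split_ifs at hx with hxa
      rw [← Option.some.inj hx]
      exact hmem _ (hS x hxa)
    · split_ifs at hx hy with hxa hya
      exact hproper _ (hS x hxa) _ (hS y hya) hxy
        ((Option.some.inj hx).trans (Option.some.inj hy).symm)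
    · refine le_trans (card_le_card_of_injOn Subtype.val (fun x hx => ?_)
        Subtype.val_injective.injOn) (hclass c)
      have hx' := mem_colorClass.1 hx
      split_ifs at hx' with hxa
      simpa using ⟨hS x hxa, Option.some.inj hx'⟩
  obtain ⟨g, hg1, hg2, hg3⟩ := hnear.boundedColorable (k := k) (r := r) (fun x => hL x.1)
    (fun x => (card_le_card_of_injOn Subtype.val (fun y hy => by simpa using (mem_filter.1 hy).2)
      Subtype.val_injective.injOn).trans (hdeg x.1)) hrk
    ((Fintype.card_subtype_le _).trans hcard) hr
  refine ⟨fun x => if hx : x ∈ insert a S then g ⟨x, hx⟩ else 0, fun x hx => ?_,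
    fun x hx y hy hxy => ?_, fun c => ?_⟩
  · simpa only [dif_pos hx] using hg1 ⟨x, hx⟩
  · simpa only [dif_pos hx, dif_pos hy] using hg2 (u := ⟨x, hx⟩) (v := ⟨y, hy⟩) hxy
  · refine le_trans (card_le_card (t := (univ.filter fun x => g x = c).map
      (Function.Embedding.subtype _)) fun x hx => ?_) ((card_map _).trans_le (hg3 c))
    obtain ⟨hxS, hxc⟩ := mem_filter.1 hx
    simp only [dif_pos hxS] at hxc
    exact mem_map.2 ⟨⟨x, hxS⟩, mem_filter.2 ⟨mem_univ _, hxc⟩, rfl⟩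

end Extension

end EquitableList

/-- **Kierstead–Kostochka (2013).** Let `G` be a graph with `|V(G)| ≥ Δ(G)³`. Then `G`
is equitably `k`-choosable for every `k ≥ Δ(G) + 2`. -/
theorem equitably_choosable_many_vertices {V : Type*} [Fintype V] (G : SimpleGraph V)
    [DecidableRel G.Adj] (hbig : G.maxDegree ^ 3 ≤ Fintype.card V)
    (k : ℕ) (hk : G.maxDegree + 2 ≤ k) :
    EquitablyChoosable G k := by
  intro L hL
  have hcard : Fintype.card V ≤ (Fintype.card V + k - 1) / k * k := by
    have h1 := Nat.div_add_mod (Fintype.card V + k - 1) k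
    have h2 := Nat.mod_lt (Fintype.card V + k - 1) (show 0 < k by omega)
    rw [mul_comm] at h1
    omega
  obtain ⟨f, hf, hproper, hclass⟩ := EquitableList.boundedColorable_of_cube_le (G := G) hL
    (fun u => by
      refine le_of_eq_of_le ?_ (G.degree_le_maxDegree u)
      rw [← G.card_neighborFinset_eq_degree, G.neighborFinset_eq_filter]
      congr) hk hcard (hbig.trans hcard)
  exact ⟨f, hf, hproper, fun c => by convert hclass c⟩
end

section
/- Every graph G such that d(x) + d(y) ≤ 6 for every edge xy of G is equitably 4-choosable. -/
namespace OreListColoring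

set_option linter.unusedSectionVars false

open Finset Function

variable {V : Type*} [Fintype V]

/-- The color class of `c` under `f`. -/
def colorClass (f : V → ℕ) (c : ℕ) : Finset V := univ.filter fun v => f v = c

/-- `G` has a proper `L`-coloring all of whose color classes have at most `m` vertices. -/
def CappedColorable (G : SimpleGraph V) (L : V → Finset ℕ) (m : ℕ) : Prop :=
  ∃ f : V → ℕ, (∀ v, f v ∈ L v) ∧ (∀ ⦃u v⦄, G.Adj u v → f u ≠ f v) ∧
    ∀ c, (colorClass f c).card ≤ m

/-- A proper `L`-coloring in which all color classes have at most `m` vertices, except that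
the class of `w` may have one more. -/
structure NearColoring (G : SimpleGraph V) (L : V → Finset ℕ) (m : ℕ) (f : V → ℕ) (w : ℕ) :
    Prop where
  mem_list : ∀ v, f v ∈ L v
  proper : ∀ ⦃u v⦄, G.Adj u v → f u ≠ f v
  excess : (colorClass f w).card ≤ m + 1
  cap : ∀ c, c ≠ w → (colorClass f c).card ≤ m

/-- The vertex `v` can be recolored with the new color `e`. -/
def Movable (G : SimpleGraph V) (L : V → Finset ℕ) (f : V → ℕ) (v : V) (e : ℕ) : Prop :=
  e ∈ L v ∧ e ≠ f v ∧ ∀ u, G.Adj v u → f u ≠ e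

/-- The vertex `z` is the only neighbor of `y` with its color, and that color is in `L y`. -/
def Solo (G : SimpleGraph V) (L : V → Finset ℕ) (f : V → ℕ) (y z : V) : Prop :=
  G.Adj y z ∧ f z ∈ L y ∧ ∀ u, G.Adj y u → f u = f z → u = z

@[simp]
theorem mem_colorClass {f : V → ℕ} {c : ℕ} {v : V} : v ∈ colorClass f c ↔ f v = c := by
  simp [colorClass]

section Update

variable [DecidableEq V]

theorem card_colorClass_update_new {f : V → ℕ} {v : V} {e : ℕ} (h : f v ≠ e) :
    (colorClass (update f v e) e).card = (colorClass f e).card + 1 := by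
  have : colorClass (update f v e) e = insert v (colorClass f e) := by
    ext u
    by_cases hu : u = v <;> simp [hu]
  rw [this, card_insert_of_notMem (by simpa using h)]

theorem card_colorClass_update_old {f : V → ℕ} {v : V} {e : ℕ} (h : f v ≠ e) :
    (colorClass (update f v e) (f v)).card + 1 = (colorClass f (f v)).card := by
  have : colorClass (update f v e) (f v) = (colorClass f (f v)).erase v := by
    ext u
    by_cases hu : u = v <;> simp [hu, h.symm]
  rw [this, card_erase_add_one (by simp)]

theorem card_colorClass_update_le {f : V → ℕ} {v : V} {e c : ℕ} (h : c ≠ e) :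
    (colorClass (update f v e) c).card ≤ (colorClass f c).card := by
  refine card_le_card fun u => ?_
  by_cases hu : u = v <;> simp [hu, h.symm]

end Update

section Moves

variable {G : SimpleGraph V} {L : V → Finset ℕ} {m : ℕ} {f : V → ℕ} {w : ℕ}

theorem NearColoring.lt_card (h : NearColoring G L m f w) (hno : ¬ CappedColorable G L m) :
    m < (colorClass f w).card := by
  by_contra! hc
  refine hno ⟨f, h.mem_list, h.proper, fun c => ?_⟩
  by_cases hcw : c = w
  · exact hcw ▸ hc
  · exact h.cap c hcw

variable [DecidableEq V]

/-- Recoloring a vertex. -/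
theorem NearColoring.recolor_proper (h : NearColoring G L m f w) {v : V} {e : ℕ}
    (hv : Movable G L f v e) :
    (∀ u, update f v e u ∈ L u) ∧ ∀ ⦃a b⦄, G.Adj a b → update f v e a ≠ update f v e b := by
  refine ⟨fun u => ?_, fun a b hab => ?_⟩
  · by_cases hu : u = v
    · subst hu; simpa using hv.1
    · simpa [hu] using h.mem_list u
  · have := h.proper hab
    by_cases ha : a = v
    · subst ha
      have hb : b ≠ a := hab.ne'
      simpa [hb] using (hv.2.2 b hab).symm
    · by_cases hb : b = v
      · subst hb
        simpa [ha] using hv.2.2 a hab.symm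
      · simpa [ha, hb] using this

/-- Moving a vertex into a class with fewer than `m` vertices. -/
theorem NearColoring.recolor (h : NearColoring G L m f w) {v : V} {e : ℕ}
    (hv : Movable G L f v e) (he : (colorClass f e).card < m) :
    NearColoring G L m (update f v e) w := by
  obtain ⟨h1, h2⟩ := h.recolor_proper hv
  have hnew := card_colorClass_update_new hv.2.1.symm
  refine ⟨h1, h2, ?_, fun c hc => ?_⟩
  · by_cases hwe : w = e
    · subst hwe; omega
    · exact (card_colorClass_update_le hwe).trans h.excess
  · by_cases hce : c = e
    · subst hce; omega
    · exact (card_colorClass_update_le hce).trans (h.cap c hc)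

/-- Moving a vertex of the large class elsewhere shifts the excess. -/
theorem NearColoring.shift (h : NearColoring G L m f w) {v : V} {e : ℕ}
    (hvw : f v = w) (hv : Movable G L f v e) :
    NearColoring G L m (update f v e) e := by
  obtain ⟨h1, h2⟩ := h.recolor_proper hv
  have hnew := card_colorClass_update_new hv.2.1.symm
  have hold := card_colorClass_update_old hv.2.1.symm
  have hex := h.excess
  have hew : e ≠ w := hvw ▸ hv.2.1
  refine ⟨h1, h2, ?_, fun c hc => ?_⟩
  · have := h.cap e hew; omega
  · by_cases hcw : c = w
    · rw [hvw] at hold; rw [hcw]; omega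
    · exact (card_colorClass_update_le hc).trans (h.cap c hcw)

/-- No vertex of the large class moves to a small class. -/
theorem NearColoring.le_card_of_movable (h : NearColoring G L m f w)
    (hno : ¬ CappedColorable G L m) {y : V} {e : ℕ} (hy : f y = w) (hm : Movable G L f y e) :
    m ≤ (colorClass f e).card := by
  by_contra! he
  have h1 := (h.shift hy hm).lt_card hno
  have := card_colorClass_update_new hm.2.1.symm
  omega

/-- A solo neighbor of a vertex in the large class does not move to a small class. -/
theorem NearColoring.le_card_of_solo (h : NearColoring G L m f w)
    (hno : ¬ CappedColorable G L m) {y z : V} {e : ℕ} (hy : f y = w) (hs : Solo G L f y z)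
    (hm : Movable G L f z e) : m ≤ (colorClass f e).card := by
  by_contra! he
  have hyz : y ≠ z := hs.1.ne
  have hne := h.proper hs.1
  have h1 := h.recolor hm he
  have hold := card_colorClass_update_old hm.2.1.symm
  have hcap := h.cap (f z) (by rw [← hy]; exact hne.symm)
  have h2 := h1.le_card_of_movable hno (y := y) (e := f z) (by simp [hyz, hy])
    ⟨hs.2.1, by simpa [hyz] using hne.symm, fun u hu hfu => ?_⟩
  · omega
  · by_cases huz : u = z
    · subst huz; exact hm.2.1 (by simpa using hfu)
    · exact huz (hs.2.2 u hu (by simpa [huz] using hfu))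

/-- Two steps: a vertex of the large class moves to a class from which some vertex moves to a
small class. -/
theorem NearColoring.not_movable_two (h : NearColoring G L m f w)
    (hno : ¬ CappedColorable G L m) {y u : V} {e e' : ℕ} (hy : f y = w)
    (hm : Movable G L f y e) (hu : f u = e) (hmu : Movable G L f u e') :
    m ≤ (colorClass f e').card := by
  by_contra! he'
  have h1 := h.recolor hmu he'
  have hold := card_colorClass_update_old hmu.2.1.symm
  have hew : e ≠ w := hy ▸ hm.2.1
  have hcap := h.cap e hew
  have huy : y ≠ u := by rintro rfl; exact hew (hu.symm.trans hy)
  have h2 := h1.le_card_of_movable hno (y := y) (e := e) (by simp [huy, hy])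
    ⟨hm.1, by simpa [huy] using hm.2.1, fun a ha hfa => ?_⟩
  · rw [hu] at hold; omega
  · by_cases hau : a = u
    · subst hau; exact hmu.2.1 (by rw [hu]; simpa using hfa)
    · exact hm.2.2 a ha (by simpa [hau] using hfa)

theorem NearColoring.not_movable_three (h : NearColoring G L m f w)
    (hno : ¬ CappedColorable G L m) {y u t : V} {e g e' : ℕ} (hy : f y = w)
    (hm : Movable G L f y e) (hu : f u = e) (hmu : Movable G L f u g) (ht : f t = g)
    (hmt : Movable G L f t e') : m ≤ (colorClass f e').card := by
  by_contra! he'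
  have h1 := h.recolor hmt he'
  have hold := card_colorClass_update_old hmt.2.1.symm
  have hgw : g ≠ w := by
    rintro rfl
    exact absurd (h.le_card_of_movable hno ht hmt) (by omega)
  have hcap := h.cap g hgw
  have hee : e' ≠ e := by
    rintro rfl
    exact absurd (h.le_card_of_movable hno hy hm) (by omega)
  have hty : y ≠ t := by rintro rfl; exact hgw (ht.symm.trans hy)
  have htu : u ≠ t := by rintro rfl; exact hmu.2.1 (ht.symm)
  have h2 := h1.not_movable_two hno (y := y) (e := e) (u := u) (e' := g) (by simp [hty, hy])
    ⟨hm.1, by simpa [hty] using hm.2.1, fun a ha hfa => ?_⟩ (by simp [htu, hu])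
    ⟨hmu.1, by simpa [htu] using hmu.2.1, fun a ha hfa => ?_⟩
  · rw [ht] at hold; omega
  · by_cases hat : a = t
    · subst hat; exact hee (by simpa using hfa)
    · exact hm.2.2 a ha (by simpa [hat] using hfa)
  · by_cases hat : a = t
    · subst hat; exact hmt.2.1 (by rw [ht]; simpa using hfa)
    · exact hmu.2.2 a ha (by simpa [hat] using hfa)

/-- A solo neighbor `z` of a vertex `y` in the large class moves to a class from which `u` moves
to a small class `e'`: this is only possible if `e'` is the class of `z` and `u` is adjacent
to `y`. -/
theorem NearColoring.solo_two (h : NearColoring G L m f w)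
    (hno : ¬ CappedColorable G L m) {y z u : V} {e e' : ℕ} (hy : f y = w)
    (hs : Solo G L f y z) (hm : Movable G L f z e) (hu : f u = e) (hmu : Movable G L f u e')
    (he' : (colorClass f e').card < m) : e' = f z ∧ G.Adj y u := by
  by_contra hcon
  have h1 := h.recolor hmu he'
  have hold := card_colorClass_update_old hmu.2.1.symm
  have hew : e ≠ w := by rintro rfl; exact hm.2.2 y hs.1.symm hy
  have hcap := h.cap e hew
  have huy : y ≠ u := by rintro rfl; exact hew (hu.symm.trans hy)
  have huz : z ≠ u := by rintro rfl; exact hm.2.1 hu.symm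
  have h2 := h1.le_card_of_solo hno (y := y) (z := z) (e := e) (by simp [huy, hy])
    ⟨hs.1, by simpa [huz] using hs.2.1, fun a ha hfa => ?_⟩
    ⟨hm.1, by simpa [huz] using hm.2.1, fun a ha hfa => ?_⟩
  · rw [hu] at hold; omega
  · by_cases hau : a = u
    · subst hau; exact absurd ⟨by simpa [huz] using hfa, ha⟩ hcon
    · exact hs.2.2 a ha (by simpa [hau, huz] using hfa)
  · by_cases hau : a = u
    · subst hau; exact hmu.2.1 (by rw [hu]; simpa using hfa)
    · exact hm.2.2 a ha (by simpa [hau] using hfa)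

/-- If all neighbors of `y` in the large class are solo, none of them moves to a class from
which a vertex moves to a small class. -/
theorem NearColoring.closed_two (h : NearColoring G L m f w)
    (hno : ¬ CappedColorable G L m) {y z u : V} {e e' : ℕ} (hy : f y = w)
    (hs : ∀ a, G.Adj y a → Solo G L f y a) (hz : G.Adj y z) (hm : Movable G L f z e)
    (hu : f u = e) (hmu : Movable G L f u e') : m ≤ (colorClass f e').card := by
  by_contra! he'
  obtain ⟨-, hyu⟩ := h.solo_two hno hy (hs z hz) hm hu hmu he'
  exact absurd (h.le_card_of_solo hno hy (hs u hyu) hmu) (by omega)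

theorem NearColoring.closed_three (h : NearColoring G L m f w)
    (hno : ¬ CappedColorable G L m) {y z u t : V} {e g e' : ℕ} (hy : f y = w)
    (hs : ∀ a, G.Adj y a → Solo G L f y a) (hz : G.Adj y z) (hm : Movable G L f z e)
    (hu : f u = e) (hmu : Movable G L f u g) (ht : f t = g) (hmt : Movable G L f t e') :
    m ≤ (colorClass f e').card := by
  by_contra! he'
  have small {a : V} (ha : G.Adj y a) (hma : Movable G L f a e') : False :=
    absurd (h.le_card_of_solo hno hy (hs a ha) hma) (by omega)
  have h1 := h.recolor hmt he'
  have hold := card_colorClass_update_old hmt.2.1.symm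
  have hgw : g ≠ w := by
    rintro rfl
    exact absurd (h.le_card_of_movable hno ht hmt) (by omega)
  have hcap := h.cap g hgw
  have hee : e' ≠ e := by
    rintro rfl
    exact small hz hm
  have hty : y ≠ t := by rintro rfl; exact hgw (ht.symm.trans hy)
  have htu : u ≠ t := by rintro rfl; exact hmu.2.1 (ht.symm)
  have htz : z ≠ t := by rintro rfl; exact small hz hmt
  have h2 := h1.solo_two hno (y := y) (z := z) (e := e) (u := u) (e' := g) (by simp [hty, hy])
    ⟨hz, by simpa [htz] using (hs z hz).2.1, fun a ha hfa => ?_⟩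
    ⟨hm.1, by simpa [htz] using hm.2.1, fun a ha hfa => ?_⟩ (by simp [htu, hu])
    ⟨hmu.1, by simpa [htu] using hmu.2.1, fun a ha hfa => ?_⟩ (by rw [ht] at hold; omega)
  · exact absurd (h.closed_two hno hy hs h2.2 hmu ht hmt) (by omega)
  · by_cases hat : a = t
    · subst hat; exact (small ha hmt).elim
    · exact (hs z hz).2.2 a ha (by simpa [hat, htz] using hfa)
  · by_cases hat : a = t
    · subst hat; exact hee (by simpa using hfa)
    · exact hm.2.2 a ha (by simpa [hat] using hfa)
  · by_cases hat : a = t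
    · subst hat; exact hmt.2.1 (by rw [ht]; simpa using hfa)
    · exact hmu.2.2 a ha (by simpa [hat] using hfa)

/-- Along a path `x, y, z` of solo neighbors that starts in the large class, the last vertex does
not move to a small class. -/
theorem NearColoring.le_card_of_solo_solo (h : NearColoring G L m f w)
    (hno : ¬ CappedColorable G L m) {x y z : V} {e : ℕ} (hx : f x = w) (hxy : Solo G L f x y)
    (hyz : Solo G L f y z) (hzw : f z ≠ w) (hm : Movable G L f z e) (hey : e ≠ f y) :
    m ≤ (colorClass f e).card := by
  by_contra! he
  have h1 := h.recolor hm he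
  have hold := card_colorClass_update_old hm.2.1.symm
  have hcap := h.cap (f z) hzw
  have hxz : x ≠ z := by rintro rfl; exact hzw hx
  have hyz' : y ≠ z := hyz.1.ne
  have h2 := h1.le_card_of_solo hno (y := x) (z := y) (e := f z) (by simp [hxz, hx])
    ⟨hxy.1, by simpa [hyz'] using hxy.2.1, fun a ha hfa => ?_⟩
    ⟨hyz.2.1, by simpa [hyz'] using (h.proper hyz.1).symm, fun a ha hfa => ?_⟩
  · omega
  · by_cases haz : a = z
    · subst haz; exact absurd (by simpa [hyz'] using hfa) hey
    · exact hxy.2.2 a ha (by simpa [haz, hyz'] using hfa)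
  · by_cases haz : a = z
    · subst haz; exact hm.2.1 (by simpa using hfa)
    · exact haz (hyz.2.2 a ha (by simpa [haz] using hfa))

theorem NearColoring.solo_solo_two (h : NearColoring G L m f w)
    (hno : ¬ CappedColorable G L m) {x y z u : V} {e e' : ℕ} (hx : f x = w)
    (hxy : Solo G L f x y) (hyz : Solo G L f y z) (hzw : f z ≠ w) (hm : Movable G L f z e)
    (hey : e ≠ f y) (hew : e ≠ w) (hu : f u = e) (hmu : Movable G L f u e')
    (hey' : e' ≠ f y) (he' : (colorClass f e').card < m) : e' = f z ∧ G.Adj y u := by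
  by_contra hcon
  have h1 := h.recolor hmu he'
  have hold := card_colorClass_update_old hmu.2.1.symm
  have hcap := h.cap e hew
  have hux : x ≠ u := by rintro rfl; exact hew (hu.symm.trans hx)
  have huy : y ≠ u := by rintro rfl; exact hey hu.symm
  have huz : z ≠ u := by rintro rfl; exact hm.2.1 hu.symm
  have h2 := h1.le_card_of_solo_solo hno (x := x) (y := y) (z := z) (e := e) (by simp [hux, hx])
    ⟨hxy.1, by simpa [huy] using hxy.2.1, fun a ha hfa => ?_⟩
    ⟨hyz.1, by simpa [huz] using hyz.2.1, fun a ha hfa => ?_⟩ (by simpa [huz] using hzw)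
    ⟨hm.1, by simpa [huz] using hm.2.1, fun a ha hfa => ?_⟩ (by simpa [huy] using hey)
  · rw [hu] at hold; omega
  · by_cases hau : a = u
    · subst hau; exact absurd (by simpa [huy] using hfa) hey'
    · exact hxy.2.2 a ha (by simpa [hau, huy] using hfa)
  · by_cases hau : a = u
    · subst hau; exact absurd ⟨by simpa [huz] using hfa, ha⟩ hcon
    · exact hyz.2.2 a ha (by simpa [hau, huz] using hfa)
  · by_cases hau : a = u
    · subst hau; exact hmu.2.1 (by rw [hu]; simpa using hfa)
    · exact hm.2.2 a ha (by simpa [hau] using hfa)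

end Moves

section Counting

variable {G : SimpleGraph V} {L : V → Finset ℕ} {m : ℕ} {f : V → ℕ} {w : ℕ} {B : Finset ℕ}

/-- No vertex with color in `B` can be recolored with a color outside `B`. -/
def Blocked (G : SimpleGraph V) (L : V → Finset ℕ) (f : V → ℕ) (B : Finset ℕ) : Prop :=
  ∀ v, f v ∈ B → ∀ e, e ∉ B → ¬ Movable G L f v e

/-- The vertices with color in `B`. -/
def inside (f : V → ℕ) (B : Finset ℕ) : Finset V := univ.filter fun v => f v ∈ B

/-- The vertices with color not in `B`. -/
def outside (f : V → ℕ) (B : Finset ℕ) : Finset V := univ.filter fun v => f v ∉ B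

@[simp]
theorem mem_inside {v : V} : v ∈ inside f B ↔ f v ∈ B := by simp [inside]

@[simp]
theorem mem_outside {v : V} : v ∈ outside f B ↔ f v ∉ B := by simp [outside]

theorem card_inside_add_card_outside (f : V → ℕ) (B : Finset ℕ) :
    (inside f B).card + (outside f B).card = Fintype.card V := by
  simpa [inside, outside] using
    card_filter_add_card_filter_not (s := (univ : Finset V)) (fun v => f v ∈ B)

theorem card_inside (f : V → ℕ) (B : Finset ℕ) :
    (inside f B).card = ∑ c ∈ B, (colorClass f c).card := by
  rw [card_eq_sum_card_fiberwise (f := f) (t := B) (fun v hv => by simpa using hv)]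
  refine sum_congr rfl fun c hc => ?_
  congr 1
  ext v
  simp only [mem_filter, mem_inside, mem_colorClass]
  exact ⟨fun h => h.2, fun h => ⟨h ▸ hc, h⟩⟩

theorem NearColoring.lt_card_inside (h : NearColoring G L m f w)
    (hno : ¬ CappedColorable G L m) (hw : w ∈ B) (hB : ∀ c ∈ B, m ≤ (colorClass f c).card) :
    B.card * m + 1 ≤ (inside f B).card := by
  have hlt := h.lt_card hno
  rw [card_inside, ← add_sum_erase B _ hw]
  have h1 : (B.erase w).card * m ≤ ∑ c ∈ B.erase w, (colorClass f c).card := by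
    rw [← smul_eq_mul]
    exact card_nsmul_le_sum _ _ _ fun c hc => hB c (mem_of_mem_erase hc)
  have h2 := card_erase_add_one hw
  rw [← h2, add_mul]
  omega

/-- At most three classes have `m` or more vertices. -/
theorem NearColoring.card_le_three (h : NearColoring G L m f w)
    (hno : ¬ CappedColorable G L m) (hV : Fintype.card V ≤ 4 * m) (hw : w ∈ B)
    (hB : ∀ c ∈ B, m ≤ (colorClass f c).card) : B.card ≤ 3 := by
  have h1 := h.lt_card_inside hno hw hB
  have h2 := card_inside_add_card_outside f B
  by_contra! h3
  have : 4 * m ≤ B.card * m := Nat.mul_le_mul_right m h3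
  omega

variable [DecidableRel G.Adj]

theorem sum_card_filter_adj_comm (X Y : Finset V) :
    ∑ v ∈ X, (Y.filter (G.Adj v)).card = ∑ z ∈ Y, (X.filter (G.Adj z)).card := by
  simp only [card_filter]
  rw [sum_comm]
  simp only [G.adj_comm]

variable [DecidableEq V]

instance (y z : V) : Decidable (Solo G L f y z) :=
  inferInstanceAs (Decidable (_ ∧ _ ∧ _))

theorem Blocked.exists_adj (hB : Blocked G L f B) {v : V} (hv : f v ∈ B) {e : ℕ} (he : e ∈ L v)
    (heB : e ∉ B) : ∃ u, G.Adj v u ∧ f u = e := by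
  by_contra! hcon
  exact hB v hv e heB ⟨he, fun h => heB (h ▸ hv), hcon⟩

theorem Blocked.le_card_adj (hB : Blocked G L f B) (hL : ∀ v, (L v).card = 4) {v : V}
    (hv : f v ∈ B) : 4 ≤ ((outside f B).filter (G.Adj v)).card + B.card := by
  have h1 : L v \ B ⊆ ((outside f B).filter (G.Adj v)).image f := by
    intro e he
    rw [mem_sdiff] at he
    obtain ⟨u, hu, rfl⟩ := hB.exists_adj hv he.1 he.2
    exact mem_image_of_mem f (by simp [hu, he.2])
  have h2 := (card_le_card h1).trans card_image_le
  have h3 := le_card_sdiff B (L v)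
  have h4 := hL v
  omega

/-- The colors outside `B` in the list of `y` are each represented by a solo neighbor of `y` or
by two neighbors. -/
theorem Blocked.le_card_adj_add_card_solo (hB : Blocked G L f B) (hL : ∀ v, (L v).card = 4)
    {y : V} (hy : f y ∈ B) :
    8 ≤ ((outside f B).filter (G.Adj y)).card + ((outside f B).filter (Solo G L f y)).card
      + 2 * B.card := by
  have key : ∀ e ∈ L y \ B, 2 ≤ (((outside f B).filter (G.Adj y)).filter (f · = e)).card
      + (((outside f B).filter (Solo G L f y)).filter (f · = e)).card := by
    intro e he
    rw [mem_sdiff] at he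
    obtain ⟨u, hu, rfl⟩ := hB.exists_adj hy he.1 he.2
    have hmem : u ∈ ((outside f B).filter (G.Adj y)).filter (f · = f u) := by simp [hu, he.2]
    by_cases hs : Solo G L f y u
    · have hmem' : u ∈ ((outside f B).filter (Solo G L f y)).filter (f · = f u) := by
        simp [hs, he.2]
      have := card_pos.2 ⟨u, hmem⟩
      have := card_pos.2 ⟨u, hmem'⟩
      omega
    · have : ∃ a, G.Adj y a ∧ f a = f u ∧ a ≠ u := by
        by_contra! hcon
        exact hs ⟨hu, he.1, hcon⟩
      obtain ⟨a, ha, hau, hne⟩ := this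
      have := one_lt_card.2 ⟨u, hmem, a, by simp [ha, hau, he.2], hne.symm⟩
      omega
  have h1 := card_nsmul_le_sum _ _ _ key
  rw [sum_add_distrib, smul_eq_mul] at h1
  have h2 : ∀ X : Finset V, ∑ e ∈ L y \ B, (X.filter (f · = e)).card ≤ X.card := by
    intro X
    rw [← card_biUnion]
    · exact card_le_card (biUnion_subset.2 fun e _ => filter_subset _ _)
    · intro a _ b _ hab
      exact disjoint_filter.2 fun v _ h1 h2 => hab (h1.symm.trans h2)
  have h3 := h2 ((outside f B).filter (G.Adj y))
  have h4 := h2 ((outside f B).filter (Solo G L f y))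
  have h5 := le_card_sdiff B (L y)
  have h6 := hL y
  omega

/-- If `y` has no spare neighbors outside `B`, all of these are solo. -/
theorem Blocked.solo_of_card_le (hB : Blocked G L f B) (hL : ∀ v, (L v).card = 4)
    {y z : V} (hy : f y ∈ B)
    (hc : ((outside f B).filter (G.Adj y)).card + B.card ≤ 4) (hz : G.Adj y z)
    (hzB : f z ∉ B) : Solo G L f y z := by
  have h1 := hB.le_card_adj_add_card_solo hL hy
  have hsub : (outside f B).filter (Solo G L f y) ⊆ (outside f B).filter (G.Adj y) :=
    fun a ha => by
      simp only [mem_filter] at ha ⊢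
      exact ⟨ha.1, ha.2.1⟩
  have heq := eq_of_subset_of_card_le hsub (by omega)
  have hmem : z ∈ (outside f B).filter (G.Adj y) := by simp [hz, hzB]
  rw [← heq] at hmem
  exact (mem_filter.1 hmem).2

theorem card_filter_adj_le (hdeg : ∀ v, (univ.filter (G.Adj v)).card ≤ 3) (X : Finset V) (v : V) :
    (X.filter (G.Adj v)).card ≤ 3 :=
  (card_le_card (filter_subset_filter _ (subset_univ X))).trans (hdeg v)

/-- The vertices outside `B` with three neighbors inside `B`. -/
def tripleVertices (G : SimpleGraph V) [DecidableRel G.Adj] (f : V → ℕ) (B : Finset ℕ) :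
    Finset V :=
  (outside f B).filter fun z => ((inside f B).filter (G.Adj z)).card = 3

theorem mem_inside_of_mem_tripleVertices (hdeg : ∀ v, (univ.filter (G.Adj v)).card ≤ 3)
    {z u : V} (hz : z ∈ tripleVertices G f B) (hu : G.Adj z u) : f u ∈ B := by
  have hz3 : ((inside f B).filter (G.Adj z)).card = 3 := (mem_filter.1 hz).2
  have heq := eq_of_subset_of_card_le (filter_subset_filter (G.Adj z) (subset_univ (inside f B)))
    (by have := hdeg z; omega)
  have hmem : u ∈ univ.filter (G.Adj z) := by simp [hu]
  rw [← heq] at hmem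
  simpa using (mem_filter.1 hmem).1

theorem exists_movable_of_mem_tripleVertices (hdeg : ∀ v, (univ.filter (G.Adj v)).card ≤ 3)
    (hL : ∀ v, (L v).card = 4) (hB : B.card ≤ 2) {z : V} (hz : z ∈ tripleVertices G f B) :
    ∃ e, e ∉ B ∧ Movable G L f z e := by
  have h1 : 0 < (L z \ insert (f z) B).card := by
    have := le_card_sdiff (insert (f z) B) (L z)
    have := card_insert_le (f z) B
    have := hL z
    omega
  obtain ⟨e, he⟩ := card_pos.1 h1
  simp only [mem_sdiff, mem_insert, not_or] at he
  exact ⟨e, he.2.2, he.1, he.2.1, fun u hu hfu =>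
    he.2.2 (hfu ▸ mem_inside_of_mem_tripleVertices hdeg hz hu)⟩

theorem sum_card_adj_outside_le (hdeg : ∀ v, (univ.filter (G.Adj v)).card ≤ 3) :
    ∑ z ∈ outside f B, ((inside f B).filter (G.Adj z)).card
      ≤ 2 * (outside f B).card + (tripleVertices G f B).card := by
  have h1 : ∀ z ∈ outside f B, ((inside f B).filter (G.Adj z)).card
      ≤ 2 + if ((inside f B).filter (G.Adj z)).card = 3 then 1 else 0 := by
    intro z _
    have := card_filter_adj_le hdeg (inside f B) z
    split_ifs <;> omega
  refine (sum_le_sum h1).trans ?_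
  rw [sum_add_distrib, sum_const, smul_eq_mul, mul_comm, tripleVertices, card_filter]

/-- The set of blocked colors cannot have three elements. -/
theorem NearColoring.card_blocked_ne_three (h : NearColoring G L m f w)
    (hno : ¬ CappedColorable G L m) (hV : Fintype.card V ≤ 4 * m)
    (hdeg : ∀ v, (univ.filter (G.Adj v)).card ≤ 3) (hL : ∀ v, (L v).card = 4)
    (hw : w ∈ B) (hfull : ∀ c ∈ B, m ≤ (colorClass f c).card) (hB : Blocked G L f B) :
    B.card ≠ 3 := by
  intro h3
  have h1 := h.lt_card_inside hno hw hfull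
  have h2 := card_inside_add_card_outside f B
  have h4 : (inside f B).card • 1 ≤ ∑ v ∈ inside f B, ((outside f B).filter (G.Adj v)).card :=
    card_nsmul_le_sum _ _ _ fun v hv => by
      have := hB.le_card_adj hL (mem_inside.1 hv)
      omega
  have h5 : ∑ v ∈ outside f B, ((inside f B).filter (G.Adj v)).card ≤ (outside f B).card • 3 :=
    sum_le_card_nsmul _ _ _ fun v _ => card_filter_adj_le hdeg _ v
  rw [sum_card_filter_adj_comm] at h4
  rw [h3] at h1
  simp only [smul_eq_mul] at h4 h5
  omega

/-- If the large class is blocked, some neighbor of a vertex in it can be moved to another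
class. -/
theorem NearColoring.exists_movable_of_blocked_singleton (h : NearColoring G L m f w)
    (hno : ¬ CappedColorable G L m) (hV : Fintype.card V ≤ 4 * m)
    (hL : ∀ v, (L v).card = 4) (hdeg : ∀ v, (univ.filter (G.Adj v)).card ≤ 3)
    (hB : Blocked G L f {w}) :
    ∃ y z e, f y = w ∧ G.Adj y z ∧ e ≠ w ∧ Movable G L f z e := by
  have h1 := h.lt_card_inside hno (mem_singleton_self w)
    (by simpa using (h.lt_card hno).le)
  have h2 := card_inside_add_card_outside f {w}
  have h4 : (inside f {w}).card • 3 ≤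
      ∑ v ∈ inside f {w}, ((outside f {w}).filter (G.Adj v)).card :=
    card_nsmul_le_sum _ _ _ fun v hv => by
      have := hB.le_card_adj hL (mem_inside.1 hv)
      simp only [card_singleton] at this
      omega
  have : ∃ z ∈ outside f {w}, 2 ≤ ((inside f {w}).filter (G.Adj z)).card := by
    by_contra! hcon
    have h5 : ∑ v ∈ outside f {w}, ((inside f {w}).filter (G.Adj v)).card
        ≤ (outside f {w}).card • 1 :=
      sum_le_card_nsmul _ _ _ fun v hv => by have := hcon v hv; omega
    rw [sum_card_filter_adj_comm] at h4
    simp only [smul_eq_mul, card_singleton] at h1 h4 h5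
    omega
  obtain ⟨z, hz, hz2⟩ := this
  obtain ⟨y, hy⟩ := card_pos.1 (by omega : 0 < ((inside f {w}).filter (G.Adj z)).card)
  simp only [mem_filter, mem_inside, mem_singleton] at hy
  have hzw : f z ≠ w := by simpa using hz
  have hunion : ((inside f {w}).filter (G.Adj z)).card + ((outside f {w}).filter (G.Adj z)).card
      ≤ 3 := by
    rw [← card_union_of_disjoint]
    · refine (card_le_card fun u hu => ?_).trans (hdeg z)
      simp only [mem_union, mem_filter] at hu
      simpa using hu.elim And.right And.right
    · refine disjoint_left.2 fun u hu hu' => ?_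
      simp only [mem_filter, mem_inside, mem_outside] at hu hu'
      exact hu'.1 hu.1
  have hpos : 0 < (L z \ ({f z, w} ∪ ((outside f {w}).filter (G.Adj z)).image f)).card := by
    have a1 := le_card_sdiff ({f z, w} ∪ ((outside f {w}).filter (G.Adj z)).image f) (L z)
    have a2 := card_union_le {f z, w} (((outside f {w}).filter (G.Adj z)).image f)
    have a3 := card_image_le (s := (outside f {w}).filter (G.Adj z)) (f := f)
    have a4 := card_le_two (a := f z) (b := w)
    have a5 := hL z
    omega
  obtain ⟨e, he⟩ := card_pos.1 hpos
  simp only [mem_sdiff, mem_union, mem_insert, mem_singleton, mem_image, mem_filter, mem_outside,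
    not_or, not_exists, not_and] at he
  exact ⟨y, z, e, hy.1, hy.2.symm, he.2.1.2, he.1, he.2.1.1, fun u hu hfu =>
    he.2.2 u ⟨fun huw => he.2.1.2 (hfu.symm.trans huw), hu⟩ hfu⟩

end Counting

section BlockedPair

variable {G : SimpleGraph V} {L : V → Finset ℕ} {m : ℕ} {f : V → ℕ} {w g : ℕ}
variable [DecidableRel G.Adj] [DecidableEq V]

/-- If a vertex of the large class `w` can be moved to `g`, then the conclusion of
`NearColoring.solo_two` holds for solo neighbors of vertices of both classes. -/
theorem NearColoring.solo_of_movable (h : NearColoring G L m f w)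
    (hno : ¬ CappedColorable G L m) (hg : m ≤ (colorClass f g).card)
    {v : V} (hvw : f v = w) (hv : Movable G L f v g) {y z : V} {e : ℕ}
    (hy : f y ∈ ({w, g} : Finset ℕ)) (hz : f z ∉ ({w, g} : Finset ℕ)) (hs : Solo G L f y z)
    (he : e ∉ ({w, g} : Finset ℕ)) (hm : Movable G L f z e) :
    m ≤ (colorClass f e).card ∧ ∀ u d, f u = e → Movable G L f u d →
      (colorClass f d).card < m → d = f z ∧ G.Adj y u := by
  simp only [mem_insert, mem_singleton, not_or] at hy hz he
  rcases hy with hy | hy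
  · exact ⟨h.le_card_of_solo hno hy hs hm, fun u d hu hmu hd => h.solo_two hno hy hs hm hu hmu hd⟩
  · have h2 := h.shift hvw hv
    have hgw : g ≠ w := hvw ▸ hv.2.1
    have hyv : y ≠ v := by rintro rfl; exact hgw (hy.symm.trans hvw)
    have hzv : z ≠ v := by rintro rfl; exact hz.1 hvw
    have hs2 : Solo G L (update f v g) y z := by
      refine ⟨hs.1, by simpa [hzv] using hs.2.1, fun a ha hfa => ?_⟩
      by_cases hav : a = v
      · subst hav; exact absurd (by simpa [hzv] using hfa.symm) hz.2
      · exact hs.2.2 a ha (by simpa [hav, hzv] using hfa)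
    have hmov : ∀ {a d}, a ≠ v → d ≠ g → Movable G L f a d → Movable G L (update f v g) a d := by
      intro a d hav hdg hma
      refine ⟨hma.1, by simpa [hav] using hma.2.1, fun b hb hfb => ?_⟩
      by_cases hbv : b = v
      · subst hbv; exact hdg (by simpa using hfb.symm)
      · exact hma.2.2 b hb (by simpa [hbv] using hfb)
    have hy2 : update f v g y = g := by simp [hyv, hy]
    refine ⟨(h2.le_card_of_solo hno hy2 hs2 (hmov hzv he.2 hm)).trans
      (card_colorClass_update_le he.2), fun u d hu hmu hd => ?_⟩
    have huv : u ≠ v := by rintro rfl; exact he.1 (hu.symm.trans hvw)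
    have hdg : d ≠ g := by rintro rfl; omega
    have := h2.solo_two hno hy2 hs2 (hmov hzv he.2 hm) (by simpa [huv] using hu)
      (hmov huv hdg hmu) ((card_colorClass_update_le hdg).trans_lt hd)
    simpa [hzv] using this

/-- Two blocked classes, where a vertex of the large class can be moved to the other one. -/
theorem NearColoring.false_of_movable_pair (h : NearColoring G L m f w)
    (hno : ¬ CappedColorable G L m) (hV : Fintype.card V ≤ 4 * m)
    (hL : ∀ v, (L v).card = 4) (hdeg : ∀ v, (univ.filter (G.Adj v)).card ≤ 3)
    (hg : m ≤ (colorClass f g).card) (hB : Blocked G L f {w, g})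
    {v : V} (hvw : f v = w) (hv : Movable G L f v g) {e₀ : ℕ}
    (hsmall : ∀ c, c ∉ ({w, g} : Finset ℕ) → c ≠ e₀ → (colorClass f c).card < m)
    (he₀ : (colorClass f e₀).card < m ∨
      ∃ u d, f u = e₀ ∧ Movable G L f u d ∧ (colorClass f d).card < m) : False := by
  have hgw : g ≠ w := hvw ▸ hv.2.1
  have hcard : ({w, g} : Finset ℕ).card = 2 := card_pair hgw.symm
  have hin := h.lt_card_inside (B := {w, g}) hno (by simp) (by
    simpa using ⟨(h.lt_card hno).le, hg⟩)
  rw [hcard] at hin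
  have hout := card_inside_add_card_outside f {w, g}
  have hE := sum_card_adj_outside_le (f := f) (B := {w, g}) hdeg
  rw [sum_card_filter_adj_comm] at hE
  -- solo edges at vertices with three neighbors inside come from neighbors of a single vertex
  obtain ⟨u₀, d₀, hu₀⟩ : ∃ u₀ d₀, ∀ y z, f y ∈ ({w, g} : Finset ℕ) →
      z ∈ tripleVertices G f {w, g} → Solo G L f y z → f z = d₀ ∧ G.Adj u₀ y := by
    rcases he₀ with he₀ | ⟨u, d, hu, hmu, hd⟩
    · refine ⟨v, 0, fun y z hy hz hs => ?_⟩
      obtain ⟨e, he, hm⟩ := exists_movable_of_mem_tripleVertices hdeg hL hcard.le hz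
      have hzB : f z ∉ ({w, g} : Finset ℕ) := mem_outside.1 (mem_filter.1 hz).1
      have h1 := (h.solo_of_movable hno hg hvw hv hy hzB hs he hm).1
      by_cases hee : e = e₀
      · subst hee; omega
      · exact absurd (hsmall e he hee) (by omega)
    · refine ⟨u, d, fun y z hy hz hs => ?_⟩
      obtain ⟨e, he, hm⟩ := exists_movable_of_mem_tripleVertices hdeg hL hcard.le hz
      have hzB : f z ∉ ({w, g} : Finset ℕ) := mem_outside.1 (mem_filter.1 hz).1
      have h1 := h.solo_of_movable hno hg hvw hv hy hzB hs he hm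
      by_cases hee : e = e₀
      · obtain ⟨h2, h3⟩ := h1.2 u d (hu.trans hee.symm) hmu hd
        exact ⟨h2.symm, h3.symm⟩
      · exact absurd (hsmall e he hee) (by omega)
  have hsolo : ∑ y ∈ inside f {w, g}, ((tripleVertices G f {w, g}).filter (Solo G L f y)).card
      ≤ 3 := by
    calc _ ≤ ∑ y ∈ inside f {w, g}, if G.Adj u₀ y then 1 else 0 := by
          refine sum_le_sum fun y hy => ?_
          rw [mem_inside] at hy
          split_ifs with hadj
          · refine card_le_one.2 fun a ha b hb => ?_
            rw [mem_filter] at ha hb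
            exact hb.2.2.2 a ha.2.1
              ((hu₀ y a hy ha.1 ha.2).1.trans (hu₀ y b hy hb.1 hb.2).1.symm)
          · rw [Nat.le_zero, card_eq_zero, filter_eq_empty_iff]
            exact fun z hz hs => hadj (hu₀ y z hy hz hs).2
      _ = ((inside f {w, g}).filter (G.Adj u₀)).card := (card_filter _ _).symm
      _ ≤ 3 := card_filter_adj_le hdeg _ _
  have hT : ∑ z ∈ tripleVertices G f {w, g}, ((inside f {w, g}).filter (G.Adj z)).card
      = (tripleVertices G f {w, g}).card * 3 := by
    rw [← smul_eq_mul, ← sum_const]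
    exact sum_congr rfl fun z hz => (mem_filter.1 hz).2
  rw [sum_card_filter_adj_comm] at hT
  have hpoint : ∀ y ∈ inside f {w, g},
      ((tripleVertices G f {w, g}).filter (G.Adj y)).card + 4 ≤
        ((tripleVertices G f {w, g}).filter (Solo G L f y)).card
          + 2 * ((outside f {w, g}).filter (G.Adj y)).card := by
    intro y hy
    have h1 := hB.le_card_adj_add_card_solo hL (mem_inside.1 hy)
    have hsub : tripleVertices G f {w, g} ⊆ outside f {w, g} := filter_subset _ _
    have h2 : ((tripleVertices G f {w, g}).filter (G.Adj y)).card
        + ((outside f {w, g}).filter (Solo G L f y)).card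
        ≤ ((tripleVertices G f {w, g}).filter (Solo G L f y)).card
          + ((outside f {w, g}).filter (G.Adj y)).card := by
      rw [← card_union_add_card_inter, add_comm]
      refine add_le_add (card_le_card fun a ha => ?_) (card_le_card fun a ha => ?_)
      · simp only [mem_inter, mem_filter] at ha ⊢
        exact ⟨ha.1.1, ha.2.2⟩
      · simp only [mem_union, mem_filter] at ha ⊢
        rcases ha with ha | ha
        · exact ⟨hsub ha.1, ha.2⟩
        · exact ⟨ha.1, ha.2.1⟩
    omega
  have hsum := sum_le_sum hpoint
  simp only [sum_add_distrib, sum_const, smul_eq_mul, ← mul_sum] at hsum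
  omega

/-- Two blocked classes, where the large class is blocked on its own. -/
theorem NearColoring.false_of_blocked_pair (h : NearColoring G L m f w)
    (hno : ¬ CappedColorable G L m) (hV : Fintype.card V ≤ 4 * m)
    (hL : ∀ v, (L v).card = 4) (hdeg : ∀ v, (univ.filter (G.Adj v)).card ≤ 3)
    (hgw : g ≠ w) (hg : m ≤ (colorClass f g).card) (hB : Blocked G L f {w, g})
    (hW : Blocked G L f {w}) {e₀ : ℕ}
    (hsmall : ∀ c, c ∉ ({w, g} : Finset ℕ) → c ≠ e₀ → (colorClass f c).card < m)
    (he₀ : (colorClass f e₀).card < m ∨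
      ∃ u d, f u = e₀ ∧ Movable G L f u d ∧ (colorClass f d).card < m) : False := by
  have hcard : ({w, g} : Finset ℕ).card = 2 := card_pair hgw.symm
  have hwcard := h.lt_card hno
  have hin : (inside f {w, g}).card = (colorClass f w).card + (colorClass f g).card := by
    rw [card_inside, sum_pair hgw.symm]
  have hgcard := h.cap g hgw
  have hout := card_inside_add_card_outside f {w, g}
  have hE := sum_card_adj_outside_le (f := f) (B := {w, g}) hdeg
  rw [sum_card_filter_adj_comm] at hE
  have hsum_in : ∀ F : V → ℕ, ∑ y ∈ inside f {w, g}, F y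
      = ∑ y ∈ colorClass f w, F y + ∑ y ∈ colorClass f g, F y := by
    intro F
    rw [← sum_union (disjoint_left.2 fun a ha ha' => hgw (by simp_all))]
    congr 1
    ext a
    simp
  have hclosed : ∀ y, f y = w → ∀ a, G.Adj y a → Solo G L f y a := by
    intro y hy a ha
    refine hW.solo_of_card_le hL (by simp [hy]) ?_ ha ?_
    · have := card_filter_adj_le hdeg (outside f {w}) y
      rw [card_singleton]
      omega
    · simpa using fun haw => h.proper ha (hy.trans haw.symm)
  have hsplit : ∀ y, ((outside f {w, g}).filter (G.Adj y)).card +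
      ((colorClass f w).filter (G.Adj y)).card + ((colorClass f g).filter (G.Adj y)).card
      = (univ.filter (G.Adj y)).card := by
    intro y
    simp only [outside, colorClass, filter_filter, card_filter, ← sum_add_distrib]
    refine sum_congr rfl fun a _ => ?_
    by_cases h1 : f a = w
    · simp [h1, hgw.symm]
    · by_cases h2 : f a = g <;> simp [h1, h2, hgw]
  have hne_of_small {d} (hd : (colorClass f d).card < m) : d ≠ w ∧ d ≠ g := by
    constructor <;> rintro rfl <;> omega
  -- a vertex with three neighbors inside has no neighbor in the large class
  have hZW : ∀ z ∈ tripleVertices G f {w, g}, ∀ y, G.Adj z y → f y ≠ w := by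
    intro z hz y hzy hy
    obtain ⟨e, he, hm⟩ := exists_movable_of_mem_tripleVertices hdeg hL hcard.le hz
    have h1 := h.le_card_of_solo hno hy (hclosed y hy z hzy.symm) hm
    by_cases hee : e = e₀
    · subst hee
      rcases he₀ with he₀ | ⟨u, d, hu, hmu, hd⟩
      · omega
      · exact absurd (h.closed_two hno hy (hclosed y hy) hzy.symm hm hu hmu) (by omega)
    · exact absurd (hsmall e he hee) (by omega)
  have hZx : ∀ z ∈ tripleVertices G f {w, g}, ∀ y, G.Adj z y → f y = g →
      ∀ x, G.Adj y x → f x ≠ w := by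
    intro z hz y hzy hy x hyx hx
    obtain ⟨e, he, hm⟩ := exists_movable_of_mem_tripleVertices hdeg hL hcard.le hz
    have hzB : f z ∉ ({w, g} : Finset ℕ) := mem_outside.1 (mem_filter.1 hz).1
    have hsolo : ∀ a, G.Adj y a → f a ∉ ({w, g} : Finset ℕ) → Solo G L f y a := by
      intro a ha haB
      refine hB.solo_of_card_le hL (by simp [hy]) ?_ ha haB
      have h1 := hsplit y
      have h2 := hdeg y
      have h3 : 0 < ((colorClass f w).filter (G.Adj y)).card := card_pos.2 ⟨x, by simp [hx, hyx]⟩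
      omega
    have hxy := hclosed x hx y hyx.symm
    have hyz := hsolo z hzy.symm hzB
    simp only [mem_insert, mem_singleton, not_or] at hzB
    have he' := he
    simp only [mem_insert, mem_singleton, not_or] at he'
    have h1 := h.le_card_of_solo_solo hno hx hxy hyz hzB.1 hm (hy ▸ he'.2)
    by_cases hee : e = e₀
    · subst hee
      rcases he₀ with he₀ | ⟨u, d, hu, hmu, hd⟩
      · omega
      · have hdB := hne_of_small hd
        obtain ⟨-, hyu⟩ := h.solo_solo_two hno hx hxy hyz hzB.1 hm (hy ▸ he'.2) he'.1 hu hmu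
          (hy ▸ hdB.2) hd
        have := h.le_card_of_solo_solo hno hx hxy (hsolo u hyu (hu ▸ he)) (hu ▸ he'.1) hmu
          (hy ▸ hdB.2)
        omega
    · exact absurd (hsmall e he hee) (by omega)
  -- `T` consists of the vertices of the class of `g` with a neighbor in the large class
  set T := (colorClass f g).filter fun y => ∃ x, G.Adj y x ∧ f x = w with hTdef
  set T' := (colorClass f g).filter fun y => ¬ ∃ x, G.Adj y x ∧ f x = w with hT'def
  have hTT' : T.card + T'.card = (colorClass f g).card := card_filter_add_card_filter_not _
  have hWG : ∑ y ∈ colorClass f w, ((colorClass f g).filter (G.Adj y)).card ≤ T.card := by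
    rw [sum_card_filter_adj_comm, hTdef, card_filter]
    refine sum_le_sum fun y hy => ?_
    rw [mem_colorClass] at hy
    split_ifs with hx
    · have h1 := hB.le_card_adj hL (v := y) (by simp [hy])
      have h2 := hsplit y
      have h3 := hdeg y
      omega
    · rw [Nat.le_zero, card_eq_zero, filter_eq_empty_iff]
      exact fun x hxw hyx => hx ⟨x, hyx, mem_colorClass.1 hxw⟩
  have hWA : (colorClass f w).card • 3 ≤ ∑ y ∈ colorClass f w,
      (((outside f {w, g}).filter (G.Adj y)).card + ((colorClass f g).filter (G.Adj y)).card) := by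
    refine card_nsmul_le_sum _ _ _ fun y hy => ?_
    rw [mem_colorClass] at hy
    have h1 := hW.le_card_adj hL (v := y) (by simp [hy])
    have h2 := hsplit y
    have h3 : ((outside f {w}).filter (G.Adj y)).card ≤ (univ.filter (G.Adj y)).card :=
      card_le_card (filter_subset_filter _ (subset_univ _))
    have h4 : ((colorClass f w).filter (G.Adj y)).card = 0 := by
      rw [card_eq_zero, filter_eq_empty_iff]
      exact fun a ha hya => h.proper hya (hy.trans (mem_colorClass.1 ha).symm)
    simp only [card_singleton] at h1
    omega
  have hGA : (colorClass f g).card • 2 ≤ ∑ y ∈ colorClass f g,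
      ((outside f {w, g}).filter (G.Adj y)).card := by
    refine card_nsmul_le_sum _ _ _ fun y hy => ?_
    rw [mem_colorClass] at hy
    have h1 := hB.le_card_adj hL (v := y) (by simp [hy])
    omega
  have hZT : (tripleVertices G f {w, g}).card • 3 ≤ T'.card • 3 := by
    calc _ ≤ ∑ z ∈ tripleVertices G f {w, g}, (T'.filter (G.Adj z)).card := by
          refine card_nsmul_le_sum _ _ _ fun z hz => ?_
          rw [← (mem_filter.1 hz).2]
          refine card_le_card fun y hy => ?_
          simp only [mem_filter, mem_inside, mem_insert, mem_singleton] at hy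
          have hyg : f y = g := hy.1.resolve_left (hZW z hz y hy.2)
          simp only [hT'def, mem_filter, mem_colorClass]
          exact ⟨⟨hyg, fun ⟨x, hyx, hx⟩ => hZx z hz y hy.2 hyg x hyx hx⟩, hy.2⟩
      _ = ∑ y ∈ T', ((tripleVertices G f {w, g}).filter (G.Adj y)).card :=
          sum_card_filter_adj_comm _ _
      _ ≤ T'.card • 3 := sum_le_card_nsmul _ _ _ fun y _ => card_filter_adj_le hdeg _ y
  rw [hsum_in] at hE
  simp only [sum_add_distrib, smul_eq_mul] at hWA hGA hZT
  omega

/-- A near coloring of a graph with maximum degree at most three and at most `4 * m` vertices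
can be turned into a coloring with classes of size at most `m`. -/
theorem NearColoring.cappedColorable (h : NearColoring G L m f w)
    (hV : Fintype.card V ≤ 4 * m) (hL : ∀ v, (L v).card = 4)
    (hdeg : ∀ v, (univ.filter (G.Adj v)).card ≤ 3) : CappedColorable G L m := by
  by_contra hno
  let Direct : ℕ → Prop := fun c => ∃ u d, f u = c ∧ Movable G L f u d ∧ (colorClass f d).card < m
  let Acc : ℕ → Prop := fun c => (colorClass f c).card < m ∨ Direct c ∨
    ∃ u e, f u = c ∧ Movable G L f u e ∧ Direct e
  have hfull : ∀ {c}, ¬ Acc c → m ≤ (colorClass f c).card := fun hc => by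
    by_contra! hlt
    exact hc (Or.inl hlt)
  have hwfull := (h.lt_card hno).le
  have hw : ¬ Acc w := by
    rintro (hlt | ⟨u, d, hu, hmu, hd⟩ | ⟨u, e, hu, hmu, t, d, ht, hmt, hd⟩)
    · omega
    · exact absurd (h.le_card_of_movable hno hu hmu) (by omega)
    · exact absurd (h.not_movable_two hno hu hmu ht hmt) (by omega)
  have hblocked1 : (∀ c, c ≠ w → Acc c) → Blocked G L f {w} := by
    intro hall v hv e he hm
    rw [mem_singleton] at hv he
    rcases hall e he with hlt | ⟨u, d, hu, hmu, hd⟩ | ⟨u, e', hu, hmu, t, d, ht, hmt, hd⟩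
    · exact hw (Or.inr (Or.inl ⟨v, e, hv, hm, hlt⟩))
    · exact hw (Or.inr (Or.inr ⟨v, e, hv, hm, u, d, hu, hmu, hd⟩))
    · exact absurd (h.not_movable_three hno hv hm hu hmu ht hmt) (by omega)
  by_cases hall : ∀ c, c ≠ w → Acc c
  · have hB := hblocked1 hall
    obtain ⟨y, z, e, hy, hyz, hew, hm⟩ := h.exists_movable_of_blocked_singleton hno hV hL hdeg hB
    have hclosed : ∀ a, G.Adj y a → Solo G L f y a := by
      intro a ha
      refine hB.solo_of_card_le hL (by simp [hy]) ?_ ha ?_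
      · have := card_filter_adj_le hdeg (outside f {w}) y
        rw [card_singleton]
        omega
      · simpa using fun haw => h.proper ha (hy.trans haw.symm)
    rcases hall e hew with hlt | ⟨u, d, hu, hmu, hd⟩ | ⟨u, e', hu, hmu, t, d, ht, hmt, hd⟩
    · exact absurd (h.le_card_of_solo hno hy (hclosed z hyz) hm) (by omega)
    · exact absurd (h.closed_two hno hy hclosed hyz hm hu hmu) (by omega)
    · exact absurd (h.closed_three hno hy hclosed hyz hm hu hmu ht hmt) (by omega)
  · push Not at hall
    obtain ⟨g, hgw, hg⟩ := hall
    by_cases hall2 : ∀ c, c ∉ ({w, g} : Finset ℕ) → Acc c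
    · obtain ⟨e₀, hsmall⟩ : ∃ e₀, ∀ c, c ∉ ({w, g} : Finset ℕ) → c ≠ e₀ →
          (colorClass f c).card < m := by
        by_contra! hcon
        obtain ⟨a, ha, -, ham⟩ := hcon w
        obtain ⟨b, hb, hba, hbm⟩ := hcon a
        have := h.card_le_three (B := insert b (insert a {w, g})) hno hV (by simp) (by
          simpa using ⟨hbm, ham, hwfull, hfull hg⟩)
        rw [card_insert_of_notMem (by simp_all), card_insert_of_notMem ha,
          card_pair hgw.symm] at this
        omega
      have hdirect : ∀ c, c ∉ ({w, g} : Finset ℕ) → (colorClass f c).card < m ∨ Direct c := by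
        intro c hc
        rcases hall2 c hc with hlt | hd | ⟨u, e, hu, hmu, hd⟩
        · exact Or.inl hlt
        · exact Or.inr hd
        · by_cases hce : c = e₀
          · refine Or.inr ⟨u, e, hu, hmu, hsmall e ?_ ?_⟩
            · simp only [mem_insert, mem_singleton, not_or]
              constructor <;> rintro rfl
              · exact hw (Or.inr (Or.inl hd))
              · exact hg (Or.inr (Or.inl hd))
            · rw [← hce, ← hu]
              exact hmu.2.1
          · exact Or.inl (hsmall c hc hce)
      have hB : Blocked G L f {w, g} := by
        intro v hv e he hm
        have hv' : ¬ Acc (f v) := by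
          simp only [mem_insert, mem_singleton] at hv
          rcases hv with hv | hv <;> rwa [hv]
        rcases hdirect e he with hlt | hd
        · exact hv' (Or.inr (Or.inl ⟨v, e, rfl, hm, hlt⟩))
        · exact hv' (Or.inr (Or.inr ⟨v, e, rfl, hm, hd⟩))
      obtain ⟨e₁, hsmall₁, he₁⟩ : ∃ e₁, (∀ c, c ∉ ({w, g} : Finset ℕ) → c ≠ e₁ →
          (colorClass f c).card < m) ∧ ((colorClass f e₁).card < m ∨ Direct e₁) := by
        by_cases he₀ : e₀ ∈ ({w, g} : Finset ℕ)
        · have hall3 : ∀ c, c ∉ ({w, g} : Finset ℕ) → (colorClass f c).card < m :=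
            fun c hc => hsmall c hc fun hce => hc (hce ▸ he₀)
          obtain ⟨c, hc⟩ := Infinite.exists_notMem_finset ({w, g} : Finset ℕ)
          exact ⟨c, fun d hd _ => hall3 d hd, Or.inl (hall3 c hc)⟩
        · exact ⟨e₀, hsmall, hdirect e₀ he₀⟩
      by_cases hv : ∃ v, f v = w ∧ Movable G L f v g
      · obtain ⟨v, hvw, hv⟩ := hv
        exact h.false_of_movable_pair hno hV hL hdeg (hfull hg) hB hvw hv hsmall₁ he₁
      · refine h.false_of_blocked_pair hno hV hL hdeg hgw (hfull hg) hB ?_ hsmall₁ he₁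
        intro v hvw e he hm
        rw [mem_singleton] at hvw he
        by_cases heg : e = g
        · exact hv ⟨v, hvw, heg ▸ hm⟩
        · exact hB v (by simp [hvw]) e (by simp [he, heg]) hm
    · push Not at hall2
      obtain ⟨c, hc, hcA⟩ := hall2
      have hcard : (insert c {w, g} : Finset ℕ).card = 3 := by
        rw [card_insert_of_notMem hc, card_pair hgw.symm]
      have hfullB : ∀ a ∈ (insert c {w, g} : Finset ℕ), m ≤ (colorClass f a).card := by
        simpa using ⟨hfull hcA, hwfull, hfull hg⟩
      refine h.card_blocked_ne_three (B := insert c {w, g}) hno hV hdeg hL (by simp) hfullB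
        ?_ hcard
      intro v hv e he hm
      have hv' : ¬ Acc (f v) := by
        simp only [mem_insert, mem_singleton] at hv
        rcases hv with hv | hv | hv <;> rwa [hv]
      refine hv' (Or.inr (Or.inl ⟨v, e, rfl, hm, ?_⟩))
      by_contra! hle
      have := h.card_le_three (B := insert e (insert c {w, g})) hno hV (by simp) (by
        intro a ha
        rcases mem_insert.1 ha with rfl | ha
        · exact hle
        · exact hfullB a ha)
      rw [card_insert_of_notMem he, hcard] at this
      omega

end BlockedPair

section Induction

variable [DecidableEq V] {G : SimpleGraph V} {L : V → Finset ℕ} {m : ℕ}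

/-- A coloring of the subgraph induced on the complement of `S`, as a function on all vertices. -/
theorem exists_coloring_off {S : Finset V} (hL : ∀ v, (L v).card = 4)
    (h : CappedColorable (G.comap (Subtype.val : {v // v ∉ S} → V)) (fun v => L v) m) :
    ∃ f : V → ℕ, (∀ v, f v ∈ L v) ∧ (∀ u v, u ∉ S → v ∉ S → G.Adj u v → f u ≠ f v) ∧
      ∀ c, (colorClass f c \ S).card ≤ m := by
  obtain ⟨f', hmem, hproper, hcap⟩ := h
  have hne : ∀ v, (L v).Nonempty := fun v => card_pos.1 (by rw [hL v]; omega)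
  choose d hd using hne
  refine ⟨fun v => if hv : v ∉ S then f' ⟨v, hv⟩ else d v, fun v => ?_, fun u v hu hv huv => ?_,
    fun c => ?_⟩
  · dsimp only
    split_ifs with hv
    · exact hd v
    · exact hmem ⟨v, hv⟩
  · simpa only [hu, hv, not_false_eq_true, dif_pos] using
      @hproper ⟨u, hu⟩ ⟨v, hv⟩ (by simpa using huv)
  · refine le_trans ?_ (hcap c)
    rw [← card_map (Embedding.subtype fun v => v ∉ S)]
    refine card_le_card fun v hv => ?_
    simp only [mem_sdiff, mem_colorClass] at hv
    obtain ⟨hv1, hv2⟩ := hv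
    simp only [hv2, not_false_eq_true, dif_pos] at hv1
    simp [hv1, hv2]

theorem exists_color {X : Finset V} {l A : Finset ℕ} (f : V → ℕ) (h : X.card + A.card < l.card) :
    ∃ c ∈ l, c ∉ A ∧ ∀ u ∈ X, f u ≠ c := by
  have h1 : 0 < (l \ (X.image f ∪ A)).card := by
    have := le_card_sdiff (X.image f ∪ A) l
    have := card_union_le (X.image f) A
    have := card_image_le (s := X) (f := f)
    omega
  obtain ⟨c, hc⟩ := card_pos.1 h1
  simp only [mem_sdiff, mem_union, mem_image, not_or, not_exists, not_and] at hc
  exact ⟨c, hc.1, hc.2.2, hc.2.1⟩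

variable [DecidableRel G.Adj]

/-- A coloring of the complement of four vertices extends to these, with four different colors,
if they have at most three, two, one and no neighbors in the complement. -/
theorem cappedColorable_of_four {a b c d : V} (hab : a ≠ b) (hac : a ≠ c) (had : a ≠ d)
    (hbc : b ≠ c) (hbd : b ≠ d) (hcd : c ≠ d) (hL : ∀ v, (L v).card = 4)
    (ha : (univ.filter (G.Adj a) \ {a, b, c, d}).card ≤ 3)
    (hb : (univ.filter (G.Adj b) \ {a, b, c, d}).card ≤ 2)
    (hc : (univ.filter (G.Adj c) \ {a, b, c, d}).card ≤ 1)
    (hd : (univ.filter (G.Adj d) \ {a, b, c, d}).card ≤ 0) {f : V → ℕ} (hf : ∀ v, f v ∈ L v)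
    (hproper : ∀ u v, u ∉ ({a, b, c, d} : Finset V) → v ∉ ({a, b, c, d} : Finset V) →
      G.Adj u v → f u ≠ f v)
    (hcap : ∀ k, (colorClass f k \ {a, b, c, d}).card ≤ m) : CappedColorable G L (m + 1) := by
  obtain ⟨ka, hka, -, hna⟩ := exists_color
    (X := univ.filter (G.Adj a) \ {a, b, c, d}) (A := ∅) (l := L a) f
    (by rw [hL, card_empty]; omega)
  obtain ⟨kb, hkb, hkb', hnb⟩ := exists_color
    (X := univ.filter (G.Adj b) \ {a, b, c, d}) (A := {ka}) (l := L b) f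
    (by rw [hL, card_singleton]; omega)
  obtain ⟨kc, hkc, hkc', hnc⟩ := exists_color
    (X := univ.filter (G.Adj c) \ {a, b, c, d}) (A := {ka, kb}) (l := L c) f
    (by have := card_le_two (a := ka) (b := kb); rw [hL]; omega)
  obtain ⟨kd, hkd, hkd', hnd⟩ := exists_color
    (X := univ.filter (G.Adj d) \ {a, b, c, d}) (A := {ka, kb, kc}) (l := L d) f
    (by have := card_le_three (a := ka) (b := kb) (c := kc); rw [hL]; omega)
  simp only [mem_insert, mem_singleton, not_or] at hkb' hkc' hkd'
  set S : Finset V := {a, b, c, d} with hS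
  let F : V → ℕ := fun v =>
    if v = a then ka else if v = b then kb else if v = c then kc else if v = d then kd else f v
  have hFa : F a = ka := by simp [F]
  have hFb : F b = kb := by simp [F, hab.symm]
  have hFc : F c = kc := by simp [F, hac.symm, hbc.symm]
  have hFd : F d = kd := by simp [F, had.symm, hbd.symm, hcd.symm]
  have hF : ∀ v, v ∉ S → F v = f v := by
    intro v hv
    simp only [hS, mem_insert, mem_singleton, not_or] at hv
    simp [F, hv]
  have hmemS : ∀ v, v ∈ S → v = a ∨ v = b ∨ v = c ∨ v = d := by simp [hS]
  have hinj : ∀ u v, u ∈ S → v ∈ S → F u = F v → u = v := by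
    intro u v hu hv huv
    rcases hmemS u hu with rfl | rfl | rfl | rfl <;>
      rcases hmemS v hv with rfl | rfl | rfl | rfl <;> grind
  have hcross : ∀ u v, u ∈ S → v ∉ S → G.Adj u v → F u ≠ F v := by
    intro u v hu hv huv
    rw [hF v hv]
    have hmem : v ∈ univ.filter (G.Adj u) \ S := by simp [huv, hv]
    rcases hmemS u hu with rfl | rfl | rfl | rfl
    · rw [hFa]; exact (hna v hmem).symm
    · rw [hFb]; exact (hnb v hmem).symm
    · rw [hFc]; exact (hnc v hmem).symm
    · rw [hFd]; exact (hnd v hmem).symm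
  refine ⟨F, fun v => ?_, fun u v huv => ?_, fun k => ?_⟩
  · by_cases hv : v ∈ S
    · rcases hmemS v hv with rfl | rfl | rfl | rfl
      · rwa [hFa]
      · rwa [hFb]
      · rwa [hFc]
      · rwa [hFd]
    · rw [hF v hv]; exact hf v
  · by_cases hu : u ∈ S <;> by_cases hv : v ∈ S
    · exact fun h => huv.ne (hinj u v hu hv h)
    · exact hcross u v hu hv huv
    · exact (hcross v u hv hu huv.symm).symm
    · rw [hF u hu, hF v hv]; exact hproper u v hu hv huv
  · rw [← card_sdiff_add_card_inter (colorClass F k) S]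
    refine add_le_add ((card_le_card fun v hv => ?_).trans (hcap k)) (card_le_one.2 ?_)
    · simp only [mem_sdiff, mem_colorClass] at hv ⊢
      exact ⟨hF v hv.2 ▸ hv.1, hv.2⟩
    · intro u hu v hv
      simp only [mem_inter, mem_colorClass] at hu hv
      exact hinj u v hu.2 hv.2 (hu.1.trans hv.1.symm)

theorem card_filter_sdiff_le {v : V} {S T : Finset V} (hT : T ⊆ S) (hadj : ∀ u ∈ T, G.Adj v u) :
    (univ.filter (G.Adj v) \ S).card + T.card ≤ (univ.filter (G.Adj v)).card := by
  rw [← card_union_of_disjoint (disjoint_left.2 fun u hu hu' => (mem_sdiff.1 hu).2 (hT hu'))]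
  refine card_le_card (union_subset sdiff_subset fun u hu => by simpa using hadj u hu)

/-- Around a vertex of degree at least four there are four vertices that can be removed. -/
theorem exists_four_of_four_le_card
    (hore : ∀ x y, G.Adj x y →
      (univ.filter (G.Adj x)).card + (univ.filter (G.Adj y)).card ≤ 6)
    {y : V} (hy : 4 ≤ (univ.filter (G.Adj y)).card) :
    ∃ a b c d : V, a ≠ b ∧ a ≠ c ∧ a ≠ d ∧ b ≠ c ∧ b ≠ d ∧ c ≠ d ∧
      (univ.filter (G.Adj a) \ {a, b, c, d}).card ≤ 3 ∧
      (univ.filter (G.Adj b) \ {a, b, c, d}).card ≤ 2 ∧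
      (univ.filter (G.Adj c) \ {a, b, c, d}).card ≤ 1 ∧
      (univ.filter (G.Adj d) \ {a, b, c, d}).card ≤ 0 := by
  have hpick : ∀ X : Finset V, X.card ≤ 3 → ∃ u, G.Adj y u ∧ u ∉ X := by
    intro X hX
    have := le_card_sdiff X (univ.filter (G.Adj y))
    obtain ⟨u, hu⟩ := card_pos.1 (by omega : 0 < (univ.filter (G.Adj y) \ X).card)
    exact ⟨u, by simpa using hu⟩
  by_cases hleaf : ∃ d, G.Adj y d ∧ (univ.filter (G.Adj d)).card ≤ 1
  · obtain ⟨d, hyd, hd1⟩ := hleaf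
    obtain ⟨b, hyb, hb⟩ := hpick {d} (by simp)
    obtain ⟨c, hyc, hc⟩ := hpick {d, b} (card_le_two.trans (by omega))
    simp only [mem_insert, mem_singleton, not_or] at hb hc
    refine ⟨y, b, c, d, hyb.ne, hyc.ne, hyd.ne, fun h => hc.2 h.symm, hb, hc.1, ?_, ?_, ?_, ?_⟩
    · have h2 := card_filter_sdiff_le (G := G) (v := y) (S := {y, b, c, d}) (T := {b, c, d})
        (by simp) (by simpa using ⟨hyb, hyc, hyd⟩)
      rw [card_eq_three.2 ⟨b, c, d, fun h => hc.2 h.symm, hb, hc.1, rfl⟩] at h2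
      have := hore y b hyb
      omega
    · have h1 := card_filter_sdiff_le (G := G) (v := b) (S := {y, b, c, d}) (T := {y}) (by simp)
        (by simpa using hyb.symm)
      have := hore y b hyb
      rw [card_singleton] at h1
      omega
    · have h1 := card_filter_sdiff_le (G := G) (v := c) (S := {y, b, c, d}) (T := {y}) (by simp)
        (by simpa using hyc.symm)
      have := hore y c hyc
      rw [card_singleton] at h1
      omega
    · have h1 := card_filter_sdiff_le (G := G) (v := d) (S := {y, b, c, d}) (T := {y}) (by simp)
        (by simpa using hyd.symm)
      rw [card_singleton] at h1
      omega
  · push Not at hleaf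
    obtain ⟨d, hyd, -⟩ := hpick ∅ (by simp)
    have hd2 := hleaf d hyd
    obtain ⟨a, ha, hay⟩ := exists_mem_ne hd2 y
    simp only [mem_filter, mem_univ, true_and] at ha
    obtain ⟨c, hyc, hc⟩ := hpick {d, a} (card_le_two.trans (by omega))
    simp only [mem_insert, mem_singleton, not_or] at hc
    have hyd' := hore y d hyd
    have hyc' := hore y c hyc
    have hda' := hore d a ha
    refine ⟨a, y, c, d, hay, fun h => hc.2 h.symm, ha.ne', hyc.ne, hyd.ne, hc.1, ?_, ?_, ?_, ?_⟩
    · have h1 := card_filter_sdiff_le (G := G) (v := a) (S := {a, y, c, d}) (T := {d}) (by simp)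
        (by simpa using ha.symm)
      rw [card_singleton] at h1
      omega
    · have h1 := card_filter_sdiff_le (G := G) (v := y) (S := {a, y, c, d}) (T := {c, d})
        (by grind) (by simpa using ⟨hyc, hyd⟩)
      rw [card_pair hc.1] at h1
      omega
    · have h1 := card_filter_sdiff_le (G := G) (v := c) (S := {a, y, c, d}) (T := {y}) (by simp)
        (by simpa using hyc.symm)
      rw [card_singleton] at h1
      omega
    · have h1 := card_filter_sdiff_le (G := G) (v := d) (S := {a, y, c, d}) (T := {y, a})
        (by grind) (by simpa using ⟨hyd.symm, ha⟩)
      rw [card_pair hay.symm] at h1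
      omega

end Induction

theorem cappedColorable_of_ore (n : ℕ) : ∀ {V : Type*} [Fintype V] [DecidableEq V]
    {G : SimpleGraph V} [DecidableRel G.Adj] {L : V → Finset ℕ} {m : ℕ},
    Fintype.card V = n → Fintype.card V ≤ 4 * m → (∀ v, (L v).card = 4) →
    (∀ x y, G.Adj x y → (univ.filter (G.Adj x)).card + (univ.filter (G.Adj y)).card ≤ 6) →
    CappedColorable G L m := by
  induction n using Nat.strong_induction_on with
  | _ n ih =>
  intro V _ _ G _ L m hn hV hL hore
  have off : ∀ (S : Finset V) (k : ℕ), S.Nonempty → n - S.card ≤ 4 * k →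
      ∃ f : V → ℕ, (∀ v, f v ∈ L v) ∧ (∀ u v, u ∉ S → v ∉ S → G.Adj u v → f u ≠ f v) ∧
        ∀ c, (colorClass f c \ S).card ≤ k := by
    intro S k hS hk
    have hcard : Fintype.card {v // v ∉ S} = n - S.card := by
      rw [Fintype.card_subtype_compl (fun v => v ∈ S), Fintype.card_coe, hn]
    have hpos := hS.card_pos
    have hle := card_le_univ S
    have hdeg : ∀ v : {v // v ∉ S}, (univ.filter ((G.comap Subtype.val).Adj v)).card
        ≤ (univ.filter (G.Adj v)).card := by
      intro v
      rw [← card_map (Embedding.subtype fun v => v ∉ S)]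
      refine card_le_card fun u hu => ?_
      simp only [mem_map, mem_filter, mem_univ, true_and, SimpleGraph.comap_adj,
        Embedding.subtype_apply] at hu ⊢
      obtain ⟨a, ha, rfl⟩ := hu
      exact ha
    refine exists_coloring_off hL (ih (n - S.card) (by omega) hcard (by omega)
      (fun v => hL v) fun x y hxy => ?_)
    have := hore x y hxy
    have := hdeg x
    have := hdeg y
    omega
  by_cases hbig : ∃ y, 4 ≤ (univ.filter (G.Adj y)).card
  · obtain ⟨y, hy⟩ := hbig
    obtain ⟨a, b, c, d, hab, hac, had, hbc, hbd, hcd, ha, hb, hc, hd⟩ :=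
      exists_four_of_four_le_card hore hy
    have hS : ({a, b, c, d} : Finset V).card = 4 := by
      rw [card_insert_of_notMem (by simp [hab, hac, had]),
        card_eq_three.2 ⟨b, c, d, hbc, hbd, hcd, rfl⟩]
    have hle := card_le_univ ({a, b, c, d} : Finset V)
    obtain ⟨m, rfl⟩ : ∃ k, m = k + 1 := ⟨m - 1, by omega⟩
    obtain ⟨f, hf, hproper, hcap⟩ := off {a, b, c, d} m (by simp) (by omega)
    exact cappedColorable_of_four hab hac had hbc hbd hcd hL ha hb hc hd hf hproper hcap
  · push Not at hbig
    have hdeg : ∀ v, (univ.filter (G.Adj v)).card ≤ 3 := fun v => by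
      have := hbig v
      omega
    rcases isEmpty_or_nonempty V with hemp | ⟨⟨x⟩⟩
    · exact ⟨fun _ => 0, fun v => hemp.elim v, fun v => hemp.elim v, fun c => by
        rw [eq_empty_of_isEmpty (colorClass _ c)]; simp⟩
    · obtain ⟨f, hf, hproper, hcap⟩ := off {x} m (by simp) (by omega)
      obtain ⟨w, hw, -, hxw⟩ := exists_color (X := univ.filter (G.Adj x)) (A := ∅) (l := L x) f
        (by have := hdeg x; rw [hL, card_empty]; omega)
      simp only [mem_filter, mem_univ, true_and] at hxw
      have hsub : ∀ c, colorClass (update f x w) c \ {x} ⊆ colorClass f c \ {x} := by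
        intro c v hv
        simp only [mem_sdiff, mem_colorClass, mem_singleton] at hv ⊢
        exact ⟨by simpa [hv.2] using hv.1, hv.2⟩
      have hnear : NearColoring G L m (update f x w) w := by
        refine ⟨fun v => ?_, fun u v huv => ?_, ?_, fun c hc => ?_⟩
        · by_cases hv : v = x
          · subst hv; simpa using hw
          · simpa [hv] using hf v
        · by_cases hu : u = x
          · subst hu
            simpa [huv.ne'] using (hxw v huv).symm
          · by_cases hv : v = x
            · subst hv
              simpa [hu] using hxw u huv.symm
            · simpa [hu, hv] using hproper u v (by simpa using hu) (by simpa using hv) huv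
        · have h1 := (card_le_card (hsub w)).trans (hcap w)
          have h2 := card_le_card_sdiff_add_card (s := colorClass (update f x w) w) (t := {x})
          rw [card_singleton] at h2
          omega
        · have h1 := (card_le_card (hsub c)).trans (hcap c)
          rwa [sdiff_singleton_eq_erase, erase_eq_of_notMem (by simpa using hc.symm)] at h1
      exact hnear.cappedColorable hV hL hdeg

end OreListColoring

/-- **Kierstead–Kostochka–Yu.** Every graph `G` with `d(x) + d(y) ≤ 6` for every edge
`xy` (i.e. `Θ(G) ≤ 6`) is equitably `4`-choosable. -/
theorem equitably_four_choosable_of_ore {V : Type*} [Fintype V] (G : SimpleGraph V)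
    [DecidableRel G.Adj]
    (hore : ∀ ⦃x y : V⦄, G.Adj x y → G.degree x + G.degree y ≤ 6) :
    EquitablyChoosable G 4 := by
  classical
  intro L hL
  refine OreListColoring.cappedColorable_of_ore (G := G) (Fintype.card V) rfl (by omega) hL
    fun x y hxy => ?_
  simpa [← SimpleGraph.card_neighborFinset_eq_degree, SimpleGraph.neighborFinset_eq_filter]
    using hore hxy
end

section
/- Let G be a graph. If mad(G) < 3, then G is equitably k-choosable for every k ≥ max{Δ(G), 4}; and if mad(G) < 12/5, then G is equitably k-choosable for every k ≥ max{Δ(G), 3}. -/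
/-- The number of edges of the subgraph of `G` induced by the finite vertex set `A`:
each unordered edge inside `A` is counted twice by the ordered-pair filter, so we
divide by `2`. -/
def inducedEdgeCount {V : Type*} [DecidableEq V] (G : SimpleGraph V) [DecidableRel G.Adj]
    (A : Finset V) : ℕ :=
  ((A ×ˢ A).filter fun p => G.Adj p.1 p.2).card / 2

/-- The maximum average degree of `G` is less than `q`: every nonempty (induced)
subgraph `G[A]` satisfies `2‖G[A]‖ / |A| < q`. -/
def MadLT {V : Type*} [Fintype V] [DecidableEq V] (G : SimpleGraph V)
    [DecidableRel G.Adj] (q : ℚ) : Prop :=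
  ∀ A : Finset V, A.Nonempty → (2 * inducedEdgeCount G A : ℚ) / (A.card : ℚ) < q

set_option linter.unusedSectionVars false

section EquitableReduction

variable {V : Type*} [DecidableEq V] (G : SimpleGraph V) [DecidableRel G.Adj]

/-- The neighbors of `v` that lie in `B`. -/
def neighborsIn (B : Finset V) (v : V) : Finset V := B.filter (G.Adj v)

/-- Coloring the vertices of the list from its tail to its head with pairwise distinct colors,
each vertex sees fewer than `k` forbidden colors: those of its neighbors in `B` and those of the
later entries of the list. -/
def FewConstraints (B : Finset V) (k : ℕ) : List V → Prop
  | [] => True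
  | v :: l => (neighborsIn G B v).card + l.length < k ∧ FewConstraints B k l

/-- `A` contains `k` vertices onto which every equitable coloring of the rest extends. -/
def Reducible (k : ℕ) (A : Finset V) : Prop :=
  ∃ l : List V, l.Nodup ∧ l.length = k ∧ (∀ v ∈ l, v ∈ A) ∧
    FewConstraints G (A \ l.toFinset) k l

/-- Every nonempty vertex set has a vertex with at most two neighbors in it. -/
def TwoDegenerate : Prop :=
  ∀ B : Finset V, B.Nonempty → ∃ v ∈ B, (neighborsIn G B v).card ≤ 2

/-- An `L`-coloring of `G[A]` with color classes of size at most `⌈|A|/k⌉`. -/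
def EquitablyColorableOn (k : ℕ) (L : V → Finset ℕ) (A : Finset V) : Prop :=
  ∃ f : V → ℕ, (∀ v ∈ A, f v ∈ L v) ∧ (∀ u ∈ A, ∀ v ∈ A, G.Adj u v → f u ≠ f v) ∧
    ∀ c : ℕ, (A.filter fun v => f v = c).card ≤ (A.card + k - 1) / k

variable {G}

@[simp]
theorem mem_neighborsIn {B : Finset V} {v u : V} :
    u ∈ neighborsIn G B v ↔ u ∈ B ∧ G.Adj v u := by
  simp [neighborsIn]

theorem neighborsIn_mono {B C : Finset V} (h : B ⊆ C) (v : V) :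
    neighborsIn G B v ⊆ neighborsIn G C v := Finset.filter_subset_filter _ h

theorem card_neighborsIn_sdiff_add_le {A T P : Finset V} {v : V} (hT : P ⊆ T)
    (hP : P ⊆ neighborsIn G A v) :
    (neighborsIn G (A \ T) v).card + P.card ≤ (neighborsIn G A v).card := by
  have hd : Disjoint (neighborsIn G (A \ T) v) P := by
    rw [Finset.disjoint_left]
    intro x hx hxP
    have := hT hxP
    simp_all
  rw [← Finset.card_union_of_disjoint hd]
  exact Finset.card_le_card
    (Finset.union_subset (neighborsIn_mono Finset.sdiff_subset v) hP)

theorem FewConstraints.append {B : Finset V} {k : ℕ} {l₁ l₂ : List V}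
    (h₂ : FewConstraints G B k l₂) {d : ℕ} (h₁ : ∀ v ∈ l₁, (neighborsIn G B v).card ≤ d)
    (hlen : l₁.length + l₂.length + d ≤ k) : FewConstraints G B k (l₁ ++ l₂) := by
  induction l₁ with
  | nil => exact h₂
  | cons v l ih =>
    simp only [List.length_cons] at hlen
    refine ⟨?_, ih (fun u hu => h₁ u (List.mem_cons_of_mem _ hu)) (by omega)⟩
    have := h₁ v List.mem_cons_self
    change _ + (l ++ l₂).length < k
    rw [List.length_append]
    omega

theorem FewConstraints.mono {B C : Finset V} {k : ℕ} (h : B ⊆ C) {l : List V}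
    (hl : FewConstraints G C k l) : FewConstraints G B k l := by
  induction l with
  | nil => trivial
  | cons v l ih =>
    refine ⟨lt_of_le_of_lt ?_ hl.1, ih hl.2⟩
    exact Nat.add_le_add_right (Finset.card_le_card (neighborsIn_mono h v)) _

theorem FewConstraints.exists_coloring {B : Finset V} {k : ℕ} {L : V → Finset ℕ}
    (hL : ∀ v, (L v).card = k) (f : V → ℕ) {l : List V} (hnd : l.Nodup)
    (hl : FewConstraints G B k l) :
    ∃ g : V → ℕ, (∀ v ∈ l, g v ∈ L v) ∧ (∀ u ∈ l, ∀ v ∈ l, g u = g v → u = v) ∧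
      ∀ v ∈ l, ∀ u ∈ B, G.Adj v u → g v ≠ f u := by
  induction l with
  | nil => exact ⟨f, by simp, by simp, by simp⟩
  | cons v l ih =>
    obtain ⟨hv, hl⟩ := hl
    obtain ⟨hvl, hnd⟩ := List.nodup_cons.1 hnd
    obtain ⟨g, hgL, hginj, hgf⟩ := ih hnd hl
    have hcard : ((neighborsIn G B v).image f ∪ l.toFinset.image g).card < (L v).card := by
      rw [hL]
      refine lt_of_le_of_lt (Finset.card_union_le _ _) (lt_of_le_of_lt ?_ hv)
      exact Nat.add_le_add Finset.card_image_le
        (Finset.card_image_le.trans (List.toFinset_card_le l))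
    obtain ⟨c, hcL, hc⟩ := Finset.exists_mem_notMem_of_card_lt_card hcard
    simp only [Finset.mem_union, Finset.mem_image, mem_neighborsIn, List.mem_toFinset, not_or,
      not_exists, not_and] at hc
    have hne : ∀ u ∈ l, Function.update g v c u = g u := by
      intro u hu
      refine Function.update_of_ne ?_ _ _
      rintro rfl
      exact hvl hu
    refine ⟨Function.update g v c, ?_, ?_, ?_⟩
    · intro u hu
      rcases List.mem_cons.1 hu with rfl | hu
      · simpa using hcL
      · rw [hne u hu]; exact hgL u hu
    · intro u hu u' hu' h
      rcases List.mem_cons.1 hu with rfl | hul <;> rcases List.mem_cons.1 hu' with rfl | hul'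
      · rfl
      · rw [hne u' hul', Function.update_self] at h
        exact absurd h.symm (hc.2 u' hul')
      · rw [hne u hul, Function.update_self] at h
        exact absurd h (hc.2 u hul)
      · rw [hne u hul, hne u' hul'] at h
        exact hginj u hul u' hul' h
    · intro u hu x hx hadj
      rcases List.mem_cons.1 hu with rfl | hu
      · rw [Function.update_self]
        exact fun h => hc.1 x ⟨hx, hadj⟩ h.symm
      · rw [hne u hu]; exact hgf u hu x hx hadj

theorem equitablyColorableOn_of_card_le {k : ℕ} {L : V → Finset ℕ}
    (hL : ∀ v, (L v).card = k) {A : Finset V} (hA : A.card ≤ k) :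
    EquitablyColorableOn G k L A := by
  have hfew : FewConstraints G ∅ k (A.toList ++ []) :=
    FewConstraints.append (l₂ := []) trivial (d := 0) (by simp [neighborsIn]) (by simpa using hA)
  rw [List.append_nil] at hfew
  obtain ⟨g, hgL, hginj, -⟩ := hfew.exists_coloring hL (fun _ => 0) A.nodup_toList
  simp only [Finset.mem_toList] at hgL hginj
  refine ⟨g, hgL, fun u hu v hv hadj h => hadj.ne (hginj u hu v hv h), fun c => ?_⟩
  rcases A.eq_empty_or_nonempty with rfl | hne
  · simp
  have hpos := hne.card_pos
  calc (A.filter fun v => g v = c).card ≤ 1 := by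
        refine Finset.card_le_one.2 fun u hu v hv => ?_
        rw [Finset.mem_filter] at hu hv
        exact hginj u hu.1 v hv.1 (hu.2.trans hv.2.symm)
    _ ≤ (A.card + k - 1) / k := (Nat.one_le_div_iff (by omega)).2 (by omega)

theorem Reducible.exists_subset_extend {k : ℕ} (hk : 0 < k) {L : V → Finset ℕ}
    (hL : ∀ v, (L v).card = k) {A : Finset V} (h : Reducible G k A) :
    ∃ B ⊂ A, EquitablyColorableOn G k L B → EquitablyColorableOn G k L A := by
  obtain ⟨l, hnd, hlen, hlA, hfew⟩ := h
  have hSA : l.toFinset ⊆ A := fun v hv => hlA v (List.mem_toFinset.1 hv)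
  have hScard : l.toFinset.card = k := by rw [List.toFinset_card_of_nodup hnd, hlen]
  have hAcard : (A \ l.toFinset).card + k = A.card := by
    rw [← hScard]; exact Finset.card_sdiff_add_card_eq_card hSA
  refine ⟨A \ l.toFinset, ?_, ?_⟩
  · refine Finset.sdiff_ssubset hSA ?_
    rw [← Finset.card_pos]; omega
  rintro ⟨f, hfL, hfadj, hfcard⟩
  obtain ⟨g, hgL, hginj, hgf⟩ := hfew.exists_coloring hL f hnd
  refine ⟨fun v => if v ∈ l then g v else f v, ?_, ?_, ?_⟩
  · intro v hv
    by_cases hvl : v ∈ l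
    · simpa [hvl] using hgL v hvl
    · simpa [hvl] using hfL v (by simp [hv, hvl])
  · intro u hu v hv hadj
    by_cases hul : u ∈ l <;> by_cases hvl : v ∈ l <;> simp only [hul, hvl, if_true, if_false]
    · exact fun h => hadj.ne (hginj u hul v hvl h)
    · exact hgf u hul v (by simp [hv, hvl]) hadj
    · exact (hgf v hvl u (by simp [hu, hul]) hadj.symm).symm
    · exact hfadj u (by simp [hu, hul]) v (by simp [hv, hvl]) hadj
  · intro c
    have hsub : (A.filter fun v => (if v ∈ l then g v else f v) = c) ⊆
        ((A \ l.toFinset).filter fun v => f v = c) ∪ (l.toFinset.filter fun v => g v = c) := by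
      intro v hv
      by_cases hvl : v ∈ l <;> simp_all
    have hone : (l.toFinset.filter fun v => g v = c).card ≤ 1 := by
      refine Finset.card_le_one.2 fun u hu v hv => ?_
      rw [Finset.mem_filter, List.mem_toFinset] at hu hv
      exact hginj u hu.1 v hv.1 (hu.2.trans hv.2.symm)
    have hdiv : (A.card + k - 1) / k = ((A \ l.toFinset).card + k - 1) / k + 1 := by
      rw [← Nat.add_div_right _ hk]
      congr 1
      omega
    rw [hdiv]
    exact (Finset.card_le_card hsub).trans
      ((Finset.card_union_le _ _).trans (Nat.add_le_add (hfcard c) hone))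

theorem equitablyColorableOn_of_reducible {k : ℕ} (hk : 0 < k) {L : V → Finset ℕ}
    (hL : ∀ v, (L v).card = k) (h : ∀ A : Finset V, k < A.card → Reducible G k A)
    (A : Finset V) : EquitablyColorableOn G k L A := by
  induction A using Finset.strongInduction with
  | H A ih =>
    rcases le_or_gt A.card k with hA | hA
    · exact equitablyColorableOn_of_card_le hL hA
    · obtain ⟨B, hBA, hB⟩ := (h A hA).exists_subset_extend hk hL
      exact hB (ih B hBA)

theorem TwoDegenerate.exists_list (hG : TwoDegenerate G) {A : Finset V} (m : ℕ) :
    ∀ T ⊆ A, T.card + m ≤ A.card → ∃ M : List V, M.Nodup ∧ M.length = m ∧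
      (∀ v ∈ M, v ∈ A ∧ v ∉ T) ∧
      ∀ v ∈ M, (neighborsIn G (A \ (T ∪ M.toFinset)) v).card ≤ 2 := by
  induction m with
  | zero => exact fun T _ _ => ⟨[], by simp⟩
  | succ m ih =>
    intro T hT hcard
    have hne : (A \ T).Nonempty := by
      rw [← Finset.card_pos, Finset.card_sdiff_of_subset hT]; omega
    obtain ⟨v, hv, hdeg⟩ := hG _ hne
    rw [Finset.mem_sdiff] at hv
    obtain ⟨M, hnd, hlen, hmem, hM⟩ := ih (insert v T) (Finset.insert_subset hv.1 hT)
      (by rw [Finset.card_insert_of_notMem hv.2]; omega)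
    have hset : T ∪ (v :: M).toFinset = insert v T ∪ M.toFinset := by
      ext x; simp only [List.toFinset_cons, Finset.mem_union, Finset.mem_insert]; tauto
    refine ⟨v :: M, ?_, by simp [hlen], ?_, ?_⟩
    · refine List.nodup_cons.2 ⟨fun h => (hmem v h).2 (Finset.mem_insert_self _ _), hnd⟩
    · intro u hu
      rcases List.mem_cons.1 hu with rfl | hu
      · exact hv
      · exact ⟨(hmem u hu).1, fun h => (hmem u hu).2 (Finset.mem_insert_of_mem h)⟩
    · intro u hu
      rw [hset]
      rcases List.mem_cons.1 hu with rfl | hu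
      · refine (Finset.card_le_card (neighborsIn_mono ?_ u)).trans hdeg
        refine Finset.sdiff_subset_sdiff le_rfl ?_
        exact (Finset.subset_insert _ _).trans Finset.subset_union_left
      · exact hM u hu

/-- A core `w, z, H` with room for the remaining vertices gives a reducible set: the gap between
`z` and `H` is filled by vertices of small degree. -/
theorem TwoDegenerate.reducible_of_core (hG : TwoDegenerate G) {A : Finset V} {k : ℕ}
    (hkA : k ≤ A.card) {w z : V} {H T : List V} (hT : T = w :: z :: H) (hnd : T.Nodup)
    (hlen : T.length ≤ k) (hsub : ∀ v ∈ T, v ∈ A)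
    (hw : (neighborsIn G (A \ T.toFinset) w).card = 0)
    (hz : (neighborsIn G (A \ T.toFinset) z).card ≤ 1)
    (hH : FewConstraints G (A \ T.toFinset) k H) : Reducible G k A := by
  have hTA : T.toFinset ⊆ A := fun v hv => hsub v (List.mem_toFinset.1 hv)
  have hTcard : T.toFinset.card = T.length := List.toFinset_card_of_nodup hnd
  obtain ⟨M, hMnd, hMlen, hMmem, hM⟩ :=
    hG.exists_list (k - T.length) T.toFinset hTA (by omega)
  have hTlen : T.length = H.length + 2 := by simp [hT]
  have hset : (w :: z :: (M ++ H)).toFinset = T.toFinset ∪ M.toFinset := by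
    ext x; simp only [hT, List.toFinset_cons, List.toFinset_append, Finset.mem_union,
      Finset.mem_insert]; tauto
  have hmono : A \ (T.toFinset ∪ M.toFinset) ⊆ A \ T.toFinset :=
    Finset.sdiff_subset_sdiff le_rfl Finset.subset_union_left
  have hperm : (w :: z :: (M ++ H)).Perm (T ++ M) := by
    rw [hT]
    exact (List.perm_append_comm.cons z).cons w
  refine ⟨w :: z :: (M ++ H), ?_, ?_, ?_, ?_⟩
  · rw [hperm.nodup_iff, List.nodup_append']
    exact ⟨hnd, hMnd, fun v hvT hvM => (hMmem v hvM).2 (List.mem_toFinset.2 hvT)⟩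
  · simp only [List.length_cons, List.length_append]; omega
  · intro v hv
    rcases List.mem_append.1 (hperm.mem_iff.1 hv) with hv | hv
    · exact hsub v hv
    · exact (hMmem v hv).1
  · rw [hset]
    have hcw := Finset.card_le_card (neighborsIn_mono (G := G) hmono w)
    have hcz := Finset.card_le_card (neighborsIn_mono (G := G) hmono z)
    refine ⟨?_, ?_, ?_⟩
    · simp only [List.length_cons, List.length_append]; omega
    · simp only [List.length_append]; omega
    · exact (hH.mono hmono).append hM (by omega)

theorem card_neighborsIn_sdiff_lt {A T : Finset V} {v x : V} {k : ℕ}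
    (hdeg : (neighborsIn G A v).card ≤ k) (hxT : x ∈ T) (hx : x ∈ neighborsIn G A v) :
    (neighborsIn G (A \ T) v).card + 1 ≤ k :=
  (card_neighborsIn_sdiff_add_le (P := {x}) (by simpa using hxT) (by simpa using hx)).trans hdeg

theorem card_neighborsIn_sdiff_add_two_le {A T : Finset V} {v x y : V} {k : ℕ}
    (hdeg : (neighborsIn G A v).card ≤ k) (hxy : x ≠ y) (hxT : x ∈ T) (hyT : y ∈ T)
    (hx : x ∈ neighborsIn G A v) (hy : y ∈ neighborsIn G A v) :
    (neighborsIn G (A \ T) v).card + 2 ≤ k := by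
  rw [← Finset.card_pair hxy]
  exact (card_neighborsIn_sdiff_add_le (by simp [Finset.insert_subset_iff, hxT, hyT])
    (by simp only [Finset.insert_subset_iff, Finset.singleton_subset_iff, hx, hy, and_self])).trans
    hdeg

theorem card_neighborsIn_sdiff_eq_zero {A T : Finset V} {v : V} (h : neighborsIn G A v ⊆ T) :
    (neighborsIn G (A \ T) v).card = 0 := by
  have := card_neighborsIn_sdiff_add_le h (le_refl (neighborsIn G A v))
  omega

/-- A set of at most two elements containing `a` is `{a}` or a pair. -/
theorem eq_singleton_or_eq_pair {N : Finset V} {a : V} (hN : N.card ≤ 2) (ha : a ∈ N) :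
    N = {a} ∨ ∃ b, b ≠ a ∧ N = {a, b} := by
  have hc := Finset.card_erase_of_mem ha
  rcases (N.erase a).eq_empty_or_nonempty with h0 | ⟨b, hb⟩
  · left
    rw [← Finset.insert_erase ha, h0]
    rfl
  · right
    have hb1 : (N.erase a).card = 1 := by
      have := Finset.card_pos.2 ⟨b, hb⟩
      omega
    obtain ⟨b', hb'⟩ := Finset.card_eq_one.1 hb1
    refine ⟨b', ?_, by rw [← hb', Finset.insert_erase ha]⟩
    have : b' ∈ N.erase a := by simp [hb']
    exact Finset.ne_of_mem_erase this

section Configurations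

variable {A : Finset V} {k : ℕ}

theorem neighborsIn_nonempty_of_not_reducible (hG : TwoDegenerate G) (hk : 3 ≤ k)
    (hkA : k < A.card) (hdeg : ∀ v ∈ A, (neighborsIn G A v).card ≤ k) (hred : ¬ Reducible G k A)
    {w : V} (hw : w ∈ A) : (neighborsIn G A w).Nonempty := by
  by_contra hempty
  rw [Finset.not_nonempty_iff_eq_empty] at hempty
  have hnadj : ∀ v ∈ A, ¬ G.Adj w v := fun v hv hadj => by
    have : v ∈ neighborsIn G A w := mem_neighborsIn.2 ⟨hv, hadj⟩
    simp [hempty] at this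
  have hne : (A \ {w}).Nonempty := by
    rw [← Finset.card_pos, Finset.card_sdiff_of_subset (by simpa using hw)]
    simp only [Finset.card_singleton]; omega
  obtain ⟨z, hz, hzdeg⟩ := hG _ hne
  simp only [Finset.mem_sdiff, Finset.mem_singleton] at hz
  rcases (neighborsIn G (A \ {w}) z).eq_empty_or_nonempty with h0 | ⟨x, hx⟩
  · refine hred (hG.reducible_of_core hkA.le (w := w) (z := z) (H := []) rfl ?_ ?_ ?_ ?_ ?_ trivial)
    · simp [Ne.symm hz.2]
    · simp only [List.length_cons, List.length_nil]; omega
    · simp [hw, hz.1]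
    · exact card_neighborsIn_sdiff_eq_zero (by simp [hempty])
    · refine (Finset.card_le_card (neighborsIn_mono (C := A \ {w}) ?_ z)).trans (by simp [h0])
      exact Finset.sdiff_subset_sdiff le_rfl (by simp)
  · have hx' := hx
    simp only [mem_neighborsIn, Finset.mem_sdiff, Finset.mem_singleton] at hx'
    obtain ⟨⟨hxA, hxw⟩, hzx⟩ := hx'
    refine hred (hG.reducible_of_core hkA.le (w := w) (z := z) (H := [x]) rfl ?_ ?_ ?_ ?_ ?_ ?_)
    · simp [Ne.symm hz.2, Ne.symm hxw, hzx.ne]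
    · simp only [List.length_cons, List.length_nil]; omega
    · simp [hw, hz.1, hxA]
    · exact card_neighborsIn_sdiff_eq_zero (by simp [hempty])
    · have h2 := card_neighborsIn_sdiff_lt (T := {w, z, x}) hzdeg (by simp) hx
      have hsub : A \ [w, z, x].toFinset ⊆ (A \ {w}) \ {w, z, x} := by
        intro v; simp only [Finset.mem_sdiff, List.mem_toFinset, List.mem_cons, List.not_mem_nil,
          Finset.mem_singleton, Finset.mem_insert]; tauto
      have := Finset.card_le_card (neighborsIn_mono (G := G) hsub z)
      omega
    · refine ⟨?_, trivial⟩
      exact card_neighborsIn_sdiff_lt (x := z) (hdeg x hxA) (by simp)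
        (mem_neighborsIn.2 ⟨hz.1, hzx.symm⟩)

theorem not_adj_of_not_reducible (hG : TwoDegenerate G) (hk : 3 ≤ k)
    (hkA : k < A.card) (hdeg : ∀ v ∈ A, (neighborsIn G A v).card ≤ k) (hred : ¬ Reducible G k A)
    {w z : V} (hw : w ∈ A) (hz : z ∈ A) (hdw : (neighborsIn G A w).card ≤ 2)
    (hdz : (neighborsIn G A z).card ≤ 2) : ¬ G.Adj w z := by
  intro hadj
  have hzw : z ∈ neighborsIn G A w := mem_neighborsIn.2 ⟨hz, hadj⟩
  have hwz : w ∈ neighborsIn G A z := mem_neighborsIn.2 ⟨hw, hadj.symm⟩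
  rcases eq_singleton_or_eq_pair hdw hzw with hN | ⟨x, hxz, hN⟩
  · refine hred (hG.reducible_of_core hkA.le (w := w) (z := z) (H := []) rfl ?_ ?_ ?_ ?_ ?_ trivial)
    · simp [hadj.ne]
    · simp only [List.length_cons, List.length_nil]; omega
    · simp [hw, hz]
    · exact card_neighborsIn_sdiff_eq_zero (by simp [hN])
    · have := card_neighborsIn_sdiff_lt (T := [w, z].toFinset) hdz (by simp) hwz
      omega
  · have hx : x ∈ neighborsIn G A w := by simp [hN]
    rw [mem_neighborsIn] at hx
    refine hred (hG.reducible_of_core hkA.le (w := w) (z := z) (H := [x]) rfl ?_ ?_ ?_ ?_ ?_ ?_)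
    · simp [hadj.ne, hx.2.ne, Ne.symm hxz]
    · simp only [List.length_cons, List.length_nil]; omega
    · simp [hw, hz, hx.1]
    · exact card_neighborsIn_sdiff_eq_zero (by rw [hN]; intro v; simp; tauto)
    · have := card_neighborsIn_sdiff_lt (T := [w, z, x].toFinset) hdz (by simp) hwz
      omega
    · refine ⟨?_, trivial⟩
      exact card_neighborsIn_sdiff_lt (x := w) (hdeg x hx.1) (by simp)
        (mem_neighborsIn.2 ⟨hw, hx.2.symm⟩)

theorem three_lt_card_of_adj_leaf (hG : TwoDegenerate G) (hk : 3 ≤ k)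
    (hkA : k < A.card) (hdeg : ∀ v ∈ A, (neighborsIn G A v).card ≤ k) (hred : ¬ Reducible G k A)
    {w x : V} (hw : w ∈ A) (hx : x ∈ A) (hdw : (neighborsIn G A w).card ≤ 1)
    (hadj : G.Adj w x) : 3 < (neighborsIn G A x).card := by
  by_contra! hdx
  have hxw : x ∈ neighborsIn G A w := mem_neighborsIn.2 ⟨hx, hadj⟩
  have hwx : w ∈ neighborsIn G A x := mem_neighborsIn.2 ⟨hw, hadj.symm⟩
  have hdx3 : 2 < (neighborsIn G A x).card := by
    by_contra! h
    exact not_adj_of_not_reducible hG hk hkA hdeg hred hw hx (by omega) h hadj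
  obtain ⟨t, ht, htw⟩ := Finset.exists_mem_ne (by omega : 1 < (neighborsIn G A x).card) w
  have ht' := mem_neighborsIn.1 ht
  refine hred (hG.reducible_of_core hkA.le (w := w) (z := x) (H := [t]) rfl ?_ ?_ ?_ ?_ ?_ ?_)
  · simp [hadj.ne, ht'.2.ne, Ne.symm htw]
  · simp only [List.length_cons, List.length_nil]; omega
  · simp [hw, hx, ht'.1]
  · refine card_neighborsIn_sdiff_eq_zero fun v hv => ?_
    simp [Finset.card_le_one.1 hdw v hv x hxw]
  · have := card_neighborsIn_sdiff_add_two_le (T := [w, x, t].toFinset) hdx htw.symm (by simp)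
      (by simp) hwx ht
    omega
  · refine ⟨?_, trivial⟩
    exact card_neighborsIn_sdiff_lt (x := x) (hdeg t ht'.1) (by simp)
      (mem_neighborsIn.2 ⟨hx, ht'.2.symm⟩)

theorem eq_of_adj_of_not_reducible (hG : TwoDegenerate G) (hk : 4 ≤ k)
    (hkA : k < A.card) (hdeg : ∀ v ∈ A, (neighborsIn G A v).card ≤ k) (hred : ¬ Reducible G k A)
    {w y z : V} (hw : w ∈ A) (hy : y ∈ A) (hz : z ∈ A) (hdw : (neighborsIn G A w).card ≤ 2)
    (hdz : (neighborsIn G A z).card ≤ 2) (hwy : G.Adj w y) (hzy : G.Adj z y) : w = z := by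
  by_contra hne
  have hwz := not_adj_of_not_reducible hG (by omega) hkA hdeg hred hw hz hdw hdz
  have hwN : w ∈ neighborsIn G A y := mem_neighborsIn.2 ⟨hw, hwy.symm⟩
  have hzN : z ∈ neighborsIn G A y := mem_neighborsIn.2 ⟨hz, hzy.symm⟩
  have hyz : y ∈ neighborsIn G A z := mem_neighborsIn.2 ⟨hy, hzy⟩
  rcases eq_singleton_or_eq_pair hdw (mem_neighborsIn.2 ⟨hy, hwy⟩) with hN | ⟨x, hxy, hN⟩
  · refine hred (hG.reducible_of_core hkA.le (w := w) (z := z) (H := [y]) rfl ?_ ?_ ?_ ?_ ?_ ?_)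
    · simp [hne, hwy.ne, hzy.ne]
    · simp only [List.length_cons, List.length_nil]; omega
    · simp [hw, hz, hy]
    · exact card_neighborsIn_sdiff_eq_zero (by simp [hN])
    · have := card_neighborsIn_sdiff_lt (T := [w, z, y].toFinset) hdz (by simp) hyz
      omega
    · exact ⟨card_neighborsIn_sdiff_lt (hdeg y hy) (by simp) hwN, trivial⟩
  · have hx : x ∈ neighborsIn G A w := by simp [hN]
    rw [mem_neighborsIn] at hx
    have hxz : z ≠ x := fun h => hwz (h ▸ hx.2)
    refine hred (hG.reducible_of_core hkA.le (w := w) (z := z) (H := [y, x]) rfl ?_ ?_ ?_ ?_ ?_ ?_)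
    · simp [hne, hwy.ne, hzy.ne, hx.2.ne, hxz, Ne.symm hxy]
    · simp only [List.length_cons, List.length_nil]; omega
    · simp [hw, hz, hy, hx.1]
    · exact card_neighborsIn_sdiff_eq_zero (by rw [hN]; intro v; simp; tauto)
    · have := card_neighborsIn_sdiff_lt (T := [w, z, y, x].toFinset) hdz (by simp) hyz
      omega
    · refine ⟨?_, ?_, trivial⟩
      · exact card_neighborsIn_sdiff_add_two_le (hdeg y hy) hne (by simp) (by simp) hwN hzN
      · exact card_neighborsIn_sdiff_lt (x := w) (hdeg x hx.1) (by simp)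
          (mem_neighborsIn.2 ⟨hw, hx.2.symm⟩)

theorem exists_adj_three_lt_card (hG : TwoDegenerate G) (hk : 4 ≤ k)
    (hkA : k < A.card) (hdeg : ∀ v ∈ A, (neighborsIn G A v).card ≤ k) (hred : ¬ Reducible G k A)
    {w : V} (hw : w ∈ A) (hdw : (neighborsIn G A w).card = 2) :
    ∃ y ∈ A, G.Adj w y ∧ 3 < (neighborsIn G A y).card := by
  by_contra! h
  obtain ⟨u, u', huu', hN⟩ := Finset.card_eq_two.1 hdw
  have hu : u ∈ neighborsIn G A w := by simp [hN]
  have hu' : u' ∈ neighborsIn G A w := by simp [hN]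
  rw [mem_neighborsIn] at hu hu'
  have hwu : w ∈ neighborsIn G A u := mem_neighborsIn.2 ⟨hw, hu.2.symm⟩
  have hwu' : w ∈ neighborsIn G A u' := mem_neighborsIn.2 ⟨hw, hu'.2.symm⟩
  have hdu := h u hu.1 hu.2
  have hdu' := h u' hu'.1 hu'.2
  have hdu3 : 2 < (neighborsIn G A u).card := by
    by_contra! h2
    exact not_adj_of_not_reducible hG (by omega) hkA hdeg hred hw hu.1 hdw.le h2 hu.2
  have hlt : ({w, u'} : Finset V).card < (neighborsIn G A u).card :=
    lt_of_le_of_lt Finset.card_le_two hdu3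
  obtain ⟨t, ht, htn⟩ := Finset.exists_mem_notMem_of_card_lt_card hlt
  simp only [Finset.mem_insert, Finset.mem_singleton, not_or] at htn
  have ht' := mem_neighborsIn.1 ht
  refine hred (hG.reducible_of_core hkA.le (w := w) (z := u) (H := [u', t]) rfl ?_ ?_ ?_ ?_ ?_ ?_)
  · simp [hu.2.ne, hu'.2.ne, ht'.2.ne, huu', Ne.symm htn.1, Ne.symm htn.2]
  · simp only [List.length_cons, List.length_nil]; omega
  · simp [hw, hu.1, hu'.1, ht'.1]
  · exact card_neighborsIn_sdiff_eq_zero (by rw [hN]; intro v; simp; tauto)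
  · have := card_neighborsIn_sdiff_add_two_le (T := [w, u, u', t].toFinset) hdu (Ne.symm htn.1)
      (by simp) (by simp) hwu ht
    omega
  · refine ⟨?_, ?_, trivial⟩
    · have := card_neighborsIn_sdiff_lt (T := [w, u, u', t].toFinset) hdu' (by simp) hwu'
      simp only [List.length_cons, List.length_nil]; omega
    · exact card_neighborsIn_sdiff_lt (x := u) (hdeg t ht'.1) (by simp)
        (mem_neighborsIn.2 ⟨hu.1, ht'.2.symm⟩)

/-- Sparse graphs contain a reducible set when `k ≥ 4`: otherwise, after deleting the leaves, each
vertex of degree two can be charged to a private vertex of degree at least four. -/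
theorem reducible_of_sum_lt_three_mul (hk : 4 ≤ k) (hG : TwoDegenerate G)
    (hsum : ∀ B : Finset V, B.Nonempty → ∑ v ∈ B, (neighborsIn G B v).card < 3 * B.card)
    (hkA : k < A.card) (hdeg : ∀ v ∈ A, (neighborsIn G A v).card ≤ k) : Reducible G k A := by
  by_contra hred
  have hk3 : 3 ≤ k := by omega
  set B := A.filter fun v => 2 ≤ (neighborsIn G A v).card with hB
  have hBA : B ⊆ A := Finset.filter_subset _ _
  have hBne : B.Nonempty := by
    obtain ⟨w, hw⟩ : A.Nonempty := by rw [← Finset.card_pos]; omega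
    rcases le_or_gt 2 (neighborsIn G A w).card with h2 | h2
    · exact ⟨w, by simp [hB, hw, h2]⟩
    · obtain ⟨x, hx⟩ := neighborsIn_nonempty_of_not_reducible hG hk3 hkA hdeg hred hw
      rw [mem_neighborsIn] at hx
      have := three_lt_card_of_adj_leaf hG hk3 hkA hdeg hred hw hx.1 (by omega) hx.2
      exact ⟨x, by simp only [hB, Finset.mem_filter]; exact ⟨hx.1, by omega⟩⟩
  -- a vertex with no leaf neighbor keeps its degree
  have hkeep : ∀ v, (∀ x ∈ A, G.Adj x v → 2 ≤ (neighborsIn G A x).card) →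
      neighborsIn G B v = neighborsIn G A v := by
    intro v hv
    refine (neighborsIn_mono hBA v).antisymm fun x hx => ?_
    rw [mem_neighborsIn] at hx ⊢
    exact ⟨Finset.mem_filter.2 ⟨hx.1, hv x hx.1 hx.2.symm⟩, hx.2⟩
  have hsmall : ∀ v ∈ A, (neighborsIn G A v).card ≤ 3 →
      neighborsIn G B v = neighborsIn G A v := by
    refine fun v hv h3 => hkeep v fun x hx hadj => ?_
    by_contra! h1
    have := three_lt_card_of_adj_leaf hG hk3 hkA hdeg hred hx hv (by omega) hadj
    omega
  have hlarge : ∀ v ∈ A, (neighborsIn G A v).card ≤ (neighborsIn G B v).card + 1 := by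
    intro v hv
    have hone : (neighborsIn G A v \ neighborsIn G B v).card ≤ 1 := by
      refine Finset.card_le_one.2 fun a ha b hb => ?_
      simp only [hB, Finset.mem_sdiff, mem_neighborsIn, Finset.mem_filter] at ha hb
      exact eq_of_adj_of_not_reducible hG hk hkA hdeg hred ha.1.1 hv hb.1.1
        (by by_contra! h; exact ha.2 ⟨⟨ha.1.1, by omega⟩, ha.1.2⟩)
        (by by_contra! h; exact hb.2 ⟨⟨hb.1.1, by omega⟩, hb.1.2⟩) ha.1.2.symm hb.1.2.symm
    have := Finset.card_sdiff_add_card_eq_card (neighborsIn_mono (G := G) hBA v)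
    omega
  set W := A.filter fun v => (neighborsIn G A v).card = 2
  have hp : ∀ w, ∃ y, w ∈ W → y ∈ A ∧ G.Adj w y ∧ 3 < (neighborsIn G A y).card := by
    intro w
    by_cases hw : w ∈ W
    · have hw' := Finset.mem_filter.1 hw
      obtain ⟨y, hy⟩ := exists_adj_three_lt_card hG hk hkA hdeg hred hw'.1 hw'.2
      exact ⟨y, fun _ => hy⟩
    · exact ⟨w, fun h => absurd h hw⟩
  choose p hp using hp
  have hinj : Set.InjOn p W := by
    intro w hw z hz h
    have hw' := Finset.mem_filter.1 (Finset.mem_coe.1 hw)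
    have hz' := Finset.mem_filter.1 (Finset.mem_coe.1 hz)
    exact eq_of_adj_of_not_reducible hG hk hkA hdeg hred hw'.1 (hp w hw).1 hz'.1 hw'.2.le
      hz'.2.le (hp w hw).2.1 (h ▸ (hp z hz).2.1)
  have hcardp : (W.image p).card = W.card := Finset.card_image_of_injOn hinj
  have hterm : ∀ v ∈ B, 3 + (if v ∈ W.image p then 1 else 0) ≤
      (neighborsIn G B v).card + (if v ∈ W then 1 else 0) := by
    intro v hv
    have hv' := Finset.mem_filter.1 hv
    by_cases hvp : v ∈ W.image p
    · obtain ⟨w, hw, rfl⟩ := Finset.mem_image.1 hvp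
      have hw' := Finset.mem_filter.1 hw
      have hwp := hp w hw
      have hk' : neighborsIn G B (p w) = neighborsIn G A (p w) := by
        refine hkeep _ fun x hx hadj => ?_
        by_contra! h1
        have := eq_of_adj_of_not_reducible hG hk hkA hdeg hred hx hv'.1 hw'.1 (by omega) hw'.2.le
          hadj hwp.2.1
        subst this
        omega
      rw [if_pos hvp, hk']
      omega
    · rw [if_neg hvp]
      rcases le_or_gt (neighborsIn G A v).card 3 with h3 | h3
      · rw [hsmall v hv'.1 h3]
        split_ifs with hvW
        · omega
        · have : (neighborsIn G A v).card ≠ 2 := fun h => hvW (Finset.mem_filter.2 ⟨hv'.1, h⟩)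
          omega
      · have := hlarge v hv'.1
        omega
  have htot := Finset.sum_le_sum hterm
  have hWB : W ⊆ B := fun v hv => by
    have hv' := Finset.mem_filter.1 hv
    exact Finset.mem_filter.2 ⟨hv'.1, hv'.2.ge⟩
  have hpB : W.image p ⊆ B := fun v hv => by
    obtain ⟨w, hw, rfl⟩ := Finset.mem_image.1 hv
    have := hp w hw
    exact Finset.mem_filter.2 ⟨this.1, by omega⟩
  simp only [Finset.sum_add_distrib, Finset.sum_const, smul_eq_mul, Finset.sum_boole,
    Finset.filter_mem_eq_inter, Finset.inter_eq_right.2 hWB, Finset.inter_eq_right.2 hpB,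
    Nat.cast_id] at htot
  have := hsum B hBne
  omega

/-- Sparser graphs contain a reducible set when `k = 3`: otherwise vertices of degree two are
pairwise nonadjacent and all other degrees are three. -/
theorem reducible_of_five_mul_sum_lt (hG : TwoDegenerate G)
    (hsum : ∀ B : Finset V, B.Nonempty → 5 * ∑ v ∈ B, (neighborsIn G B v).card < 12 * B.card)
    (hkA : 3 < A.card) (hdeg : ∀ v ∈ A, (neighborsIn G A v).card ≤ 3) : Reducible G 3 A := by
  by_contra hred
  have htwo : ∀ v ∈ A, 2 ≤ (neighborsIn G A v).card := by
    intro v hv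
    by_contra! h
    obtain ⟨x, hx⟩ := neighborsIn_nonempty_of_not_reducible hG le_rfl hkA hdeg hred hv
    rw [mem_neighborsIn] at hx
    have := three_lt_card_of_adj_leaf hG le_rfl hkA hdeg hred hv hx.1 (by omega) hx.2
    exact absurd (hdeg x hx.1) (by omega)
  set W := A.filter fun v => (neighborsIn G A v).card = 2
  set U := A.filter fun v => ¬ (neighborsIn G A v).card = 2
  have hcard : W.card + U.card = A.card := Finset.card_filter_add_card_filter_not _
  have hcount : W.card * 2 ≤ U.card * 3 := by
    refine Finset.card_mul_le_card_mul G.Adj (fun w hw => ?_) (fun u hu => ?_)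
    · have hw' := Finset.mem_filter.1 hw
      rw [← hw'.2]
      refine Finset.card_le_card fun x hx => ?_
      rw [mem_neighborsIn] at hx
      refine Finset.mem_filter.2 ⟨Finset.mem_filter.2 ⟨hx.1, fun h2 => ?_⟩, hx.2⟩
      exact not_adj_of_not_reducible hG le_rfl hkA hdeg hred hw'.1 hx.1 hw'.2.le h2.le hx.2
    · have hu' := Finset.mem_filter.1 hu
      refine (Finset.card_le_card fun x hx => ?_).trans (hdeg u hu'.1)
      have hx' := Finset.mem_filter.1 hx
      exact mem_neighborsIn.2 ⟨(Finset.mem_filter.1 hx'.1).1, hx'.2.symm⟩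
  have hsplit : ∑ v ∈ A, (neighborsIn G A v).card = W.card * 2 + U.card * 3 := by
    rw [← Finset.sum_filter_add_sum_filter_not A fun v => (neighborsIn G A v).card = 2]
    congr 1
    · exact Finset.sum_const_nat fun v hv => (Finset.mem_filter.1 hv).2
    · refine Finset.sum_const_nat fun v hv => ?_
      have hv' := Finset.mem_filter.1 hv
      have := htwo v hv'.1
      have := hdeg v hv'.1
      omega
  have := hsum A (by rw [← Finset.card_pos]; omega)
  omega

end Configurations

theorem twoDegenerate_of_sum_lt
    (hsum : ∀ B : Finset V, B.Nonempty → ∑ v ∈ B, (neighborsIn G B v).card < 3 * B.card) :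
    TwoDegenerate G := by
  intro B hB
  obtain ⟨v, hv, h⟩ := Finset.exists_lt_of_sum_lt (s := B) (g := fun _ => 3)
    (f := fun v => (neighborsIn G B v).card)
    (by simpa [mul_comm] using hsum B hB)
  exact ⟨v, hv, by omega⟩

theorem two_mul_inducedEdgeCount (A : Finset V) :
    2 * inducedEdgeCount G A = ∑ v ∈ A, (neighborsIn G A v).card := by
  have hcard : ((A ×ˢ A).filter fun p => G.Adj p.1 p.2).card =
      ∑ v ∈ A, (neighborsIn G A v).card := by
    rw [Finset.card_filter, Finset.sum_product]
    simp [neighborsIn]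
  have heven : 2 ∣ ((A ×ˢ A).filter fun p => G.Adj p.1 p.2).card := by
    rw [← ZMod.natCast_eq_zero_iff, Finset.cast_card]
    refine Finset.sum_involution (fun p _ => p.swap) (fun p _ => by decide) (fun p hp _ h => ?_)
      (fun p hp => ?_) (fun p _ => by simp)
    · have hadj := (Finset.mem_filter.1 hp).2
      exact hadj.ne (congrArg Prod.snd h)
    · simp only [Finset.mem_filter, Finset.mem_product, Prod.fst_swap, Prod.snd_swap] at hp ⊢
      exact ⟨⟨hp.1.2, hp.1.1⟩, hp.2.symm⟩
  rw [inducedEdgeCount, Nat.mul_div_cancel' heven, hcard]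

theorem MadLT.sum_lt [Fintype V] {q : ℚ} (h : MadLT G q) {B : Finset V} (hB : B.Nonempty) :
    ((∑ v ∈ B, (neighborsIn G B v).card : ℕ) : ℚ) < q * B.card := by
  have hpos : (0 : ℚ) < B.card := by exact_mod_cast hB.card_pos
  rw [← two_mul_inducedEdgeCount, ← div_lt_iff₀ hpos]
  exact_mod_cast h B hB

theorem card_neighborsIn_le_maxDegree [Fintype V] (A : Finset V) (v : V) :
    (neighborsIn G A v).card ≤ G.maxDegree := by
  refine le_trans (Finset.card_le_card fun x hx => ?_) (G.degree_le_maxDegree v)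
  simpa using (mem_neighborsIn.1 hx).2

theorem equitablyChoosable_of_reducible [Fintype V] {k : ℕ} (hk : 0 < k)
    (h : ∀ A : Finset V, k < A.card → Reducible G k A) : EquitablyChoosable G k := by
  intro L hL
  obtain ⟨f, hfL, hfadj, hfcard⟩ := equitablyColorableOn_of_reducible hk hL h Finset.univ
  exact ⟨f, fun v => hfL v (Finset.mem_univ v),
    fun u v => hfadj u (Finset.mem_univ u) v (Finset.mem_univ v), by simpa using hfcard⟩

theorem equitablyChoosable_of_madLT_three [Fintype V] (h : MadLT G 3) {k : ℕ} (hk : 4 ≤ k)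
    (hdeg : G.maxDegree ≤ k) : EquitablyChoosable G k := by
  have hsum : ∀ B : Finset V, B.Nonempty →
      ∑ v ∈ B, (neighborsIn G B v).card < 3 * B.card := fun B hB => by
    exact_mod_cast h.sum_lt hB
  exact equitablyChoosable_of_reducible (by omega) fun A hA =>
    reducible_of_sum_lt_three_mul hk (twoDegenerate_of_sum_lt hsum) hsum hA
      fun v _ => (card_neighborsIn_le_maxDegree A v).trans hdeg

end EquitableReduction

/-- **Dong–Zhang.** If `mad(G) < 3`, then `G` is equitably `k`-choosable for every
`k ≥ max {Δ(G), 4}`; and if `mad(G) < 12/5`, then `G` is equitably `k`-choosable for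
every `k ≥ max {Δ(G), 3}`. -/
theorem dong_zhang_mad {V : Type*} [Fintype V] [DecidableEq V] (G : SimpleGraph V)
    [DecidableRel G.Adj] :
    (MadLT G 3 → ∀ k : ℕ, max G.maxDegree 4 ≤ k → EquitablyChoosable G k) ∧
    (MadLT G (12 / 5) → ∀ k : ℕ, max G.maxDegree 3 ≤ k → EquitablyChoosable G k) := by
  refine ⟨fun h k hk => equitablyChoosable_of_madLT_three h (le_of_max_le_right hk)
    (le_of_max_le_left hk), fun h k hk => ?_⟩
  rcases (le_of_max_le_right hk).eq_or_lt with rfl | hk4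
  · have hsum : ∀ B : Finset V, B.Nonempty →
        5 * ∑ v ∈ B, (neighborsIn G B v).card < 12 * B.card := fun B hB => by
      have := h.sum_lt hB
      rw [div_mul_eq_mul_div, lt_div_iff₀ (by norm_num), mul_comm] at this
      exact_mod_cast this
    have hdegen : TwoDegenerate G := twoDegenerate_of_sum_lt fun B hB => by
      have := hsum B hB
      have := hB.card_pos
      omega
    exact equitablyChoosable_of_reducible (by omega) fun A hA =>
      reducible_of_five_mul_sum_lt hdegen hsum hA
        fun v _ => (card_neighborsIn_le_maxDegree A v).trans (le_of_max_le_left hk)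
  · exact equitablyChoosable_of_madLT_three (fun A hA => (h A hA).trans (by norm_num)) hk4
      (le_of_max_le_left hk)
end

section
/- For each integer k ≥ 3, the star K_{1,2k} is equitably k-choosable but has no equitable k-coloring. -/
/-- The star `K_{1,2k}`: the vertex `0` of `Fin (2k+1)` is the center, adjacent to the
`2k` other vertices, which form an independent set. -/
def starGraph (k : ℕ) : SimpleGraph (Fin (2 * k + 1)) :=
  SimpleGraph.fromRel fun u _ => u = 0

open Finset in
/-- Greedy coloring with bounded multiplicities: if the lists `L v`, each color being usable `t`
times, always offer at least `s.card` slots, then `s` can be colored from the lists so that no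
color is used more than `t` times. -/
theorem exists_list_choice_card_fiber_le {α β : Type*} [DecidableEq α] [DecidableEq β]
    [Nonempty β] (L : α → Finset β) (t : ℕ) (s : Finset α)
    (hs : ∀ v ∈ s, s.card ≤ t * (L v).card) :
    ∃ f : α → β, (∀ v ∈ s, f v ∈ L v) ∧ ∀ c, (s.filter fun v => f v = c).card ≤ t := by
  induction s using Finset.induction_on with
  | empty => exact ⟨fun _ => Classical.arbitrary β, by simp, by simp⟩
  | insert a s ha ih =>
    rw [card_insert_of_notMem ha] at hs
    obtain ⟨f, hf, hft⟩ := ih fun v hv => by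
      have := hs v (mem_insert_of_mem hv)
      lia
    obtain ⟨c, hc, hct⟩ : ∃ c ∈ L a, (s.filter fun v => f v = c).card < t :=
      exists_card_fiber_lt_of_card_lt_mul (by
        have := hs a (mem_insert_self a s)
        rw [mul_comm] at this
        lia)
    have hfilter : ∀ d, (s.filter fun v => Function.update f a c v = d) =
        s.filter fun v => f v = d := fun d =>
      filter_congr fun v hv => by
        rw [Function.update_of_ne (ne_of_mem_of_not_mem hv ha)]
    refine ⟨Function.update f a c, fun v hv => ?_, fun d => ?_⟩
    · obtain rfl | hv := mem_insert.1 hv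
      · simpa using hc
      · rw [Function.update_of_ne (ne_of_mem_of_not_mem hv ha)]
        exact hf v hv
    · rw [filter_insert, hfilter, Function.update_self]
      split_ifs with h
      · subst h
        exact (card_insert_le _ _).trans hct
      · exact hft d

theorem starGraph_adj {k : ℕ} {u v : Fin (2 * k + 1)} :
    (starGraph k).Adj u v ↔ u ≠ v ∧ (u = 0 ∨ v = 0) :=
  SimpleGraph.fromRel_adj _ _ _

open Finset in
theorem equitablyChoosable_starGraph {k : ℕ} (hk : 3 ≤ k) :
    EquitablyChoosable (starGraph k) k := by
  intro L hL
  obtain ⟨c, hc⟩ : (L 0).Nonempty := card_pos.1 (by rw [hL]; lia)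
  obtain ⟨f, hf, hf3⟩ := exists_list_choice_card_fiber_le (fun v => (L v).erase c) 3
    (univ.erase (0 : Fin (2 * k + 1))) fun v _ => by
      have := pred_card_le_card_erase (s := L v) (a := c)
      rw [hL] at this
      rw [card_erase_of_mem (mem_univ _), card_univ, Fintype.card_fin]
      lia
  have hleaf : ∀ v, v ≠ 0 → f v ≠ c ∧ f v ∈ L v := fun v hv =>
    mem_erase.1 (hf v (mem_erase.2 ⟨hv, mem_univ v⟩))
  have hbound : (Fintype.card (Fin (2 * k + 1)) + k - 1) / k = 3 := by
    rw [Fintype.card_fin, show 2 * k + 1 + k - 1 = 3 * k by lia]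
    exact Nat.mul_div_cancel 3 (by lia)
  refine ⟨Function.update f 0 c, fun v => ?_, fun u v huv => ?_, fun d => ?_⟩
  · obtain rfl | hv := eq_or_ne v 0
    · simpa using hc
    · simpa [hv] using (hleaf v hv).2
  · obtain ⟨hne, rfl | rfl⟩ := starGraph_adj.1 huv
    · simpa [hne.symm] using (hleaf v hne.symm).1.symm
    · simpa [hne] using (hleaf u hne).1
  · rw [hbound]
    obtain rfl | hd := eq_or_ne d c
    · have hsub : (univ.filter fun v => Function.update f 0 d v = d) ⊆ {0} := fun v hv => by
        by_contra h
        rw [mem_singleton] at h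
        simp [h, (hleaf v h).1] at hv
      exact (card_le_card hsub).trans (by simp)
    · refine (card_le_card fun v hv => ?_).trans (hf3 d)
      obtain rfl | h := eq_or_ne v 0
      · simp [hd.symm] at hv
      · simpa [h] using hv

open Finset in
theorem not_exists_equitable_coloring_starGraph {k : ℕ} :
    ¬ ∃ f : Fin (2 * k + 1) → Fin k,
        (∀ ⦃u v : Fin (2 * k + 1)⦄, (starGraph k).Adj u v → f u ≠ f v) ∧
        (∀ c c' : Fin k,
          (Finset.univ.filter fun v => f v = c).card ≤
            (Finset.univ.filter fun v => f v = c').card + 1) := by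
  rintro ⟨f, hf, heq⟩
  have hcenter : (univ.filter fun v => f v = f 0) = {0} := by
    ext v
    simp only [mem_filter, mem_univ, true_and, mem_singleton]
    refine ⟨fun h => ?_, fun h => h ▸ rfl⟩
    by_contra hv
    exact hf (starGraph_adj.2 ⟨hv, Or.inr rfl⟩) h
  have hle : ∀ c, (univ.filter fun v => f v = c).card ≤ 2 := fun c => by
    simpa [hcenter] using heq c (f 0)
  have hcard : 2 * k + 1 = ∑ c, (univ.filter fun v => f v = c).card := by
    simpa using card_eq_sum_card_fiberwise (f := f) (s := univ) (t := univ) (by simp)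
  have hsum : ∑ c, (univ.filter fun v => f v = c).card ≤ ∑ _c : Fin k, 2 :=
    sum_le_sum fun c _ => hle c
  simp only [sum_const, card_univ, Fintype.card_fin, smul_eq_mul] at hsum
  lia

/-- For each integer `k ≥ 3`, the star `K_{1,2k}` is equitably `k`-choosable but has no
equitable `k`-coloring. -/
theorem star_choosable_not_colorable (k : ℕ) (hk : 3 ≤ k) :
    EquitablyChoosable (starGraph k) k ∧
    ¬ ∃ f : Fin (2 * k + 1) → Fin k,
        (∀ ⦃u v : Fin (2 * k + 1)⦄, (starGraph k).Adj u v → f u ≠ f v) ∧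
        (∀ c c' : Fin k,
          (Finset.univ.filter fun v => f v = c).card ≤
            (Finset.univ.filter fun v => f v = c').card + 1) := by
  exact ⟨equitablyChoosable_starGraph hk, not_exists_equitable_coloring_starGraph⟩
end
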